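/- arXiv:math/9908022 — 3 statements merged into one kernel-verified Lean document; each statement's English description precedes it below -/
import Mathlib

section
/- (Intersection theorem, rigidity part.) Let (A, 𝔪) be a commutative Noetherian local ring which is an algebra over ℂ, of Krull dimension d. Let 0 → M_d → M_{d-1} → ⋯ → M_0 → 0 be a chain complex of finitely generated free A-modules, concentrated in homological degrees 0,…,d, such that every homology module H_i(M_•) has finite length and such that H_0(M_•) is isomorphic to the residue field A/𝔪. Then H_i(M_•) = 0 for all i ≠ 0 (so M_• is a finite free resolution of A/𝔪 of length d) and A is a regular local ring. -/
section AlmostAcyclic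

variable {B : Type*} [CommRing B]

/-- A quantitative acyclicity lemma. -/
theorem almost_exact_of_almost_regular {N : ℕ → Type*} [∀ i, AddCommGroup (N i)]
    [∀ i, Module B (N i)] (d : ℕ) (φ : ∀ i, N (i + 1) →ₗ[B] N i)
    (hφ : ∀ i x, φ i (φ (i + 1) x) = 0) (hN : ∀ i, d < i → Subsingleton (N i))
    (y : ℕ → B) (c : B)
    (hy : ∀ j < d, ∃ h : ∀ i, N i →ₗ[B] N (i + 1),
      ∀ i x, φ (i + 1) (h (i + 1) x) + h i (φ i x) = y j • x)
    (hreg : ∀ j < d, ∀ i, ∀ a : N i,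
      y j • a ∈ Ideal.span (y '' Set.Iio j) • (⊤ : Submodule B (N i)) →
      c • a ∈ Ideal.span (y '' Set.Iio j) • (⊤ : Submodule B (N i)))
    (k j : ℕ) (hkj : k + j = d) (i : ℕ) (hi : j ≤ i) (x : N (i + 1))
    (hx : φ i x ∈ Ideal.span (y '' Set.Iio j) • (⊤ : Submodule B (N i))) :
    ∃ v : N (i + 1 + 1), c ^ k • x - φ (i + 1) v ∈
      Ideal.span (y '' Set.Iio j) • (⊤ : Submodule B (N (i + 1))) := by
  have hmap : ∀ (J : Ideal B) (i i' : ℕ) (f : N i →ₗ[B] N i') (a : N i),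
      a ∈ J • (⊤ : Submodule B (N i)) → f a ∈ J • (⊤ : Submodule B (N i')) := by
    intro J i i' f a ha
    have := Submodule.mem_map_of_mem (f := f) ha
    rw [Submodule.map_smul''] at this
    exact Submodule.smul_mono le_rfl le_top this
  induction k generalizing j i with
  | zero =>
    have := hN (i + 1) (by omega)
    exact ⟨0, by rw [Subsingleton.elim (c ^ 0 • x - φ (i + 1) 0) 0]; exact zero_mem _⟩
  | succ k ih =>
    obtain ⟨h, hh⟩ := hy j (by omega)
    set J := Ideal.span (y '' Set.Iio j) with hJ
    have hJs : Ideal.span (y '' Set.Iio (j + 1)) = J ⊔ Ideal.span {y j} := by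
      rw [hJ, ← Ideal.span_union]
      congr 1
      ext b
      simp only [Set.mem_image, Set.mem_Iio, Set.mem_union, Set.mem_singleton_iff]
      constructor
      · rintro ⟨m, hm, rfl⟩
        rcases Nat.lt_succ_iff_lt_or_eq.mp hm with h | h
        · exact Or.inl ⟨m, h, rfl⟩
        · exact Or.inr (by rw [h])
      · rintro (⟨m, hm, rfl⟩ | rfl)
        · exact ⟨m, by omega, rfl⟩
        · exact ⟨j, by omega, rfl⟩
    have hw : φ (i + 1) (h (i + 1) x) ∈
        Ideal.span (y '' Set.Iio (j + 1)) • (⊤ : Submodule B (N (i + 1))) := by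
      rw [hJs, eq_sub_of_add_eq (hh i x)]
      refine sub_mem ?_ ?_
      · exact Submodule.smul_mem_smul
          (Ideal.mem_sup_right (Ideal.mem_span_singleton_self _)) Submodule.mem_top
      · exact Submodule.smul_mono_left le_sup_left (hmap J _ _ (h i) _ hx)
    obtain ⟨v, hv⟩ := ih (j + 1) (by omega) (i + 1) (by omega) (h (i + 1) x) hw
    rw [hJs, Submodule.sup_smul, Submodule.ideal_span_singleton_smul] at hv
    obtain ⟨q, hq, t, ht, hqt⟩ := Submodule.mem_sup.mp hv
    obtain ⟨t, -, rfl⟩ := ht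
    refine ⟨c • t, ?_⟩
    have key : y j • (c ^ k • x - φ (i + 1) t) ∈ J • (⊤ : Submodule B (N (i + 1))) := by
      have e1 := congrArg (φ (i + 1)) hqt
      simp only [map_add, map_sub, map_smul, hφ, sub_zero] at e1
      rw [eq_sub_of_add_eq (hh i x)] at e1
      have : y j • (c ^ k • x - φ (i + 1) t) = φ (i + 1) q + c ^ k • h i (φ i x) := by
        have e2 : φ (i + 1) ((DistribSMul.toLinearMap B (N (i + 1 + 1)) (y j)) t)
            = y j • φ (i + 1) t := map_smul _ _ _
        rw [e2] at e1
        rw [smul_sub, smul_comm, eq_sub_of_add_eq e1, smul_sub]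
        abel
      rw [this]
      exact add_mem (hmap J _ _ _ _ hq) (Submodule.smul_mem _ _ (hmap J _ _ (h i) _ hx))
    have := hreg j (by omega) _ _ key
    rwa [smul_sub, smul_smul, ← pow_succ', ← map_smul] at this

end AlmostAcyclic

section KoszulComparison

variable {B : Type*} [CommRing B]

theorem mem_ideal_smul_top_pi_iff {ι : Type*} [Finite ι] (J : Ideal B) (x : ι → B) :
    x ∈ J • (⊤ : Submodule B (ι → B)) ↔ ∀ k, x k ∈ J := by
  classical
  have := Fintype.ofFinite ι
  constructor
  · intro hx k
    induction hx using Submodule.smul_induction_on' with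
    | smul a ha m _ => exact J.mul_mem_right _ ha
    | add x _ y _ hx hy => exact J.add_mem hx hy
  · intro hx
    rw [pi_eq_sum_univ x]
    exact sum_mem fun k _ ↦ Submodule.smul_mem_smul (hx k) Submodule.mem_top

theorem exists_eq_sum_smul_of_mem_span {ι : Type*} [Finite ι] {n : ℕ} {z : Fin n → B}
    {x : ι → B} (hx : ∀ k, x k ∈ Ideal.span (Set.range z)) :
    ∃ q : Fin n → ι → B, x = ∑ l, z l • q l := by
  have h := fun k ↦ Ideal.mem_span_range_iff_exists_fun.mp (hx k)
  choose q hq using h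
  refine ⟨fun l k ↦ q k l, funext fun k ↦ ?_⟩
  simp [Finset.sum_apply, ← hq k, mul_comm]

/-- The Koszul differential, on functions on words instead of on alternating functions. -/
def koszulDiff {n : ℕ} (z : Fin n → B) {N : Type*} [AddCommGroup N] [Module B N] :
    (List (Fin n) → N) → List (Fin n) → N
  | _, [] => 0
  | f, a :: T => z a • f T - koszulDiff z (fun T' ↦ f (a :: T')) T

variable {n : ℕ} (z : Fin n → B) {N N' : Type*} [AddCommGroup N] [Module B N]
  [AddCommGroup N'] [Module B N']

theorem koszulDiff_sub (f g : List (Fin n) → N) (T : List (Fin n)) :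
    koszulDiff z (fun T ↦ f T - g T) T = koszulDiff z f T - koszulDiff z g T := by
  induction T generalizing f g with
  | nil => simp [koszulDiff]
  | cons a T ih => simp only [koszulDiff, ih, smul_sub]; abel

theorem koszulDiff_map (φ : N →ₗ[B] N') (f : List (Fin n) → N) (T : List (Fin n)) :
    koszulDiff z (fun T ↦ φ (f T)) T = φ (koszulDiff z f T) := by
  induction T generalizing f with
  | nil => simp [koszulDiff]
  | cons a T ih => simp only [koszulDiff, map_sub, map_smul, ih]

theorem koszulDiff_smul (c : B) (f : List (Fin n) → N) (T : List (Fin n)) :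
    koszulDiff z (fun T ↦ c • f T) T = c • koszulDiff z f T :=
  koszulDiff_map z (LinearMap.lsmul B N c) f T

theorem koszulDiff_koszulDiff (f : List (Fin n) → N) (T : List (Fin n)) :
    koszulDiff z (koszulDiff z f) T = 0 := by
  induction T generalizing f with
  | nil => simp [koszulDiff]
  | cons a T ih =>
    have h : (fun T' ↦ koszulDiff z f (a :: T')) =
        fun T' ↦ z a • f T' - koszulDiff z (fun T'' ↦ f (a :: T'')) T' := rfl
    rw [koszulDiff, h, koszulDiff_sub, koszulDiff_smul, ih, sub_zero, sub_self]

theorem exists_koszulDiff_eq_sum (f : List (Fin n) → N) (T : List (Fin n)) (hT : T.Nodup) :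
    ∃ b : Fin n → N, koszulDiff z f T = ∑ l, z l • b l ∧ (∀ l, l ∉ T → b l = 0) ∧
      ∀ a T', T = a :: T' → b a = f T' := by
  induction T generalizing f with
  | nil => exact ⟨0, by simp [koszulDiff]⟩
  | cons a T ih =>
    rw [List.nodup_cons] at hT
    obtain ⟨b, hb, hb0, -⟩ := ih (fun T' ↦ f (a :: T')) hT.2
    refine ⟨fun l ↦ (if l = a then f T else 0) - b l, ?_, ?_, ?_⟩
    · simp [koszulDiff, hb, smul_sub, Finset.sum_sub_distrib]
    · intro l hl
      simp only [List.mem_cons, not_or] at hl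
      simp [hl.1, hb0 l hl.2]
    · intro a' T' h
      obtain ⟨rfl, rfl⟩ := List.cons.inj h
      simp [hb0 a hT.1]

/-- The key estimate: a complex of free modules of length `d < n` whose degree-zero part looks
like a minimal presentation of `B ⧸ (z₁, …, zₙ)` and which is annihilated, up to homotopy, by an
almost regular sequence of length `d` forces a fixed power of the defect `c` into
`(z₁, …, zₙ)`. -/
theorem pow_mem_span_of_almost_regular {d : ℕ} (hdn : d < n) (r : ℕ → ℕ)
    (φ : ∀ i, (Fin (r (i + 1)) → B) →ₗ[B] (Fin (r i) → B))
    (hφ : ∀ i x, φ i (φ (i + 1) x) = 0) (hr : ∀ i, d < i → r i = 0)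
    (u : Fin (r 0) → B) (g : Fin n → Fin (r 1) → B) (hg : ∀ l, φ 0 (g l) = z l • u)
    (χ : Fin n → (Fin (r 1) → B) →ₗ[B] B)
    (hχg : ∀ l j, χ l (g j) - (if l = j then 1 else 0) ∈ Ideal.span (Set.range z))
    (hχφ : ∀ l x, χ l (φ 1 x) ∈ Ideal.span (Set.range z))
    (ε : (Fin (r 0) → B) →ₗ[B] B) (hεu : ε u = 1)
    (hεφ : ∀ x, ε (φ 0 x) ∈ Ideal.span (Set.range z))
    (y : ℕ → B) (c : B)
    (hy : ∀ j < d, ∃ h : ∀ i, (Fin (r i) → B) →ₗ[B] (Fin (r (i + 1)) → B),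
      ∀ i x, φ (i + 1) (h (i + 1) x) + h i (φ i x) = y j • x)
    (hreg : ∀ j < d, ∀ a : B, y j * a ∈ Ideal.span (y '' Set.Iio j) →
      c * a ∈ Ideal.span (y '' Set.Iio j)) :
    c ^ (2 * d * (d + 1)) ∈ Ideal.span (Set.range z) := by
  have hN : ∀ i, d < i → Subsingleton (Fin (r i) → B) := by
    intro i hi
    have : IsEmpty (Fin (r i)) := by rw [hr i hi]; infer_instance
    infer_instance
  have hex : ∀ i (x : Fin (r (i + 1)) → B), φ i x = 0 → ∃ v, φ (i + 1) v = c ^ d • x := by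
    intro i x hx
    obtain ⟨v, hv⟩ := almost_exact_of_almost_regular d φ hφ hN y c hy
      (by
        intro j hj i a ha
        rw [mem_ideal_smul_top_pi_iff] at ha ⊢
        exact fun k ↦ hreg j hj _ (ha k)) d 0 rfl i (Nat.zero_le _) x
      (by rw [hx]; exact zero_mem _)
    refine ⟨v, ?_⟩
    have : (Set.Iio (0 : ℕ)) = ∅ := by ext; simp
    exact (sub_eq_zero.mp (by simpa [this] using hv)).symm
  have hrel : ∀ b : Fin n → B, ∑ l, z l * b l = 0 →
      ∀ l, c ^ d * b l ∈ Ideal.span (Set.range z) := by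
    intro b hb l
    obtain ⟨v, hv⟩ := hex 0 (∑ j, b j • g j) (by
      simp only [map_sum, map_smul, hg, smul_smul]
      rw [← Finset.sum_smul]
      simp only [mul_comm (b _), hb, zero_smul])
    have h1 := hχφ l v
    rw [hv, map_smul, map_sum] at h1
    have h2 : ∑ j, b j * (χ l (g j) - if l = j then 1 else 0) ∈ Ideal.span (Set.range z) :=
      sum_mem fun j _ ↦ Ideal.mul_mem_left _ _ (hχg l j)
    simp only [mul_sub, Finset.sum_sub_distrib, mul_ite, mul_one, mul_zero,
      Finset.sum_ite_eq, Finset.mem_univ, if_true] at h2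
    have h3 := sub_mem h1 (Ideal.mul_mem_left _ (c ^ d) h2)
    convert h3 using 1
    simp only [map_smul, smul_eq_mul]
    ring
  have hrelN : ∀ i (b : Fin n → Fin (r i) → B), ∑ l, z l • b l = 0 →
      ∀ l, ∃ q : Fin n → Fin (r i) → B, c ^ d • b l = ∑ l, z l • q l := by
    intro i b hb l
    refine exists_eq_sum_smul_of_mem_span fun k ↦ ?_
    refine hrel (fun l ↦ b l k) ?_ l
    simpa [Finset.sum_apply] using congrFun hb k
  have hdesc : ∀ k m, k + m = d + 1 → ∀ f : List (Fin n) → Fin (r m) → B,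
      (∀ T, ∃ v, φ m v = c ^ d • koszulDiff z f T) → ∀ T : List (Fin n), T.Nodup → T.length = m →
      ∃ v, ∃ q : Fin n → Fin (r m) → B, c ^ (2 * d * k) • f T = φ m v + ∑ l, z l • q l := by
    intro k
    induction k with
    | zero =>
      intro m hm f _ T _ _
      have := hN m (by omega)
      exact ⟨0, 0, Subsingleton.elim _ _⟩
    | succ k ih =>
      intro m hm f hf T hT hTm
      choose f' hf' using hf
      have hf'' : ∀ T, ∃ v, φ (m + 1) v = c ^ d • koszulDiff z f' T := by
        intro T
        refine hex m _ ?_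
        rw [← koszulDiff_map, funext hf', koszulDiff_smul]
        exact (congrArg _ (koszulDiff_koszulDiff z f T)).trans (smul_zero _)
      obtain ⟨a, ha⟩ : ∃ a, a ∉ T := by
        by_contra! h
        have := Finset.card_le_card (fun a _ ↦ List.mem_toFinset.mpr (h a) :
          (Finset.univ : Finset (Fin n)) ⊆ T.toFinset)
        have := T.toFinset_card_le
        simp at *
        omega
      have haT : (a :: T).Nodup := List.nodup_cons.mpr ⟨ha, hT⟩
      obtain ⟨v, q, hvq⟩ := ih (m + 1) (by omega) f' hf'' (a :: T) haT (by simp [hTm])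
      obtain ⟨b, hb, -, hba⟩ := exists_koszulDiff_eq_sum z f (a :: T) haT
      have h1 := congrArg (φ m) hvq
      simp only [map_add, map_smul, map_sum, hφ, zero_add, hf', hb] at h1
      obtain ⟨q', hq'⟩ := hrelN m (fun l ↦ c ^ (2 * d * k + d) • b l - φ m (q l)) (by
        simp only [smul_sub, Finset.sum_sub_distrib, ← h1, Finset.smul_sum, smul_smul]
        refine sub_eq_zero.mpr (Finset.sum_congr rfl fun l _ ↦ ?_)
        congr 1
        ring) a
      refine ⟨c ^ d • q a, q', ?_⟩
      rw [← hq', hba a T rfl, map_smul, smul_sub, smul_smul, ← pow_add,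
        show 2 * d * (k + 1) = d + (2 * d * k + d) by ring]
      abel
  have hf0 : ∀ T, ∃ v, φ 0 v = koszulDiff z (fun _ ↦ u) T := by
    intro T
    induction T with
    | nil => exact ⟨0, by simp [koszulDiff]⟩
    | cons a T ih =>
      obtain ⟨v, hv⟩ := ih
      exact ⟨g a - v, by simp [koszulDiff, hg, hv]⟩
  obtain ⟨v, q, hvq⟩ := hdesc (d + 1) 0 rfl (fun _ ↦ u)
    (fun T ↦ (hf0 T).elim fun v hv ↦ ⟨c ^ d • v, by rw [map_smul, hv]⟩) [] List.nodup_nil rfl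
  have h := congrArg ε hvq
  simp only [map_smul, hεu, smul_eq_mul, mul_one, map_add, map_sum] at h
  rw [h]
  exact add_mem (hεφ v) (sum_mem fun l _ ↦
    Ideal.mul_mem_right _ _ (Ideal.subset_span ⟨l, rfl⟩))

end KoszulComparison

section CharPModels

theorem Int.isJacobsonRing : IsJacobsonRing ℤ := by
  rw [isJacobsonRing_iff_prime_eq]
  intro P hP
  by_cases h : P = ⊥
  · subst h
    refine le_antisymm (fun n hn ↦ ?_) Ideal.le_jacobson
    by_contra hn0
    obtain ⟨p, hpn, hp⟩ := Nat.exists_infinite_primes (n.natAbs + 1)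
    have hpI : Prime (p : ℤ) := Nat.prime_iff_prime_int.mp hp
    have hmax : (Ideal.span {(p : ℤ)}).IsMaximal :=
      PrincipalIdealRing.isMaximal_of_irreducible hpI.irreducible
    have := Ideal.mem_sInf.mp hn ⟨bot_le, hmax⟩
    rw [Ideal.mem_span_singleton] at this
    have h1 := Nat.le_of_dvd (Int.natAbs_pos.mpr hn0) (Int.natCast_dvd.mp this)
    omega
  · have := hP.isMaximal h
    exact Ideal.jacobson_eq_self_of_isMaximal

/-- A domain that is finitely generated over `ℤ` maps to a field of positive characteristic
without killing a prescribed nonzero element. -/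
theorem exists_ringHom_field_charP {S : Type} [CommRing S] [IsDomain S] [Algebra.FiniteType ℤ S]
    {s : S} (hs : s ≠ 0) : ∃ (p : ℕ) (_ : p.Prime) (T : Type) (_ : Field T) (_ : CharP T p)
      (h : S →+* T), h s ≠ 0 := by
  have := Int.isJacobsonRing
  have : Nontrivial (Localization.Away s) := by
    refine (IsLocalization.injective (Localization.Away s)
      (powers_le_nonZeroDivisors_of_noZeroDivisors hs)).nontrivial
  obtain ⟨m, hm⟩ := Ideal.exists_maximal (Localization.Away s)
  let _ : Field (Localization.Away s ⧸ m) := Ideal.Quotient.field m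
  have h1 : Algebra.FiniteType S (Localization.Away s) := IsLocalization.finiteType_of_monoid_fg
    (Submonoid.powers s) _
  have h2 : Algebra.FiniteType ℤ (Localization.Away s) := Algebra.FiniteType.trans (S := S) ‹_› h1
  have h3 : Algebra.FiniteType ℤ (Localization.Away s ⧸ m) :=
    Algebra.FiniteType.of_surjective (Ideal.Quotient.mkₐ ℤ m) (Ideal.Quotient.mkₐ_surjective ℤ m)
  have h4 := finite_of_finite_type_of_isJacobsonRing ℤ (Localization.Away s ⧸ m)
  obtain ⟨p, hp⟩ := CharP.exists (Localization.Away s ⧸ m)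
  have hp0 : p ≠ 0 := by
    rintro rfl
    have := CharP.charP_to_charZero (Localization.Away s ⧸ m)
    have hinj : Function.Injective (algebraMap ℤ (Localization.Away s ⧸ m)) :=
      RingHom.injective_int _
    have := (Algebra.IsIntegral.isField_iff_isField hinj).mpr (Field.toIsField _)
    exact Int.not_isField this
  refine ⟨p, (CharP.char_is_prime_or_zero (Localization.Away s ⧸ m) p).resolve_right hp0, _, _, hp,
    (Ideal.Quotient.mk m).comp (algebraMap S _), ?_⟩
  exact ((IsLocalization.Away.algebraMap_isUnit s).map (Ideal.Quotient.mk m)).ne_zero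

/-- Every finite subset of `R` is contained in a subring that admits a homomorphism to a domain of
positive characteristic, not killing a prescribed nonzero element, and such that the ideal
generated by the image of `X` is generated by a sequence all of whose powers are regular. -/
def HasCharPModels {R : Type} [CommRing R] (d : ℕ) (X : Fin d → R) : Prop :=
  ∀ Z : Set R, Z.Finite → ∀ s : R, s ≠ 0 → ∃ S : Subring R, Z ⊆ S ∧
    ∃ (x : Fin d → S) (s' : S), (∀ i, (x i : R) = X i) ∧ (s' : R) = s ∧
    ∃ (p : ℕ) (_ : p.Prime) (T : Type) (_ : CommRing T) (_ : IsDomain T) (_ : CharP T p)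
      (h : S →+* T) (ζ : ℕ → T), h s' ≠ 0 ∧
      Ideal.span (Set.range fun i ↦ h (x i)) = Ideal.span (ζ '' Set.Iio d) ∧
      ⨅ t : ℕ, Ideal.span (ζ '' Set.Iio d) ^ t = ⊥ ∧
      ∀ M : ℕ, ∀ j < d, ∀ a : T, ζ j ^ M * a ∈ Ideal.span ((fun i ↦ ζ i ^ M) '' Set.Iio j) →
        a ∈ Ideal.span ((fun i ↦ ζ i ^ M) '' Set.Iio j)

theorem hasCharPModels_zero {R : Type} [CommRing R] [IsDomain R] (X : Fin 0 → R) :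
    HasCharPModels 0 X := by
  intro Z hZ s hs
  let S := Algebra.adjoin ℤ (insert s Z)
  have hZS : insert s Z ⊆ (S : Set R) := Algebra.subset_adjoin
  have : Algebra.FiniteType ℤ S := by
    rw [← Subalgebra.fg_iff_finiteType]
    exact Subalgebra.fg_def.mpr ⟨_, hZ.insert s, rfl⟩
  obtain ⟨p, hp, T, hT, hTp, h, hh⟩ := exists_ringHom_field_charP (S := S)
    (s := ⟨s, hZS (Set.mem_insert _ _)⟩) (fun h ↦ hs (congrArg Subtype.val h))
  refine ⟨S.toSubring, fun z hz ↦ hZS (Set.mem_insert_of_mem _ hz), Fin.elim0,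
    ⟨s, hZS (Set.mem_insert _ _)⟩, fun i ↦ i.elim0, rfl, p, hp, T, inferInstance, inferInstance,
    hTp, h, fun _ ↦ 0, hh, ?_, ?_, ?_⟩
  · simp
  · refine le_bot_iff.mp ((iInf_le _ 1).trans ?_)
    simp
  · intro M j hj
    omega

end CharPModels

section PrimitivePresentation

theorem exists_smul_mem_of_mem_adjoin {O K L : Type*} [CommRing O] [IsDomain O] [Field K]
    [CommRing L] [Algebra O K] [IsFractionRing O K] [Algebra O L] [Algebra K L]
    [IsScalarTower O K L] (A : Subalgebra O L) {S : Set L} (hS : S ⊆ A) {e : L}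
    (he : e ∈ Algebra.adjoin K S) : ∃ o : O, o ≠ 0 ∧ o • e ∈ A := by
  induction he using Algebra.adjoin_induction with
  | mem x hx => exact ⟨1, one_ne_zero, by simpa using hS hx⟩
  | algebraMap k =>
    obtain ⟨a, b, hb, rfl⟩ := IsFractionRing.div_surjective (A := O) k
    refine ⟨b, nonZeroDivisors.ne_zero hb, ?_⟩
    have hb' : algebraMap O K b ≠ 0 := by
      simpa using nonZeroDivisors.ne_zero hb
    rw [Algebra.smul_def, IsScalarTower.algebraMap_apply O K L, ← map_mul,
      mul_div_cancel₀ _ hb', ← IsScalarTower.algebraMap_apply]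
    exact A.algebraMap_mem a
  | add x y _ _ hx hy =>
    obtain ⟨o, ho, hx⟩ := hx
    obtain ⟨o', ho', hy⟩ := hy
    refine ⟨o * o', mul_ne_zero ho ho', ?_⟩
    rw [smul_add]
    refine add_mem ?_ ?_
    · rw [mul_comm, mul_smul]
      exact A.smul_mem hx _
    · rw [mul_smul]
      exact A.smul_mem hy _
  | mul x y _ _ hx hy =>
    obtain ⟨o, ho, hx⟩ := hx
    obtain ⟨o', ho', hy⟩ := hy
    refine ⟨o * o', mul_ne_zero ho ho', ?_⟩
    rw [← smul_mul_smul_comm]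
    exact mul_mem hx hy

theorem exists_smul_mem_of_finite {O L : Type*} [CommRing O] [IsDomain O]
    [CommRing L] [Algebra O L] (A : Subalgebra O L) {S : Set L} (hS : S.Finite)
    (h : ∀ e ∈ S, ∃ o : O, o ≠ 0 ∧ o • e ∈ A) : ∃ o : O, o ≠ 0 ∧ ∀ e ∈ S, o • e ∈ A := by
  induction S, hS using Set.Finite.induction_on with
  | empty => exact ⟨1, one_ne_zero, by simp⟩
  | insert _ _ ih =>
    obtain ⟨o, ho, h1⟩ := ih fun e he ↦ h e (Set.mem_insert_of_mem _ he)
    obtain ⟨o', ho', h2⟩ := h _ (Set.mem_insert _ _)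
    refine ⟨o * o', mul_ne_zero ho ho', ?_⟩
    rintro e (rfl | he)
    · rw [mul_smul]
      exact A.smul_mem h2 _
    · rw [mul_comm, mul_smul]
      exact A.smul_mem (h1 e he) _

/-- Over an integrally closed domain `O` of characteristic zero, finitely many algebraic elements
of a domain are, up to a denominator in `O`, polynomials in a single integral element. -/
theorem exists_integral_primitive_element {O D : Type*} [CommRing O] [IsDomain O] [CharZero O]
    [CommRing D] [IsDomain D] [Algebra O D] [FaithfulSMul O D] {Z : Set D}
    (hZ : Z.Finite) (halg : ∀ z ∈ Z, IsAlgebraic O z) {s : D} (hsZ : s ∈ Z) (hs : s ≠ 0) :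
    ∃ w : D, IsIntegral O w ∧ ∃ G : O, G ≠ 0 ∧
      (∀ z ∈ Z, ∃ P : Polynomial O, algebraMap O D G * z = Polynomial.aeval w P) ∧
      ∃ Q : Polynomial O, s * Polynomial.aeval w Q = algebraMap O D G := by
  let K := FractionRing O
  let L := FractionRing D
  let _ : Algebra K L := FractionRing.liftAlgebra O L
  have : IsScalarTower O K L := inferInstance
  have : CharZero K := charZero_of_injective_algebraMap (IsFractionRing.injective O K)
  let Z' : Set L := algebraMap D L '' Z
  have hZ' : Z'.Finite := hZ.image _
  have hint : ∀ x ∈ Z', IsIntegral K x := by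
    rintro _ ⟨z, hz, rfl⟩
    have h1 : IsAlgebraic O (algebraMap D L z) := (halg z hz).algebraMap
    exact (IsAlgebraic.extendScalars (IsFractionRing.injective O K) h1).isIntegral
  have hfin : Finite Z' := hZ'
  let E := IntermediateField.adjoin K Z'
  have hE : FiniteDimensional K E := IntermediateField.finiteDimensional_adjoin hint
  obtain ⟨α, hα⟩ := Field.exists_primitive_element K E
  have hEadj : E.toSubalgebra = Algebra.adjoin K Z' :=
    IntermediateField.adjoin_toSubalgebra_of_isAlgebraic fun x hx ↦ (hint x hx).isAlgebraic
  have hαE : (α : L) ∈ Algebra.adjoin K Z' := hEadj ▸ α.2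
  have hEα : ∀ e ∈ E, e ∈ Algebra.adjoin K {(α : L)} := by
    intro e he
    have h1 : (⟨e, he⟩ : E) ∈ IntermediateField.adjoin K {α} := hα ▸ IntermediateField.mem_top
    rw [← IntermediateField.mem_toSubalgebra,
      IntermediateField.adjoin_simple_toSubalgebra_of_isAlgebraic
        (Algebra.IsAlgebraic.isAlgebraic α)] at h1
    have h2 : e ∈ (Algebra.adjoin K {α}).map E.val := Subalgebra.mem_map.mpr ⟨_, h1, rfl⟩
    rwa [AlgHom.map_adjoin, Set.image_singleton] at h2
  let A : Subalgebra O L := (IsScalarTower.toAlgHom O D L).range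
  obtain ⟨o, ho, v, hv⟩ := exists_smul_mem_of_mem_adjoin (O := O) A
    (by rintro _ ⟨z, -, rfl⟩; exact ⟨z, rfl⟩) hαE
  have hv : algebraMap D L v = o • (α : L) := hv
  have hvalg : IsAlgebraic O v := by
    rw [← isAlgebraic_algebraMap_iff (IsFractionRing.injective D L), hv]
    refine IsAlgebraic.smul ?_ o
    have : IsAlgebraic K (α : L) :=
      (Algebra.IsAlgebraic.isAlgebraic α).algHom E.val
    exact (IsFractionRing.isAlgebraic_iff O K L).mpr this
  obtain ⟨y, hy, hw⟩ := hvalg.exists_integral_multiple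
  let w := y • v
  have hwα : algebraMap D L w = (y * o) • (α : L) := by
    rw [mul_smul, ← hv]
    simp [w, Algebra.smul_def, IsScalarTower.algebraMap_apply O D L]
  have hαw : (α : L) ∈ Algebra.adjoin K {algebraMap D L w} := by
    have hyo : algebraMap O K (y * o) ≠ 0 := by
      simpa using ⟨hy, ho⟩
    have : (α : L) = (algebraMap O K (y * o))⁻¹ • algebraMap D L w := by
      rw [hwα, ← IsScalarTower.algebraMap_smul K (y * o) (α : L), smul_smul,
        inv_mul_cancel₀ hyo, one_smul]
    rw [this]
    exact Subalgebra.smul_mem _ (Algebra.self_mem_adjoin_singleton _ _) _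
  have hEw : ∀ e ∈ E, e ∈ Algebra.adjoin K {algebraMap D L w} := fun e he ↦
    Algebra.adjoin_le (Set.singleton_subset_iff.mpr hαw) (hEα e he)
  have hZE : Z' ⊆ E := IntermediateField.subset_adjoin K Z'
  obtain ⟨G, hG, hGm⟩ := exists_smul_mem_of_finite
    (Algebra.adjoin O {algebraMap D L w}) (hZ'.insert (algebraMap D L s)⁻¹) (by
      intro e he
      refine exists_smul_mem_of_mem_adjoin (K := K) _ Algebra.subset_adjoin (hEw e ?_)
      rcases he with rfl | he
      · exact E.inv_mem (hZE ⟨s, hsZ, rfl⟩)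
      · exact hZE he)
  have hpoly : ∀ e : L, e ∈ Algebra.adjoin O {algebraMap D L w} →
      ∃ P : Polynomial O, e = algebraMap D L (Polynomial.aeval w P) := by
    intro e he
    rw [Algebra.adjoin_singleton_eq_range_aeval] at he
    obtain ⟨P, rfl⟩ := he
    exact ⟨P, by simp [Polynomial.aeval_algebraMap_apply]⟩
  refine ⟨w, hw, G, hG, ?_, ?_⟩
  · intro z hz
    obtain ⟨P, hP⟩ := hpoly _ (hGm _ (Set.mem_insert_of_mem _ ⟨z, hz, rfl⟩))
    refine ⟨P, IsFractionRing.injective D L ?_⟩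
    rw [← hP, Algebra.smul_def, map_mul, ← IsScalarTower.algebraMap_apply]
  · obtain ⟨Q, hQ⟩ := hpoly _ (hGm _ (Set.mem_insert _ _))
    refine ⟨Q, IsFractionRing.injective D L ?_⟩
    have hs' : algebraMap D L s ≠ 0 := by simpa using hs
    rw [map_mul, ← hQ, Algebra.smul_def, mul_left_comm, mul_inv_cancel₀ hs', mul_one,
      ← IsScalarTower.algebraMap_apply]

open Polynomial in
theorem exists_primitive_presentation {D : Type} [CommRing D] [IsDomain D] [CharZero D]
    {X : Set D} (hXfin : X.Finite) (hX : AlgebraicIndepOn ℤ id X) {Z : Set D} (hZ : Z.Finite)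
    {s : D} (hs : s ≠ 0) :
    ∃ u : Set D, u.Finite ∧ X ⊆ u ∧ ∃ (w : D) (F : (MvPolynomial u ℤ)[X])
      (G : MvPolynomial u ℤ),
      eval₂ (MvPolynomial.aeval ((↑) : u → D) : MvPolynomial u ℤ →ₐ[ℤ] D).toRingHom w F = 0 ∧
      eval₂ (MvPolynomial.aeval ((↑) : u → D) : MvPolynomial u ℤ →ₐ[ℤ] D).toRingHom w
        (derivative F) ≠ 0 ∧
      (∀ P, eval₂ (MvPolynomial.aeval ((↑) : u → D) : MvPolynomial u ℤ →ₐ[ℤ] D).toRingHom w P = 0 →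
        F ∣ P) ∧
      MvPolynomial.aeval ((↑) : u → D) G ≠ 0 ∧
      (∀ z ∈ Z, ∃ P, MvPolynomial.aeval ((↑) : u → D) G * z =
        eval₂ (MvPolynomial.aeval ((↑) : u → D) : MvPolynomial u ℤ →ₐ[ℤ] D).toRingHom w P) ∧
      ∃ Q, s * eval₂ (MvPolynomial.aeval ((↑) : u → D) : MvPolynomial u ℤ →ₐ[ℤ] D).toRingHom w Q =
        MvPolynomial.aeval ((↑) : u → D) G := by
  obtain ⟨u, hXu, hu⟩ := exists_maximal_algebraicIndependent X (X ∪ insert s Z)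
    Set.subset_union_left hX
  have hufin : u.Finite := (hXfin.union (hZ.insert s)).subset hu.prop.2
  have hind : AlgebraicIndependent ℤ ((↑) : u → D) := hu.prop.1
  let _ : Algebra (MvPolynomial u ℤ) D :=
    (MvPolynomial.aeval ((↑) : u → D) : MvPolynomial u ℤ →ₐ[ℤ] D).toRingHom.toAlgebra
  have hinj : Function.Injective (algebraMap (MvPolynomial u ℤ) D) := hind
  have : FaithfulSMul (MvPolynomial u ℤ) D :=
    (faithfulSMul_iff_algebraMap_injective _ _).mpr hinj
  have halg : ∀ z ∈ insert s Z, IsAlgebraic (MvPolynomial u ℤ) z := by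
    intro z hz
    by_cases hzu : z ∈ u
    · have : z = algebraMap (MvPolynomial u ℤ) D (MvPolynomial.X ⟨z, hzu⟩) :=
        (MvPolynomial.aeval_X ((↑) : u → D) ⟨z, hzu⟩).symm
      rw [this]
      exact isAlgebraic_algebraMap _
    · have h1 : ¬ AlgebraicIndepOn ℤ id (insert z u) := fun h ↦
        hzu (hu.le_of_ge ⟨h, Set.insert_subset (Or.inr hz) hu.prop.2⟩ (Set.subset_insert z u)
          (Set.mem_insert z u))
      rw [AlgebraicIndepOn.insert_iff hzu, not_and, Transcendental, not_not] at h1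
      refine (h1 hind).of_ringHom_of_comp_eq
        (((MvPolynomial.aeval ((↑) : u → D) : MvPolynomial u ℤ →ₐ[ℤ] D).codRestrict
          (Algebra.adjoin ℤ (id '' u)) fun p ↦ ?_) : MvPolynomial u ℤ →ₐ[ℤ] _)
        (RingHom.id D) ?_ Function.injective_id ?_
      · rw [Set.image_id, Algebra.adjoin_eq_range]
        exact ⟨p, rfl⟩
      · rintro ⟨x, hx⟩
        obtain ⟨p, rfl⟩ : ∃ p, MvPolynomial.aeval ((↑) : u → D) p = x := by
          rw [Set.image_id, Algebra.adjoin_eq_range] at hx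
          exact hx
        exact ⟨p, rfl⟩
      · rfl
  obtain ⟨w, hw, G, hG, hP, hQ⟩ := exists_integral_primitive_element (hZ.insert s) halg
    (Set.mem_insert _ _) hs
  refine ⟨u, hufin, hXu, w, minpoly (MvPolynomial u ℤ) w, G, minpoly.aeval _ w, ?_,
    fun P hP ↦ minpoly.isIntegrallyClosed_dvd hw hP, ?_,
    fun z hz ↦ hP z (Set.mem_insert_of_mem _ hz), hQ⟩
  · intro h
    have h1 := minpoly.isIntegrallyClosed_dvd hw (p := derivative (minpoly (MvPolynomial u ℤ) w)) h
    have hm := minpoly.monic hw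
    have hpos := minpoly.natDegree_pos hw
    have h2 : derivative (minpoly (MvPolynomial u ℤ) w) ≠ 0 := fun h0 ↦ by
      have := derivative_eq_zero.mp h0
      omega
    exact hm.not_dvd_of_degree_lt h2 (degree_derivative_lt hm.ne_zero) h1
  · exact fun h ↦ hG (hinj (h.trans (map_zero _).symm))

end PrimitivePresentation

section Newton

open Polynomial in
theorem powerSeries_exists_eq_add_X_mul_eval {T : Type*} [CommRing T] (α : PowerSeries T)
    (p : (PowerSeries T)[X]) : ∃ h : PowerSeries T, h = α + PowerSeries.X * p.eval h := by
  let s : ℕ → PowerSeries T := fun n ↦ Nat.rec α (fun _ b ↦ α + PowerSeries.X * p.eval b) n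
  have hs : ∀ n, s (n + 1) = α + PowerSeries.X * p.eval (s n) := fun _ ↦ rfl
  have hcongr : ∀ (n : ℕ) (a b : PowerSeries T), PowerSeries.X ^ n ∣ a - b →
      PowerSeries.X ^ (n + 1) ∣
        (α + PowerSeries.X * p.eval a) - (α + PowerSeries.X * p.eval b) := by
    intro n a b h
    rw [add_sub_add_left_eq_sub, ← mul_sub, pow_succ']
    exact mul_dvd_mul_left _ (h.trans (p.sub_dvd_eval_sub a b))
  have hstep : ∀ n, PowerSeries.X ^ n ∣ s (n + 1) - s n := by
    intro n
    induction n with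
    | zero => simp
    | succ n ih => exact hcongr n _ _ ih
  have hfar : ∀ n m, n ≤ m → PowerSeries.X ^ n ∣ s m - s n := by
    intro n m h
    induction m, h using Nat.le_induction with
    | base => simp
    | succ m h ih =>
      have := dvd_add ((pow_dvd_pow _ h).trans (hstep m)) ih
      simpa using this
  let h : PowerSeries T := PowerSeries.mk fun n ↦ PowerSeries.coeff n (s (n + 1))
  have hh : ∀ n, PowerSeries.X ^ n ∣ h - s n := by
    intro n
    rw [PowerSeries.X_pow_dvd_iff]
    intro m hm
    have := PowerSeries.X_pow_dvd_iff.mp (hfar (m + 1) n hm) m (Nat.lt_succ_self m)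
    rw [map_sub, sub_eq_zero] at this
    simp [h, this]
  refine ⟨h, ?_⟩
  have key : ∀ n, PowerSeries.X ^ n ∣ h - (α + PowerSeries.X * p.eval h) := by
    intro n
    have h1 := (pow_dvd_pow _ (Nat.le_succ n)).trans (hh (n + 1))
    have h2 := (pow_dvd_pow _ (Nat.le_succ n)).trans (hcongr n _ _ (hh n))
    have := dvd_sub h1 h2
    rw [hs] at this
    convert this using 1
    ring
  rw [← sub_eq_zero]
  ext n
  exact PowerSeries.X_pow_dvd_iff.mp (key (n + 1)) n (Nat.lt_succ_self n)

open Polynomial in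
/-- A form of Newton's lemma for possibly degenerate approximate roots. -/
theorem powerSeries_exists_root_of_approx {T : Type*} [CommRing T] (f : (PowerSeries T)[X])
    (w G E V q : PowerSeries T) (hV : IsUnit V)
    (hf : f.eval w = PowerSeries.X * E ^ 2 * q) (hf' : f.derivative.eval w * G = E * V) :
    ∃ t, f.eval (w + G * t) = 0 := by
  obtain ⟨V', hV'⟩ := hV.exists_right_inv
  set δ := f.derivative.eval w
  have hE : E = δ * G * V' := by rw [hf', mul_assoc, hV', mul_one]
  obtain ⟨k, hk⟩ := Polynomial.binomExpansion (f.map (C : PowerSeries T →+* (PowerSeries T)[X]))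
    (C w) (C (δ * G * PowerSeries.X) * X)
  obtain ⟨h, hh⟩ := powerSeries_exists_eq_add_X_mul_eval (T := T) (-(G * V' ^ 2 * q)) (-(C G * k * X ^ 2))
  have := congrArg (eval h) hk
  refine ⟨δ * PowerSeries.X * h, ?_⟩
  have e1 : ∀ (g : (PowerSeries T)[X]) (x : (PowerSeries T)[X]),
      eval h (eval x (g.map (C : PowerSeries T →+* (PowerSeries T)[X]))) = eval (eval h x) g := by
    intro g x
    rw [eval_map, ← coe_evalRingHom h, hom_eval₂]
    have : (evalRingHom h).comp C = RingHom.id _ := by ext; simp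
    rw [this]
    rfl
  rw [derivative_map] at this
  simp only [eval_add, eval_mul, eval_pow, e1, eval_C, eval_X] at this
  rw [show w + G * (δ * PowerSeries.X * h) = w + δ * G * PowerSeries.X * h by ring, this, hf, hE]
  simp only [eval_neg, eval_mul, eval_C, eval_pow, eval_X] at hh
  have : δ * (δ * G * PowerSeries.X * h) = δ * (δ * G * PowerSeries.X *
    (-(G * V' ^ 2 * q) + PowerSeries.X * -(G * eval h k * h ^ 2))) := by rw [← hh]
  change _ + δ * _ + _ = _
  rw [this]
  ring

/-- A ring homomorphism defined by its graph. -/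
theorem exists_ringHom_of_presentation {Q D T : Type*} [CommRing Q] [CommRing D] [CommRing T]
    [IsDomain T] (ev : Q →+* D) (h₀ : Q →+* T) (hker : ∀ P, ev P = 0 → h₀ P = 0) (G : Q)
    (hG : h₀ G ≠ 0) : ∃ (S : Subring D) (h : S →+* T), ∀ (σ : D) (τ : T) (N : ℕ) (P : Q),
      ev P = ev G ^ N * σ → h₀ P = h₀ G ^ N * τ → ∃ hσ : σ ∈ S, h ⟨σ, hσ⟩ = τ := by
  let Γ : Subring (D × T) :=
    { carrier := {x | ∃ (N : ℕ) (P : Q), ev P = ev G ^ N * x.1 ∧ h₀ P = h₀ G ^ N * x.2}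
      mul_mem' := by
        rintro ⟨a, b⟩ ⟨a', b'⟩ ⟨N, P, h1, h2⟩ ⟨N', P', h1', h2'⟩
        exact ⟨N + N', P * P', by simp only [map_mul, h1, h1', Prod.fst_mul]; ring,
          by simp only [map_mul, h2, h2', Prod.snd_mul]; ring⟩
      one_mem' := ⟨0, 1, by simp, by simp⟩
      add_mem' := by
        rintro ⟨a, b⟩ ⟨a', b'⟩ ⟨N, P, h1, h2⟩ ⟨N', P', h1', h2'⟩
        exact ⟨N + N', G ^ N' * P + G ^ N * P',
          by simp only [map_mul, map_add, map_pow, h1, h1', Prod.fst_add]; ring,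
          by simp only [map_mul, map_add, map_pow, h2, h2', Prod.snd_add]; ring⟩
      zero_mem' := ⟨0, 0, by simp, by simp⟩
      neg_mem' := by
        rintro ⟨a, b⟩ ⟨N, P, h1, h2⟩
        exact ⟨N, -P, by simp only [map_neg, h1, Prod.fst_neg]; ring,
          by simp only [map_neg, h2, Prod.snd_neg]; ring⟩ }
  have hinj : Function.Injective ((RingHom.fst D T).comp Γ.subtype).rangeRestrict := by
    rw [injective_iff_map_eq_zero]
    rintro ⟨⟨a, b⟩, N, P, h1, h2⟩ h
    have ha : a = 0 := congrArg Subtype.val h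
    subst ha
    have h3 := hker P (by rw [h1]; exact mul_zero _)
    rw [h3] at h2
    have hb : b = 0 := (mul_eq_zero.mp h2.symm).resolve_left (pow_ne_zero _ hG)
    subst hb
    rfl
  let e := RingEquiv.ofBijective _ ⟨hinj,
    ((RingHom.fst D T).comp Γ.subtype).rangeRestrict_surjective⟩
  refine ⟨_, ((RingHom.snd D T).comp Γ.subtype).comp e.symm.toRingHom, ?_⟩
  intro σ τ N P h1 h2
  let γ : Γ := ⟨(σ, τ), N, P, h1, h2⟩
  refine ⟨⟨γ, rfl⟩, ?_⟩
  have : e.symm ⟨σ, ⟨γ, rfl⟩⟩ = γ := by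
    rw [RingEquiv.symm_apply_eq]
    rfl
  simp [this, γ]

end Newton

section RegularPowers

variable {T : Type*} [CommRing T]

theorem powerSeries_mem_span_C_iff (y : ℕ → T) (j : ℕ) (f : PowerSeries T) :
    f ∈ Ideal.span ((fun i ↦ PowerSeries.C (y i)) '' Set.Iio j) ↔
      ∀ n, PowerSeries.coeff n f ∈ Ideal.span (y '' Set.Iio j) := by
  constructor
  · intro hf n
    induction hf using Submodule.span_induction generalizing n with
    | mem x hx =>
      obtain ⟨i, hi, rfl⟩ := hx
      rw [PowerSeries.coeff_C]
      split_ifs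
      · exact Ideal.subset_span ⟨i, hi, rfl⟩
      · exact zero_mem _
    | zero => simp
    | add x y _ _ hx hy => rw [map_add]; exact add_mem (hx n) (hy n)
    | smul a x _ hx =>
      rw [smul_eq_mul, PowerSeries.coeff_mul]
      exact sum_mem fun p _ ↦ Ideal.mul_mem_left _ _ (hx _)
  · intro hf
    have hr : y '' Set.Iio j = Set.range fun i : Fin j ↦ y i := by
      ext b
      simp [Fin.exists_iff]
    rw [hr] at hf
    choose c hc using fun n ↦ Ideal.mem_span_range_iff_exists_fun.mp (hf n)
    have : f = ∑ i : Fin j, PowerSeries.mk (fun n ↦ c n i) * PowerSeries.C (y i) := by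
      ext n
      simp [← hc n, map_sum, PowerSeries.coeff_mul_C]
    rw [this]
    exact sum_mem fun i _ ↦ Ideal.mul_mem_left _ _ (Ideal.subset_span ⟨i, i.2, rfl⟩)

/-- The sequence `C ζ₀, …, C ζ_{d-1}, X` in a power series ring. -/
noncomputable def snocX (d : ℕ) (ζ : ℕ → T) (i : ℕ) : PowerSeries T :=
  if i < d then PowerSeries.C (ζ i) else PowerSeries.X

theorem snocX_image_pow {d j : ℕ} (hj : j ≤ d) (ζ : ℕ → T) (M : ℕ) :
    (fun i ↦ snocX d ζ i ^ M) '' Set.Iio j =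
      (fun i ↦ PowerSeries.C (ζ i ^ M)) '' Set.Iio j := by
  refine Set.image_congr fun i hi ↦ ?_
  have : i < d := lt_of_lt_of_le hi hj
  simp [snocX, this]

theorem snocX_regular (d : ℕ) (ζ : ℕ → T)
    (hζ : ∀ M : ℕ, ∀ j < d, ∀ a : T, ζ j ^ M * a ∈ Ideal.span ((fun i ↦ ζ i ^ M) '' Set.Iio j) →
        a ∈ Ideal.span ((fun i ↦ ζ i ^ M) '' Set.Iio j)) (M j : ℕ) (hj : j < d + 1)
    (a : PowerSeries T)
    (ha : snocX d ζ j ^ M * a ∈ Ideal.span ((fun i ↦ snocX d ζ i ^ M) '' Set.Iio j)) :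
    a ∈ Ideal.span ((fun i ↦ snocX d ζ i ^ M) '' Set.Iio j) := by
  rw [snocX_image_pow (by omega), powerSeries_mem_span_C_iff (fun i ↦ ζ i ^ M)] at ha ⊢
  intro n
  by_cases hjd : j < d
  · have := ha n
    rw [snocX, if_pos hjd, ← map_pow, PowerSeries.coeff_C_mul] at this
    exact hζ M j hjd _ this
  · have := ha (n + M)
    rwa [snocX, if_neg hjd, PowerSeries.coeff_X_pow_mul] at this

theorem snocX_image_self (d : ℕ) (ζ : ℕ → T) :
    Ideal.span (snocX d ζ '' Set.Iio (d + 1)) =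
      Ideal.span ((fun i ↦ PowerSeries.C (ζ i)) '' Set.Iio d) ⊔ Ideal.span {PowerSeries.X} := by
  rw [← Ideal.span_union]
  congr 1
  ext b
  simp only [Set.mem_image, Set.mem_Iio, Set.mem_union, Set.mem_singleton_iff]
  constructor
  · rintro ⟨m, hm, rfl⟩
    by_cases h : m < d
    · exact Or.inl ⟨m, h, by simp [snocX, h]⟩
    · exact Or.inr (by simp [snocX, h])
  · rintro (⟨m, hm, rfl⟩ | rfl)
    · exact ⟨m, by omega, by simp [snocX, hm]⟩
    · exact ⟨d, by omega, by simp [snocX]⟩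

theorem snocX_iInf_pow (d : ℕ) (ζ : ℕ → T)
    (hζ : ⨅ t : ℕ, Ideal.span (ζ '' Set.Iio d) ^ t = ⊥) :
    ⨅ t : ℕ, Ideal.span (snocX d ζ '' Set.Iio (d + 1)) ^ t = ⊥ := by
  set J := Ideal.span (ζ '' Set.Iio d)
  set I := Ideal.span (snocX d ζ '' Set.Iio (d + 1))
  have key : ∀ t, ∀ f ∈ I ^ t, ∀ n, PowerSeries.coeff n f ∈ J ^ (t - n) := by
    intro t
    induction t with
    | zero => simp
    | succ t ih =>
      intro f hf
      rw [pow_succ'] at hf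
      induction hf using Submodule.mul_induction_on' with
      | mem_mul_mem a ha b hb =>
        induction ha using Submodule.span_induction with
        | mem x hx =>
          intro n
          obtain ⟨i, hi, rfl⟩ := hx
          unfold snocX
          split_ifs with hid
          · rw [PowerSeries.coeff_C_mul]
            have h1 : ζ i * PowerSeries.coeff n b ∈ J * J ^ (t - n) :=
              Ideal.mul_mem_mul (Ideal.subset_span ⟨i, hid, rfl⟩) (ih b hb n)
            rw [← pow_succ'] at h1
            exact Ideal.pow_le_pow_right (by omega) h1
          · cases n with
            | zero => simp
            | succ n =>
              rw [PowerSeries.coeff_succ_X_mul]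
              exact Ideal.pow_le_pow_right (by omega) (ih b hb n)
        | zero => simp
        | add x y _ _ hx hy => intro n; rw [add_mul, map_add]; exact add_mem (hx n) (hy n)
        | smul a x _ hx =>
          intro n
          rw [smul_eq_mul, mul_assoc, PowerSeries.coeff_mul]
          refine sum_mem fun p hp ↦ Ideal.mul_mem_left _ _ ?_
          have := Finset.HasAntidiagonal.mem_antidiagonal.mp hp
          exact Ideal.pow_le_pow_right (by omega) (hx p.2)
      | add x _ y _ hx hy => intro n; rw [map_add]; exact add_mem (hx n) (hy n)
  rw [eq_bot_iff]
  intro f hf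
  rw [Ideal.mem_bot]
  ext n
  have : PowerSeries.coeff n f ∈ ⨅ t : ℕ, J ^ t := by
    rw [Ideal.mem_iInf]
    intro t
    have := key (t + n) f (Ideal.mem_iInf.mp hf _) n
    rwa [Nat.add_sub_cancel] at this
  rw [hζ] at this
  simpa using this

end RegularPowers

section CoordinateChange

open MvPowerSeries in
theorem mvPowerSeries_mem_pow_span_X {σ R : Type*} [Finite σ] [CommRing R] {n : ℕ}
    {f : MvPowerSeries σ R} (hf : truncTotal n f = 0) :
    f ∈ Ideal.span (Set.range (X : σ → MvPowerSeries σ R)) ^ n := by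
  have h1 : toAdicCompletion σ R f ∈ (AdicCompletion.eval (MvPolynomial.idealOfVars σ R)
      (MvPolynomial σ R) n).ker := by
    rw [LinearMap.mem_ker, AdicCompletion.eval_apply, toAdicCompletion_apply_eq_mk_truncTotal, hf]
    rfl
  rw [← AdicCompletion.pow_smul_top_eq_ker_eval (MvPolynomial.idealOfVars_fg σ R)] at h1
  have h2 : f ∈ (MvPolynomial.idealOfVars σ R ^ n • ⊤ :
      Submodule (MvPolynomial σ R) (MvPowerSeries σ R)) := by
    have := Submodule.mem_map_of_mem
      (f := (toAdicCompletionAlgEquiv σ R).symm.toLinearEquiv.toLinearMap) h1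
    rw [Submodule.map_smul''] at this
    refine Submodule.smul_mono le_rfl
      (le_top : Submodule.map (toAdicCompletionAlgEquiv σ R).symm.toLinearEquiv.toLinearMap ⊤ ≤ ⊤)
      ?_
    convert this using 1
    exact ((toAdicCompletionAlgEquiv σ R).symm_apply_apply f).symm
  rw [Ideal.smul_top_eq_map, Submodule.restrictScalars_mem, Ideal.map_pow] at h2
  convert h2 using 2
  rw [MvPolynomial.idealOfVars, Ideal.map_span, ← Set.range_comp]
  congr 2
  ext i : 1
  simp [MvPowerSeries.algebraMap_apply']

open MvPowerSeries in
theorem mvPowerSeries_maximalIdeal_eq_span_X {σ K : Type*} [Finite σ] [Field K] :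
    IsLocalRing.maximalIdeal (MvPowerSeries σ K) = Ideal.span (Set.range X) := by
  refine le_antisymm (fun f hf ↦ ?_) ?_
  · rw [← pow_one (Ideal.span _)]
    refine mvPowerSeries_mem_pow_span_X ?_
    rw [IsLocalRing.mem_maximalIdeal, mem_nonunits_iff, MvPowerSeries.isUnit_iff_constantCoeff,
      isUnit_iff_ne_zero, not_not] at hf
    ext x
    rw [coeff_truncTotal_eq_ite]
    split_ifs with h
    · have : x = 0 := by simpa [Finsupp.degree_eq_zero_iff] using h
      simpa [this] using hf
    · simp
  · rw [Ideal.span_le]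
    rintro _ ⟨i, rfl⟩
    simp [IsLocalRing.mem_maximalIdeal, MvPowerSeries.isUnit_iff_constantCoeff]

theorem mvPowerSeries_isAdicComplete {σ K : Type*} [Finite σ] [Field K] :
    IsAdicComplete (IsLocalRing.maximalIdeal (MvPowerSeries σ K)) (MvPowerSeries σ K) := by
  rw [mvPowerSeries_maximalIdeal_eq_span_X]
  infer_instance

theorem eval₂_mul_of_isHomogeneous {σ K T : Type*} [CommRing K] [CommRing T] {m : ℕ}
    {f : MvPolynomial σ K} (hm : f.IsHomogeneous m) (φ : K →+* T) (a : T) (v : σ → T) :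
    MvPolynomial.eval₂ φ (fun i ↦ a * v i) f = a ^ m * MvPolynomial.eval₂ φ v f := by
  rw [MvPolynomial.eval₂_eq, MvPolynomial.eval₂_eq, Finset.mul_sum]
  refine Finset.sum_congr rfl fun x hx ↦ ?_
  have h := hm (MvPolynomial.mem_support_iff.mp hx)
  replace h : Finsupp.degree x = m := by rwa [Finsupp.degree_eq_weight_one]
  simp_rw [mul_pow]
  rw [Finset.prod_mul_distrib, Finset.prod_pow_eq_pow_sum, ← Finsupp.degree_apply, h]
  ring

/-- A nonzero form over an infinite field is nonzero at some point with first coordinate `1`. -/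
theorem exists_eval_cons_one_ne_zero {K : Type*} [Field K] [Infinite K] {d m : ℕ}
    {f : MvPolynomial (Fin (d + 1)) K} (hf : f ≠ 0) (hm : f.IsHomogeneous m) :
    ∃ c : Fin d → K, MvPolynomial.eval (Fin.cons 1 c : Fin (d + 1) → K) f ≠ 0 := by
  have h1 : f * MvPolynomial.X 0 ≠ 0 := mul_ne_zero hf (MvPolynomial.X_ne_zero 0)
  obtain ⟨v, hv⟩ : ∃ v, MvPolynomial.eval v (f * MvPolynomial.X 0) ≠ 0 := by
    by_contra! h
    exact h1 (MvPolynomial.funext fun v ↦ by simpa using h v)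
  rw [map_mul, MvPolynomial.eval_X] at hv
  have hv0 := right_ne_zero_of_mul hv
  refine ⟨fun i ↦ (v 0)⁻¹ * v i.succ, ?_⟩
  have h2 : (Fin.cons 1 (fun i ↦ (v 0)⁻¹ * v i.succ) : Fin (d + 1) → K) = (v 0)⁻¹ • v := by
    ext i
    refine Fin.cases ?_ (fun j ↦ ?_) i
    · simp [hv0]
    · simp
  have h3 := eval₂_mul_of_isHomogeneous hm (RingHom.id K) (v 0)⁻¹ v
  rw [h2]
  refine ne_of_eq_of_ne h3 ?_
  exact mul_ne_zero (pow_ne_zero _ (inv_ne_zero hv0)) (left_ne_zero_of_mul hv)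

open MvPowerSeries in
/-- After a linear change of coordinates a nonzero power series becomes regular in the first
variable. -/
theorem exists_coordinate_change {K : Type*} [Field K] [Infinite K] {d : ℕ}
    {e : MvPowerSeries (Fin (d + 1)) K} (he : e ≠ 0) :
    ∃ (c : Fin d → K)
      (Φ : MvPowerSeries (Fin (d + 1)) K →+* PowerSeries (MvPowerSeries (Fin d) K)),
      Φ (X 0) = PowerSeries.X ∧
      (∀ j, Φ (X (Fin.succ j)) = PowerSeries.C (X j) + PowerSeries.C (C (c j)) * PowerSeries.X) ∧
      (Φ e).map (IsLocalRing.residue _) ≠ 0 := by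
  obtain ⟨m, hm⟩ := ENat.ne_top_iff_exists.mp (order_eq_top_iff.not.mpr he)
  set q := truncTotal (m + 1) e with hq
  have hqm : q.IsHomogeneous m := by
    intro x hx
    suffices Finsupp.degree x = m by rwa [Finsupp.degree_eq_weight_one] at this
    rw [hq, coeff_truncTotal_eq_ite] at hx
    split_ifs at hx with h
    · by_contra hne
      refine hx (coeff_of_lt_order ?_)
      rw [← hm]
      exact_mod_cast (show Finsupp.degree x < m by lia)
    · exact absurd rfl hx
  have hq0 : q ≠ 0 := by
    obtain ⟨x, hx, hxm⟩ := (order_eq_nat.mp hm.symm).1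
    intro h
    have := congr_arg (MvPolynomial.coeff x) h
    rw [hq, coeff_truncTotal _ (by lia)] at this
    exact hx (by simpa using this)
  have heq : e - (q : MvPowerSeries (Fin (d + 1)) K) ∈
      Ideal.span (Set.range (X : Fin (d + 1) → MvPowerSeries (Fin (d + 1)) K)) ^ (m + 1) := by
    refine mvPowerSeries_mem_pow_span_X ?_
    rw [map_sub, (truncTotal_coe_eq_self_iff q (Nat.succ_ne_zero m)).mpr, sub_self]
    exact totalDegree_truncTotal_lt _ (Nat.succ_ne_zero m)
  obtain ⟨c, hc⟩ := exists_eval_cons_one_ne_zero hq0 hqm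
  let a : Fin (d + 1) → MvPowerSeries (Fin (d + 1)) K :=
    Fin.cons (X 0) fun j ↦ X j.succ + C (c j) * X 0
  have ha : HasSubst a := hasSubst_of_constantCoeff_zero fun i ↦ by
    refine Fin.cases ?_ (fun j ↦ ?_) i <;> simp [a]
  let Φ := (finSuccEquiv K d).toRingEquiv.toRingHom.comp (substAlgHom (R := K) ha).toRingHom
  have h0 : Φ (X 0) = PowerSeries.X := by
    change finSuccEquiv K d (substAlgHom ha (X 0)) = _
    rw [substAlgHom_X]
    simp [a, finSuccEquiv_X_zero]
  have hj (j) : Φ (X (Fin.succ j)) =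
      PowerSeries.C (X j) + PowerSeries.C (C (c j)) * PowerSeries.X := by
    change finSuccEquiv K d (substAlgHom ha (X (Fin.succ j))) = _
    rw [substAlgHom_X]
    simp [a, finSuccEquiv_X_zero, finSuccEquiv_X_succ, finSuccEquiv_C]
  have hC (b) : Φ (C b) = PowerSeries.C (C b) := by
    simp [Φ, ← finSuccEquiv_C, subst_C]
  refine ⟨c, Φ, h0, hj, fun h ↦ ?_⟩
  set θ := (PowerSeries.map (IsLocalRing.residue (MvPowerSeries (Fin d) K))).comp Φ with hθ
  let ρ : K →+* IsLocalRing.ResidueField (MvPowerSeries (Fin d) K) :=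
    (IsLocalRing.residue _).comp C
  have hθX (i) : θ (X i) = PowerSeries.X * PowerSeries.C (ρ ((Fin.cons 1 c : Fin (d + 1) → K) i)) := by
    refine Fin.cases ?_ (fun j ↦ ?_) i
    · simp [hθ, h0]
    · have : IsLocalRing.residue (MvPowerSeries (Fin d) K) (X j) = 0 := by
        rw [IsLocalRing.residue_eq_zero_iff, mvPowerSeries_maximalIdeal_eq_span_X]
        exact Ideal.subset_span ⟨j, rfl⟩
      simp [hθ, hj, this, ρ, mul_comm]
  have hθq : θ q = PowerSeries.X ^ m * PowerSeries.C (ρ (MvPolynomial.eval (Fin.cons 1 c) q)) := by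
    have h1 : (θ.comp (MvPolynomial.coeToMvPowerSeries.ringHom)) =
        MvPolynomial.eval₂Hom (PowerSeries.C.comp ρ)
          (fun i ↦ PowerSeries.X * PowerSeries.C (ρ ((Fin.cons 1 c : Fin (d + 1) → K) i))) := by
      refine MvPolynomial.ringHom_ext (fun b ↦ ?_) (fun i ↦ ?_)
      · simp [hθ, hC, ρ]
      · simp [hθX]
    have h2 := RingHom.congr_fun h1 q
    rw [MvPolynomial.coe_eval₂Hom, eval₂_mul_of_isHomogeneous hqm] at h2
    refine h2.trans ?_
    congr 1
    rw [MvPolynomial.eval, MvPolynomial.coe_eval₂Hom, ← RingHom.comp_apply,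
      MvPolynomial.hom_eval₂]
    rfl
  have hdvd : PowerSeries.X ^ (m + 1) ∣ θ (e - q) := by
    rw [← Ideal.mem_span_singleton, ← Ideal.span_singleton_pow]
    have := Ideal.mem_map_of_mem θ heq
    rw [Ideal.map_pow, Ideal.map_span] at this
    refine Ideal.pow_right_mono ?_ _ this
    rw [Ideal.span_le]
    rintro _ ⟨_, ⟨i, rfl⟩, rfl⟩
    rw [hθX]
    exact Ideal.mul_mem_right _ _ (Ideal.mem_span_singleton_self _)
  have h1 : θ e = 0 := h
  rw [map_sub, h1, zero_sub, dvd_neg, hθq, PowerSeries.X_pow_dvd_iff] at hdvd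
  have h2 := hdvd m (Nat.lt_succ_self m)
  rw [PowerSeries.coeff_X_pow_mul', if_pos le_rfl, Nat.sub_self, PowerSeries.coeff_zero_C] at h2
  exact hc (ρ.injective (h2.trans (map_zero ρ).symm))

end CoordinateChange

section Specialization

open Polynomial

theorem exists_lifted_polynomials_ringHom {R T : Type*} [CommRing R] [CommRing T] (S : Subring R)
    (h : S →+* T) : ∃ (L : Subring R[X]) (l : L →+* PowerSeries T),
      (∀ p : R[X], (∀ n, p.coeff n ∈ S) → p ∈ L) ∧
      ∀ (p : R[X]) (hp : p ∈ L) (n : ℕ), ∃ hn : p.coeff n ∈ S,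
        PowerSeries.coeff n (l ⟨p, hp⟩) = h ⟨p.coeff n, hn⟩ := by
  have hinj : Function.Injective (mapRingHom S.subtype) := map_injective _ Subtype.val_injective
  let e : S[X] ≃+* (mapRingHom S.subtype).range :=
    RingEquiv.ofBijective (mapRingHom S.subtype).rangeRestrict
      ⟨fun x y hxy ↦ hinj (congr_arg Subtype.val hxy), RingHom.rangeRestrict_surjective _⟩
  refine ⟨(mapRingHom S.subtype).range,
    ((coeToPowerSeries.ringHom (R := T)).comp (mapRingHom h)).comp e.symm.toRingHom, ?_, ?_⟩
  · intro p hp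
    have := (lifts_iff_coeff_lifts (f := S.subtype) p).mpr fun n ↦ by simpa using hp n
    exact (mem_lifts p).mp this
  · rintro p ⟨q, rfl⟩ n
    have h1 : e.symm ⟨mapRingHom S.subtype q, ⟨q, rfl⟩⟩ = q := by
      rw [RingEquiv.symm_apply_eq]
      rfl
    refine ⟨by simp, ?_⟩
    change PowerSeries.coeff n ((mapRingHom h (e.symm ⟨_, _⟩) : T[X]) : PowerSeries T) = _
    rw [h1, coeff_coe, coe_mapRingHom, coeff_map]
    congr 1
    ext
    simp

theorem exists_specialization {O D T : Type*} [CommRing O] [CommRing D] [CommRing T] [IsDomain T]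
    (ev : O[X] →+* D) (F : O[X]) (hF : ∀ P, ev P = 0 → F ∣ P) (G : O)
    (f : O[X] →+* PowerSeries T) (E V q : PowerSeries T) (hE : E ≠ 0) (hV : IsUnit V)
    (hq : f F = PowerSeries.X * E ^ 2 * q) (hEV : f (derivative F) * f (C G) = E * V)
    (Z : Set D) (hZ : ∀ z ∈ Z, ∃ P, ev P = ev (C G) * z ∧
      ∃ U r, f P = f (C G) * U + PowerSeries.X * E ^ 2 * r) :
    ∃ (S : Subring D) (h : S →+* PowerSeries T), Z ⊆ S ∧
      (∀ a : O, ∃ ha : ev (C a) ∈ S, h ⟨ev (C a), ha⟩ = f (C a)) ∧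
      ∀ s (hs : s ∈ S) Q, s * ev Q = ev (C G) → h ⟨s, hs⟩ ≠ 0 := by
  have hfe (P : O[X]) : (P.map (f.comp C)).eval (f X) = f P := by
    rw [eval_map]
    have : eval₂RingHom (f.comp C) (f X) = f := by
      refine ringHom_ext (fun a ↦ by simp) (by simp)
    exact RingHom.congr_fun this P
  obtain ⟨t, ht⟩ := powerSeries_exists_root_of_approx (F.map (f.comp C)) (f X) (f (C G)) E V q hV
    (by rw [hfe, hq]) (by rw [derivative_map, hfe, hEV])
  set f₀ := eval₂RingHom (f.comp C) (f X + f (C G) * t) with hf₀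
  have hf₀C (a : O) : f₀ (C a) = f (C a) := by simp [hf₀]
  have hf₀F : f₀ F = 0 := by rw [hf₀, coe_eval₂RingHom, ← eval_map]; exact ht
  have hker (P) (hP : ev P = 0) : f₀ P = 0 := by
    obtain ⟨c, rfl⟩ := hF P hP
    rw [map_mul, hf₀F, zero_mul]
  have hG : f (C G) ≠ 0 := by
    intro h
    rw [h, mul_zero] at hEV
    exact mul_ne_zero hE hV.ne_zero hEV.symm
  obtain ⟨S, h, hS⟩ := exists_ringHom_of_presentation ev f₀ hker (C G) (by rwa [hf₀C])
  have hSev (P) : ∃ hP : ev P ∈ S, h ⟨ev P, hP⟩ = f₀ P := hS _ _ 0 P (by simp) (by simp)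
  refine ⟨S, h, ?_, fun a ↦ ?_, ?_⟩
  · intro z hz
    obtain ⟨P, hP, U, r, hr⟩ := hZ z hz
    have hdE : f (C G) ∣ E := by
      rw [← hV.dvd_mul_right, ← hEV]
      exact dvd_mul_left _ _
    have h1 : f (C G) ∣ f P := by
      rw [hr, sq]
      exact dvd_add (dvd_mul_right _ _)
        (((hdE.mul_left E).mul_left _).mul_right _)
    have h2 : f (C G) ∣ f₀ P - f P := by
      have := sub_dvd_eval_sub (f X + f (C G) * t) (f X) (P.map (f.comp C))
      rw [hfe, eval_map] at this
      exact dvd_trans (by simp) this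
    obtain ⟨τ, hτ⟩ : f (C G) ∣ f₀ P := by simpa using dvd_add h2 h1
    exact (hS z τ 1 P (by rw [hP, pow_one]) (by rw [hτ, hf₀C, pow_one])).1
  · obtain ⟨h1, h2⟩ := hSev (C a)
    exact ⟨h1, h2.trans (hf₀C a)⟩
  · intro s hs Q hQ h0
    obtain ⟨h1, h2⟩ := hSev Q
    obtain ⟨h3, h4⟩ := hSev (C G)
    have : (⟨s, hs⟩ * ⟨ev Q, h1⟩ : S) = ⟨ev (C G), h3⟩ := Subtype.ext hQ
    have := congr_arg h this
    rw [map_mul, h0, zero_mul, h4, hf₀C] at this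
    exact hG this.symm

/-- A power series is congruent to a polynomial modulo a distinguished polynomial. -/
theorem exists_polynomial_of_isDistinguishedAt {R : Type*} [CommRing R] {I : Ideal R}
    [IsAdicComplete I R] (hI : I ≠ ⊤) {g : R[X]} (hg : g.IsDistinguishedAt I)
    (f : PowerSeries R) : ∃ (r : R[X]), (g : PowerSeries R) ∣ r - f := by
  obtain ⟨-, h⟩ := (hg.isWeierstrassDivisorAt hI).isWeierstrassDivisionAt_div_mod f
  refine ⟨(hg.isWeierstrassDivisorAt hI).mod f, -(hg.isWeierstrassDivisorAt hI).div f, ?_⟩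
  nth_rw 2 [h]
  ring

theorem coe_dvd_coe_of_isDistinguishedAt {R : Type*} [CommRing R] {I : Ideal R}
    [IsHausdorff I R] (hI : I ≠ ⊤) {g p : R[X]} (hg : g.IsDistinguishedAt I)
    (h : (g : PowerSeries R) ∣ p) : g ∣ p := by
  have : Nontrivial R := ⟨⟨0, 1, fun h ↦ hI (Ideal.eq_top_of_isUnit_mem I
    (by rw [← h]; exact I.zero_mem) isUnit_one)⟩⟩
  obtain ⟨q, hq⟩ := h
  have hdeg (r : R[X]) (hr : r.degree < g.degree) :
      r.degree < ((g : PowerSeries R).map (Ideal.Quotient.mk I)).order.toNat := by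
    have : Nontrivial (R ⧸ I) := Ideal.Quotient.nontrivial_iff.mpr hI
    have h1 := hg.coe_natDegree_eq_order_map (g : PowerSeries R) 1
      (by simpa using (Ideal.ne_top_iff_one I).mp hI) (by simp)
    rw [← h1, ENat.toNat_natCast]
    rwa [degree_eq_natDegree hg.monic.ne_zero] at hr
  have h2 := (hg.isWeierstrassDivisorAt hI).eq_of_mul_add_eq_mul_add
    (q := q) (q' := (p /ₘ g : R[X])) (r := 0) (r' := p %ₘ g)
    (hdeg 0 (by simpa [bot_lt_iff_ne_bot] using hg.monic.ne_zero))
    (hdeg _ (degree_modByMonic_lt p hg.monic))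
    (by rw [← hq, coe_zero, add_zero, ← coe_mul, ← coe_add, add_comm, modByMonic_add_div])
  exact (modByMonic_eq_zero_iff_dvd hg.monic).mp h2.2.symm

end Specialization

section PolynomialApproximation

open Polynomial

theorem isDistinguishedAt_X {R : Type*} [CommRing R] (I : Ideal R) :
    (X : R[X]).IsDistinguishedAt I where
  mem {n} hn := by
    nontriviality R
    rw [natDegree_X] at hn
    obtain rfl : n = 0 := by lia
    simp
  monic := monic_X

/-- A specialization of a presented ring to power series can be approximated by a specialization
to polynomials. -/
theorem exists_polynomial_approximation {R D σ : Type*} [CommRing R] [IsDomain R] [IsLocalRing R]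
    [IsAdicComplete (IsLocalRing.maximalIdeal R) R] [CommRing D]
    (ev : (MvPolynomial σ ℤ)[X] →+* D) (Φ : D →+* PowerSeries R) (F : (MvPolynomial σ ℤ)[X])
    (G : MvPolynomial σ ℤ) (hF : ev F = 0)
    (he : (Φ (ev (derivative F) * ev (C G))).map (IsLocalRing.residue R) ≠ 0) :
    ∃ (f : (MvPolynomial σ ℤ)[X] →+* R[X]) (E V q : R[X]), E.Monic ∧ IsUnit (V.coeff 0) ∧
      f F = X * E ^ 2 * q ∧ f (derivative F) * f (C G) = E * V ∧
      (∀ z P, ev P = ev (C G) * z → ∃ U r, f P = f (C G) * U + X * E ^ 2 * r) ∧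
      ∀ i (p : R[X]), (p : PowerSeries R) = Φ (ev (C (MvPolynomial.X i))) →
        f (C (MvPolynomial.X i)) = p := by
  have hI := Ideal.IsPrime.ne_top (inferInstance : (IsLocalRing.maximalIdeal R).IsPrime)
  obtain ⟨E, v, hEv⟩ := PowerSeries.exists_isWeierstrassFactorization he
  have hE := hEv.isDistinguishedAt
  set μ : R[X] := X * E ^ 2 with hμ
  have hμd : μ.IsDistinguishedAt (IsLocalRing.maximalIdeal R) := by
    rw [hμ, sq]
    exact (isDistinguishedAt_X _).mul (hE.mul hE)
  have happ (g : PowerSeries R) := exists_polynomial_of_isDistinguishedAt hI hμd g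
  have hex (i : σ) : ∃ r : R[X],
      (μ : PowerSeries R) ∣ r - Φ (ev (C (MvPolynomial.X i))) ∧
      ∀ p : R[X], (p : PowerSeries R) = Φ (ev (C (MvPolynomial.X i))) → r = p := by
    by_cases h : ∃ p : R[X], (p : PowerSeries R) = Φ (ev (C (MvPolynomial.X i)))
    · obtain ⟨p, hp⟩ := h
      exact ⟨p, by simp [hp], fun p' hp' ↦ coe_injective R (hp.trans hp'.symm)⟩
    · obtain ⟨r, hr⟩ := happ (Φ (ev (C (MvPolynomial.X i))))
      exact ⟨r, hr, fun p hp ↦ absurd ⟨p, hp⟩ h⟩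
  choose a ha ha' using hex
  obtain ⟨w, hw⟩ := happ (Φ (ev X))
  let f : (MvPolynomial σ ℤ)[X] →+* R[X] := eval₂RingHom (MvPolynomial.aeval a).toRingHom w
  have hf (P) : (μ : PowerSeries R) ∣ f P - Φ (ev P) := by
    let π := Ideal.Quotient.mk (Ideal.span {(μ : PowerSeries R)})
    have : (π.comp (coeToPowerSeries.ringHom (R := R))).comp f = π.comp (Φ.comp ev) := by
      refine ringHom_ext' (MvPolynomial.ringHom_ext' (RingHom.ext_int _ _) fun i ↦ ?_) ?_
      · simpa [π, f, Ideal.Quotient.eq, Ideal.mem_span_singleton] using ha i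
      · simpa [π, f, Ideal.Quotient.eq, Ideal.mem_span_singleton] using hw
    have := RingHom.congr_fun this P
    simpa [π, Ideal.Quotient.eq, Ideal.mem_span_singleton] using this
  obtain ⟨q, hq⟩ : μ ∣ f F := coe_dvd_coe_of_isDistinguishedAt hI hμd (by simpa [hF] using hf F)
  obtain ⟨k, hk⟩ := hf (derivative F * C G)
  have h1 : ((f (derivative F * C G) : R[X]) : PowerSeries R) =
      (E : PowerSeries R) * (v + PowerSeries.X * (E : PowerSeries R) * k) := by
    rw [sub_eq_iff_eq_add] at hk
    rw [hk, map_mul, hEv.eq_mul, hμ]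
    push_cast
    ring
  obtain ⟨V, hV⟩ : E ∣ f (derivative F * C G) :=
    coe_dvd_coe_of_isDistinguishedAt hI hE (h1 ▸ dvd_mul_right _ _)
  have hV0 : (V : PowerSeries R) = v + PowerSeries.X * (E : PowerSeries R) * k := by
    rw [hV, coe_mul] at h1
    exact mul_left_cancel₀ (fun h ↦ hE.monic.ne_zero (coe_injective R (by simpa using h))) h1
  refine ⟨f, E, V, q, hE.monic, ?_, hq, by rw [← map_mul, hV], ?_, fun i p hp ↦ ?_⟩
  · rw [← coeff_coe, hV0]
    have := PowerSeries.isUnit_iff_constantCoeff.mp hEv.isUnit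
    simpa [mul_assoc] using this
  · intro z P hP
    obtain ⟨U, hU⟩ := happ (Φ z)
    have h2 : μ ∣ f P - f (C G) * U := by
      refine coe_dvd_coe_of_isDistinguishedAt hI hμd ?_
      have h3 := hf P
      have h4 := hf (C G)
      have h5 : ((f P - f (C G) * U : R[X]) : PowerSeries R) = (f P - Φ (ev P)) -
          ((f (C G) - Φ (ev (C G))) * U + Φ (ev (C G)) * (U - Φ z)) := by
        rw [hP, map_mul]
        push_cast
        ring
      rw [h5]
      exact dvd_sub h3 (dvd_add (h4.mul_right _) (hU.mul_left _))
    obtain ⟨r, hr⟩ := h2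
    exact ⟨U, r, by rw [← hr]; ring⟩
  · simpa [f] using ha' i p hp

end PolynomialApproximation

section InductionStep

open Polynomial

theorem exists_specialization_of_subring {R D σ : Type*} [CommRing R] [CommRing D] [Finite σ]
    (ev : (MvPolynomial σ ℤ)[X] →+* D) (F : (MvPolynomial σ ℤ)[X]) (G : MvPolynomial σ ℤ)
    (hF : ∀ P, ev P = 0 → F ∣ P) (f : (MvPolynomial σ ℤ)[X] →+* R[X]) (E V q : R[X])
    (hE : E.Monic) (hV : IsUnit (V.coeff 0)) (hq : f F = X * E ^ 2 * q)
    (hEV : f (derivative F) * f (C G) = E * V) {Z : Set D} (hZ : Z.Finite)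
    (hZP : ∀ z ∈ Z, ∃ P, ev P = ev (C G) * z ∧ ∃ U r, f P = f (C G) * U + X * E ^ 2 * r) :
    ∃ Z' : Set R, Z'.Finite ∧ ∀ (S' : Subring R), Z' ⊆ S' → ∀ (T : Type) [CommRing T] [IsDomain T]
      (h' : S' →+* T), ∃ (S : Subring D) (h : S →+* PowerSeries T), Z ⊆ S ∧
        (∀ i n, ∃ (hi : ev (C (MvPolynomial.X i)) ∈ S)
          (hn : (f (C (MvPolynomial.X i))).coeff n ∈ S'),
          PowerSeries.coeff n (h ⟨_, hi⟩) = h' ⟨_, hn⟩) ∧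
        ∀ s (hs : s ∈ S) Q, s * ev Q = ev (C G) → h ⟨s, hs⟩ ≠ 0 := by
  choose! P hP U r hr using hZP
  obtain ⟨V', hV'⟩ := hV.exists_right_inv
  let polys : Set R[X] := {E, V, q, C V', f X} ∪
    (⋃ i : σ, {f (C (MvPolynomial.X i))}) ∪ (⋃ z ∈ Z, {U z, r z})
  have hpolys : polys.Finite := by
    refine Set.Finite.union (Set.Finite.union ?_ ?_) ?_
    · simp
    · exact Set.finite_iUnion fun i ↦ Set.finite_singleton _
    · exact hZ.biUnion fun z _ ↦ by simp
  refine ⟨⋃ g ∈ polys, (g.coeffs : Set R), hpolys.biUnion fun g _ ↦ g.coeffs.finite_toSet, ?_⟩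
  intro S' hS' T _ _ h'
  obtain ⟨L, l, hL, hl⟩ := exists_lifted_polynomials_ringHom S' h'
  have hpL (g) (hg : g ∈ polys) : g ∈ L := by
    refine hL g fun n ↦ ?_
    by_cases hn : g.coeff n = 0
    · rw [hn]; exact S'.zero_mem
    · exact hS' (Set.mem_biUnion hg (Finset.mem_coe.mpr (coeff_mem_coeffs hn)))
  have hEL : E ∈ L := hpL _ (by simp [polys])
  have hVL : V ∈ L := hpL _ (by simp [polys])
  have hqL : q ∈ L := hpL _ (by simp [polys])
  have hfiL (i) : f (C (MvPolynomial.X i)) ∈ L :=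
    hpL _ (Or.inl (Or.inr (Set.mem_iUnion.mpr ⟨i, rfl⟩)))
  have hXL : X ∈ L := hL _ fun n ↦ by
    rw [coeff_X]; split_ifs
    exacts [S'.one_mem, S'.zero_mem]
  have hfL (a) : f a ∈ L := by
    induction a using Polynomial.induction_on' with
    | add a b ha hb => rw [map_add]; exact L.add_mem ha hb
    | monomial n a =>
      rw [← C_mul_X_pow_eq_monomial, map_mul, map_pow]
      refine L.mul_mem ?_ (L.pow_mem (hpL _ (by simp [polys])) n)
      induction a using MvPolynomial.induction_on with
      | C a => simp
      | add a b ha hb => rw [map_add, map_add]; exact L.add_mem ha hb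
      | mul_X a i ha =>
        rw [map_mul, map_mul]
        exact L.mul_mem ha (hfiL i)
  let f' : (MvPolynomial σ ℤ)[X] →+* PowerSeries T := l.comp (f.codRestrict L hfL)
  have hlX : l ⟨X, hXL⟩ = PowerSeries.X := by
    ext n
    obtain ⟨h1, h2⟩ := hl X hXL n
    rw [h2, PowerSeries.coeff_X]
    split_ifs with hn
    · subst hn
      convert map_one h'
      simp
    · convert map_zero h'
      simp [coeff_X, Ne.symm hn]
  have hE0 : l ⟨E, hEL⟩ ≠ 0 := by
    intro h0
    obtain ⟨h1, h2⟩ := hl E hEL E.natDegree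
    rw [h0, map_zero] at h2
    have h3 : (⟨E.coeff E.natDegree, h1⟩ : S') = 1 := Subtype.ext hE
    rw [h3, map_one] at h2
    exact zero_ne_one h2
  have hVu : IsUnit (l ⟨V, hVL⟩) := by
    rw [PowerSeries.isUnit_iff_constantCoeff, ← PowerSeries.coeff_zero_eq_constantCoeff_apply]
    obtain ⟨h1, h2⟩ := hl V hVL 0
    obtain ⟨h3, h4⟩ := hl (C V') (hpL _ (by simp [polys])) 0
    rw [h2]
    refine IsUnit.of_mul_eq_one (h' ⟨_, h3⟩) ?_
    rw [← map_mul]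
    convert map_one h'
    exact Subtype.ext (by simpa using hV')
  have hf'F : f' F = PowerSeries.X * l ⟨E, hEL⟩ ^ 2 * l ⟨q, hqL⟩ := by
    rw [← hlX, ← map_pow, ← map_mul, ← map_mul]
    exact congr_arg l (Subtype.ext hq)
  have hf'EV : f' (derivative F) * f' (C G) = l ⟨E, hEL⟩ * l ⟨V, hVL⟩ := by
    rw [← map_mul, ← map_mul l]
    exact congr_arg l (Subtype.ext (by simpa using hEV))
  obtain ⟨S, h, hZS, hSC, hSs⟩ := exists_specialization ev F hF G f' (l ⟨E, hEL⟩) (l ⟨V, hVL⟩)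
    (l ⟨q, hqL⟩) hE0 hVu hf'F hf'EV Z fun z hz ↦ by
      have hz' (g) (hg : g ∈ ({U z, r z} : Set R[X])) : g ∈ L :=
        hpL _ (Or.inr (Set.mem_biUnion hz hg))
      refine ⟨P z, hP z hz, l ⟨U z, hz' _ (by simp)⟩, l ⟨r z, hz' _ (by simp)⟩, ?_⟩
      rw [← hlX, ← map_pow, ← map_mul l, ← map_mul l]
      simp only [f', RingHom.comp_apply]
      rw [← map_mul l, ← map_add l]
      exact congr_arg l (Subtype.ext (hr z hz))
  refine ⟨S, h, hZS, fun i n ↦ ?_, hSs⟩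
  obtain ⟨h1, h2⟩ := hSC (MvPolynomial.X i)
  obtain ⟨h3, h4⟩ := hl _ (hfiL i) n
  exact ⟨h1, h3, by rw [h2]; exact h4⟩

theorem algebraicIndepOn_range_of_injective {K D σ : Type*} [CommRing K] [CharZero K] [CommRing D]
    {g : MvPolynomial σ K →+* D} (hg : Function.Injective g) {x : σ → D}
    (hx : ∀ i, g (MvPolynomial.X i) = x i) : AlgebraicIndepOn ℤ id (Set.range x) := by
  have h : AlgebraicIndependent ℤ x := by
    rw [algebraicIndependent_iff_injective_aeval]
    have h1 : (MvPolynomial.aeval x : MvPolynomial σ ℤ →ₐ[ℤ] D).toRingHom =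
        g.comp (MvPolynomial.map (Int.castRingHom K)) := by
      refine MvPolynomial.ringHom_ext' (RingHom.ext_int _ _) fun i ↦ ?_
      simp [hx]
    have h2 : Function.Injective (g.comp (MvPolynomial.map (σ := σ) (Int.castRingHom K))) :=
      hg.comp (MvPolynomial.map_injective _ Int.cast_injective)
    rw [← h1] at h2
    exact h2
  exact h.coe_range

theorem span_range_eq_of_coordinate_change {T : Type*} [CommRing T] {d : ℕ} (a b : Fin d → T)
    (y : Fin (d + 1) → PowerSeries T) (h0 : y 0 = PowerSeries.X)
    (hs : ∀ j, y (Fin.succ j) = PowerSeries.C (a j) + PowerSeries.C (b j) * PowerSeries.X)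
    (ζ : ℕ → T) (hζ : Ideal.span (Set.range a) = Ideal.span (ζ '' Set.Iio d)) :
    Ideal.span (Set.range y) = Ideal.span (snocX d ζ '' Set.Iio (d + 1)) := by
  rw [snocX_image_self]
  have h1 : Ideal.span ((fun i ↦ PowerSeries.C (ζ i)) '' Set.Iio d) =
      Ideal.span (Set.range fun j ↦ PowerSeries.C (a j)) := by
    have := congr_arg (Ideal.map PowerSeries.C) hζ
    rw [Ideal.map_span, Ideal.map_span, ← Set.range_comp, ← Set.image_comp] at this
    exact this.symm
  rw [h1]
  have hX : PowerSeries.X ∈ Ideal.span (Set.range y) := Ideal.subset_span ⟨0, h0⟩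
  refine le_antisymm (Ideal.span_le.mpr ?_) (sup_le (Ideal.span_le.mpr ?_) (Ideal.span_le.mpr ?_))
  · rintro _ ⟨i, rfl⟩
    have hX' : PowerSeries.X ∈ Ideal.span (Set.range fun j ↦ PowerSeries.C (a j)) ⊔
        Ideal.span {PowerSeries.X} := Ideal.mem_sup_right (Ideal.mem_span_singleton_self _)
    refine Fin.cases ?_ (fun j ↦ ?_) i
    · rw [h0]
      exact hX'
    · rw [hs]
      exact Ideal.add_mem _ (Ideal.mem_sup_left (Ideal.subset_span ⟨j, rfl⟩))
        (Ideal.mul_mem_left _ _ hX')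
  · rintro _ ⟨j, rfl⟩
    have : PowerSeries.C (a j) = y j.succ - PowerSeries.C (b j) * PowerSeries.X := by
      rw [hs]; ring
    change PowerSeries.C (a j) ∈ _
    rw [this]
    exact Ideal.sub_mem _ (Ideal.subset_span ⟨_, rfl⟩) (Ideal.mul_mem_left _ _ hX)
  · rintro _ rfl
    exact hX

theorem exists_primitive_presentation_ringHom {D : Type} [CommRing D] [IsDomain D] [CharZero D]
    {x : Set D} (hx : x.Finite) (hind : AlgebraicIndepOn ℤ id x) {Z : Set D} (hZ : Z.Finite)
    {s : D} (hs : s ≠ 0) :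
    ∃ u : Set D, u.Finite ∧ x ⊆ u ∧ ∃ (ev : (MvPolynomial u ℤ)[X] →+* D)
      (F : (MvPolynomial u ℤ)[X]) (G : MvPolynomial u ℤ),
      (∀ i : u, ev (C (MvPolynomial.X i)) = i) ∧ ev F = 0 ∧ ev (derivative F) ≠ 0 ∧
      (∀ P, ev P = 0 → F ∣ P) ∧ ev (C G) ≠ 0 ∧
      (∀ z ∈ insert s Z, ∃ P, ev P = ev (C G) * z) ∧ ∃ Q, s * ev Q = ev (C G) := by
  obtain ⟨u, hu, hxu, w, F, G, hF, hF', hFd, hG, hZP, Q, hQ⟩ :=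
    exists_primitive_presentation hx hind (hZ.insert s) hs
  let ev : (MvPolynomial u ℤ)[X] →+* D :=
    eval₂RingHom (MvPolynomial.aeval (↑) : MvPolynomial u ℤ →ₐ[ℤ] _).toRingHom w
  have hevC (a) : ev (C a) = MvPolynomial.aeval (fun i : u ↦ (i : D)) a := by simp [ev]
  refine ⟨u, hu, hxu, ev, F, G, fun i ↦ by rw [hevC, MvPolynomial.aeval_X], hF, hF', hFd,
    by rw [hevC]; exact hG, fun z hz ↦ ?_, Q, by rw [hevC]; exact hQ⟩
  obtain ⟨P, hP⟩ := hZP z hz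
  exact ⟨P, by rw [hevC]; exact hP.symm⟩

theorem hasCharPModels_succ {K : Type} [Field K] [CharZero K] {d : ℕ}
    (hd : HasCharPModels d (MvPowerSeries.X : Fin d → MvPowerSeries (Fin d) K)) :
    HasCharPModels (d + 1)
      (MvPowerSeries.X : Fin (d + 1) → MvPowerSeries (Fin (d + 1)) K) := by
  intro Z hZ s hs
  have : IsDomain (MvPowerSeries (Fin d) K) := NoZeroDivisors.to_isDomain _
  have : IsDomain (MvPowerSeries (Fin (d + 1)) K) := NoZeroDivisors.to_isDomain _
  have : CharZero (MvPowerSeries (Fin (d + 1)) K) :=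
    charZero_of_injective_algebraMap (R := K) (FaithfulSMul.algebraMap_injective _ _)
  obtain ⟨u, hu, hXu, ev, F, G, hevX, hF, hF', hFd, hG, hZP, Q, hQ⟩ :=
    exists_primitive_presentation_ringHom (Set.finite_range _) (algebraicIndepOn_range_of_injective
      (g := MvPolynomial.coeToMvPowerSeries.ringHom (R := K)) (MvPolynomial.coe_injective _ K)
      (x := (MvPowerSeries.X : Fin (d + 1) → _)) fun i ↦ MvPolynomial.coe_X i) hZ hs
  have := hu.to_subtype
  obtain ⟨c, Φ, hΦ0, hΦs, hΦe⟩ := exists_coordinate_change (mul_ne_zero hF' hG)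
  have := mvPowerSeries_isAdicComplete (σ := Fin d) (K := K)
  obtain ⟨f, E, V, q, hE, hV, hq, hEV, hfz, hfX⟩ :=
    exists_polynomial_approximation ev Φ F G hF hΦe
  obtain ⟨Z', hZ', H⟩ := exists_specialization_of_subring ev F G hFd f E V q hE hV hq hEV
    (hZ.insert s) fun z hz ↦ by
      obtain ⟨P, hP⟩ := hZP z hz
      exact ⟨P, hP, hfz z P hP⟩
  obtain ⟨S', hS', x', -, hx', -, p, hp, T', _, _, _, h', ζ', -, hspan, hinf, hreg⟩ :=
    hd (Z' ∪ Set.range fun j ↦ MvPowerSeries.C (c j)) (hZ'.union (Set.finite_range _)) 1 one_ne_zero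
  obtain ⟨S, h, hZS, hSX, hSs⟩ := H S' (Set.subset_union_left.trans hS') T' h'
  have hcS (j) : MvPowerSeries.C (c j) ∈ S' := hS' (Or.inr ⟨j, rfl⟩)
  let k (i : Fin (d + 1)) : u := ⟨MvPowerSeries.X i, hXu ⟨i, rfl⟩⟩
  have hk (i) : ev (C (MvPolynomial.X (k i))) = MvPowerSeries.X i := hevX (k i)
  have hxS (i) : MvPowerSeries.X i ∈ S := by
    obtain ⟨h1, -, -⟩ := hSX (k i) 0
    rwa [hk] at h1
  have hf0 : f (C (MvPolynomial.X (k 0))) = X := hfX _ _ (by rw [hk, hΦ0, coe_X])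
  have hfs (j) : f (C (MvPolynomial.X (k (Fin.succ j)))) =
      C (MvPowerSeries.X j) + C (MvPowerSeries.C (c j)) * X := hfX _ _ (by
    rw [hk, hΦs, coe_add, coe_mul, coe_C, coe_C, coe_X])
  have hcoeff (i n) : ∃ hn : (f (C (MvPolynomial.X (k i)))).coeff n ∈ S',
      PowerSeries.coeff n (h ⟨MvPowerSeries.X i, hxS i⟩) = h' ⟨_, hn⟩ := by
    obtain ⟨h1, h2, h3⟩ := hSX (k i) n
    refine ⟨h2, h3 ▸ ?_⟩
    congr 3
    exact (hk i).symm
  have hh0 : h ⟨MvPowerSeries.X 0, hxS 0⟩ = PowerSeries.X := by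
    ext n
    obtain ⟨h1, h2⟩ := hcoeff 0 n
    have h3 : (⟨_, h1⟩ : S') = if n = 1 then 1 else 0 := by
      ext1
      dsimp only
      rw [hf0, coeff_X]
      split_ifs <;> first | rfl | omega
    rw [h2, h3, PowerSeries.coeff_X]
    split_ifs <;> simp
  have hhs (j) : h ⟨MvPowerSeries.X (Fin.succ j), hxS _⟩ =
      PowerSeries.C (h' (x' j)) + PowerSeries.C (h' ⟨_, hcS j⟩) * PowerSeries.X := by
    ext n
    obtain ⟨h1, h2⟩ := hcoeff (Fin.succ j) n
    have h3 : (⟨_, h1⟩ : S') = (if n = 0 then x' j else 0) +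
        (if n = 1 then ⟨_, hcS j⟩ else 0) := by
      ext1
      dsimp only
      rw [hfs, coeff_add, coeff_C_mul, coeff_C, coeff_X, Subring.coe_add, ← hx']
      split_ifs <;> first | omega | simp
    rw [h2, h3, map_add, map_add, PowerSeries.coeff_C_mul, PowerSeries.coeff_C,
      PowerSeries.coeff_X]
    split_ifs <;> simp
  refine ⟨S, (Set.subset_insert s Z).trans hZS, fun i ↦ ⟨_, hxS i⟩, ⟨s, hZS (Set.mem_insert s Z)⟩,
    fun i ↦ rfl, rfl, p, hp, PowerSeries T', inferInstance, inferInstance,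
    charP_of_injective_ringHom PowerSeries.C_injective p, h, snocX d ζ', ?_, ?_, ?_, ?_⟩
  · exact hSs _ _ Q hQ
  · exact span_range_eq_of_coordinate_change (fun j ↦ h' (x' j)) (fun j ↦ h' ⟨_, hcS j⟩) _ hh0 hhs
      ζ' hspan
  · exact snocX_iInf_pow d ζ' hinf
  · exact fun M j hj a ha ↦ snocX_regular d ζ' hreg M j hj a ha

theorem hasCharPModels_mvPowerSeries (K : Type) [Field K] [CharZero K] (d : ℕ) :
    HasCharPModels d (MvPowerSeries.X : Fin d → MvPowerSeries (Fin d) K) := by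
  induction d with
  | zero =>
    have : IsDomain (MvPowerSeries (Fin 0) K) := NoZeroDivisors.to_isDomain _
    exact hasCharPModels_zero _
  | succ d hd => exact hasCharPModels_succ hd

end InductionStep

section CoefficientField

theorem exists_mvPowerSeries_ringHom {K S σ : Type*} [CommRing K] [CommRing S] [Finite σ]
    (I : Ideal S) [IsAdicComplete I S] (ι : K →+* S) (a : σ → S) (ha : ∀ i, a i ∈ I) :
    ∃ g : MvPowerSeries σ K →+* S, (∀ i, g (MvPowerSeries.X i) = a i) ∧
      ∀ k, g (MvPowerSeries.C k) = ι k := by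
  let e : MvPolynomial σ K →+* S := MvPolynomial.eval₂Hom ι a
  have he (n) : MvPolynomial.idealOfVars σ K ^ n ≤ (I ^ n).comap e := by
    rw [← Ideal.map_le_iff_le_comap, Ideal.map_pow]
    refine Ideal.pow_right_mono ?_ n
    rw [MvPolynomial.idealOfVars, Ideal.map_span, Ideal.span_le]
    rintro _ ⟨_, ⟨i, rfl⟩, rfl⟩
    simpa [e] using ha i
  let f (n : ℕ) : MvPowerSeries σ K →+* S ⧸ I ^ n :=
    (Ideal.quotientMap (I ^ n) e (he n)).comp (MvPowerSeries.truncTotalAlgHom σ K n).toRingHom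
  have hf (n x) : f n x = Ideal.Quotient.mk (I ^ n) (e (MvPowerSeries.truncTotal n x)) := rfl
  have hcomp {m n : ℕ} (hmn : m ≤ n) : (Ideal.Quotient.factorPow I hmn).comp (f n) = f m := by
    ext x
    rw [RingHom.comp_apply, hf, hf]
    change Ideal.Quotient.mk (I ^ m) _ = _
    rw [Ideal.Quotient.eq, ← map_sub]
    exact he m (MvPowerSeries.truncTotal_sub_truncTotal_mem_pow_idealOfVars hmn le_rfl _)
  have hp (p : MvPolynomial σ K) : IsAdicComplete.liftRingHom I f hcomp p = e p := by
    refine sub_eq_zero.mp (IsHausdorff.haus (I := I) inferInstance _ fun n ↦ ?_)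
    rw [SModEq.sub_mem, sub_zero, smul_eq_mul, Ideal.mul_top, ← Ideal.Quotient.eq,
      IsAdicComplete.mk_liftRingHom, hf, Ideal.Quotient.eq, ← map_sub]
    refine he n ((MvPolynomial.mem_pow_idealOfVars_iff' ..).mpr fun x hx ↦ ?_)
    simp [MvPowerSeries.coeff_truncTotal _ hx]
  refine ⟨IsAdicComplete.liftRingHom I f hcomp, fun i ↦ ?_, fun k ↦ ?_⟩
  · rw [← MvPolynomial.coe_X, hp]
    simp [e]
  · rw [← MvPolynomial.coe_C, hp]
    simp [e]

/-- Existence of coefficient fields in residue characteristic zero. -/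
theorem exists_coefficientField (S : Type*) [CommRing S] [IsLocalRing S]
    [IsAdicComplete (IsLocalRing.maximalIdeal S) S] [Algebra ℚ S] :
    ∃ ι : IsLocalRing.ResidueField S →+* S, ∀ k, IsLocalRing.residue S (ι k) = k := by
  have : CharZero (IsLocalRing.ResidueField S) := algebraRat.charZero _
  obtain ⟨s, hs⟩ := exists_isTranscendenceBasis ℚ (IsLocalRing.ResidueField S)
  have h1 := hs.isAlgebraic_field
  have : Algebra.FormallySmooth ℚ (IsLocalRing.ResidueField S) :=
    .of_algebraicIndependent_of_isSeparable hs.1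
  let f : IsLocalRing.ResidueField S →ₐ[ℚ] S ⧸ IsLocalRing.maximalIdeal S :=
    RingHom.toRatAlgHom (R := IsLocalRing.ResidueField S) (S := S ⧸ IsLocalRing.maximalIdeal S)
      (RingHom.id (IsLocalRing.ResidueField S))
  obtain ⟨g, hg⟩ := Algebra.FormallySmooth.exists_mkₐ_comp_eq_of_isAdicComplete f
  exact ⟨g.toRingHom, fun k ↦ DFunLike.congr_fun hg k⟩

theorem mem_span_range_of_isAdicComplete {R M : Type*} [CommRing R] [AddCommGroup M] [Module R M]
    (I : Ideal R) [IsAdicComplete I R] [IsHausdorff I M] {ι : Type*} [Finite ι] (e : ι → M)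
    (he : ∀ m : M, ∃ v ∈ Submodule.span R (Set.range e), m - v ∈ (I • ⊤ : Submodule R M)) :
    Submodule.span R (Set.range e) = ⊤ := by
  have := Fintype.ofFinite ι
  have hstep (n : ℕ) (m : M) (hm : m ∈ (I ^ n • ⊤ : Submodule R M)) : ∃ r : ι → R,
      (∀ j, r j ∈ I ^ n) ∧ m - ∑ j, r j • e j ∈ (I ^ (n + 1) • ⊤ : Submodule R M) := by
    induction hm using Submodule.smul_induction_on' with
    | smul a ha m _ =>
      obtain ⟨v, hv, hmv⟩ := he m
      obtain ⟨r, rfl⟩ := (Submodule.mem_span_range_iff_exists_fun R).mp hv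
      refine ⟨fun j ↦ a * r j, fun j ↦ Ideal.mul_mem_right _ _ ha, ?_⟩
      simp_rw [mul_smul]
      rw [← Finset.smul_sum, ← smul_sub, pow_succ, mul_smul]
      exact Submodule.smul_mem_smul ha hmv
    | add m _ m' _ h h' =>
      obtain ⟨r, hr, h⟩ := h
      obtain ⟨r', hr', h'⟩ := h'
      refine ⟨r + r', fun j ↦ add_mem (hr j) (hr' j), ?_⟩
      convert add_mem h h' using 1
      simp only [Pi.add_apply, add_smul, Finset.sum_add_distrib]
      abel
  choose! r hr hr' using hstep
  refine eq_top_iff.mpr fun m _ ↦ ?_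
  let s : ℕ → ι → R := fun n ↦ n.rec 0 fun n s ↦ s + r n (m - ∑ j, s j • e j)
  have hs (n) : m - ∑ j, s n j • e j ∈ (I ^ n • ⊤ : Submodule R M) := by
    induction n with
    | zero => simp
    | succ n ih =>
      convert hr' n _ ih using 1
      simp only [s, Pi.add_apply, add_smul, Finset.sum_add_distrib]
      abel
  have hmono (j) (n k : ℕ) : s (n + k) j - s n j ∈ I ^ n := by
    induction k with
    | zero => simp
    | succ k ih =>
      have h1 : s (n + (k + 1)) j = s (n + k) j + r (n + k) (m - ∑ j, s (n + k) j • e j) j := rfl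
      rw [h1, add_sub_right_comm]
      exact add_mem ih (Ideal.pow_le_pow_right (Nat.le_add_right n k) (hr _ _ (hs _) j))
  have hlim (j) : ∃ L, ∀ n, s n j ≡ L [SMOD (I ^ n • ⊤ : Submodule R R)] := by
    refine IsPrecomplete.prec (I := I) inferInstance fun {n k} hnk ↦ ?_
    obtain ⟨k, rfl⟩ := Nat.exists_eq_add_of_le hnk
    rw [SModEq.comm, SModEq.sub_mem, smul_eq_mul, Ideal.mul_top]
    exact hmono j n k
  choose L hL using hlim
  refine (Submodule.mem_span_range_iff_exists_fun R).mpr ⟨L, ?_⟩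
  refine (sub_eq_zero.mp (IsHausdorff.haus (I := I) inferInstance _ fun n ↦ ?_)).symm
  rw [SModEq.sub_mem, sub_zero]
  have h1 : m - ∑ j, L j • e j = (m - ∑ j, s n j • e j) + ∑ j, (s n j - L j) • e j := by
    simp only [sub_smul, Finset.sum_sub_distrib]
    abel
  rw [h1]
  refine add_mem (hs n) (sum_mem fun j _ ↦ ?_)
  have h2 := hL j n
  rw [SModEq.sub_mem, smul_eq_mul, Ideal.mul_top] at h2
  exact Submodule.smul_mem_smul h2 Submodule.mem_top

end CoefficientField

section FiniteExtension

open IsLocalRing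

theorem exists_finite_generators_mod_pow {R S : Type*} [CommRing R] [CommRing S] [Algebra R S]
    {J : Ideal S} (hJ : J.FG) (hres : ∀ y : S, ∃ r : R, y - algebraMap R S r ∈ J) (n : ℕ) :
    ∃ F : Set S, F.Finite ∧ ∀ y : S, ∃ v ∈ Submodule.span R F, y - v ∈ J ^ n := by
  induction n with
  | zero => exact ⟨∅, Set.finite_empty, fun y ↦ ⟨0, zero_mem _, by simp⟩⟩
  | succ n ih =>
    obtain ⟨F, hF, h⟩ := ih
    obtain ⟨G, hG⟩ := hJ.pow (n := n)
    refine ⟨F ∪ G, hF.union G.finite_toSet, fun y ↦ ?_⟩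
    obtain ⟨v, hv, hyv⟩ := h y
    have key (w : S) (hw : w ∈ Ideal.span (G : Set S)) :
        ∃ v ∈ Submodule.span R (G : Set S), w - v ∈ J ^ (n + 1) := by
      induction hw using Submodule.span_induction with
      | mem g hg => exact ⟨g, Submodule.subset_span hg, by simp⟩
      | zero => exact ⟨0, zero_mem _, by simp⟩
      | add a b _ _ ha hb =>
        obtain ⟨v, hv, ha⟩ := ha
        obtain ⟨w, hw, hb⟩ := hb
        exact ⟨v + w, add_mem hv hw, by rw [add_sub_add_comm]; exact add_mem ha hb⟩
      | smul a g hg' hg =>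
        obtain ⟨v, hv, hg⟩ := hg
        obtain ⟨r, hr⟩ := hres a
        refine ⟨r • v, Submodule.smul_mem _ _ hv, ?_⟩
        have h1 : a • g - r • v = (a - algebraMap R S r) * g + algebraMap R S r * (g - v) := by
          rw [Algebra.smul_def r v, smul_eq_mul]; ring
        rw [h1]
        refine add_mem ?_ (Ideal.mul_mem_left _ _ hg)
        rw [pow_succ']
        exact Ideal.mul_mem_mul hr (hG ▸ hg')
    obtain ⟨w, hw, hyw⟩ := key (y - v) (hG ▸ hyv)
    refine ⟨v + w, add_mem (Submodule.span_mono Set.subset_union_left hv)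
      (Submodule.span_mono Set.subset_union_right hw), ?_⟩
    rwa [← sub_sub]

theorem finite_of_isAdicComplete {R S : Type*} [CommRing R] [CommRing S] [Algebra R S]
    {I : Ideal R} [IsAdicComplete I R] {J : Ideal S} (hJ : J.FG) [IsHausdorff J S]
    (hres : ∀ y : S, ∃ r : R, y - algebraMap R S r ∈ J) (hIJ : I.map (algebraMap R S) ≤ J)
    {s : ℕ} (hJI : J ^ s ≤ I.map (algebraMap R S)) : Module.Finite R S := by
  obtain ⟨F, hF, h⟩ := exists_finite_generators_mod_pow hJ hres s
  have hI (n) (y : S) : y ∈ (I ^ n • ⊤ : Submodule R S) ↔ y ∈ I.map (algebraMap R S) ^ n := by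
    rw [Ideal.smul_top_eq_map, Ideal.map_pow]
    rfl
  have : IsHausdorff I S := ⟨fun y hy ↦ IsHausdorff.haus (I := J) inferInstance _ fun n ↦ by
    have := hy n
    rw [SModEq.sub_mem, sub_zero, hI] at this
    rw [SModEq.sub_mem, sub_zero, smul_eq_mul, Ideal.mul_top]
    exact Ideal.pow_right_mono hIJ n this⟩
  have := hF.to_subtype
  refine ⟨⟨hF.toFinset, ?_⟩⟩
  rw [hF.coe_toFinset]
  have h1 := mem_span_range_of_isAdicComplete (R := R) I ((↑) : F → S) fun y ↦ by
    obtain ⟨v, hv, hyv⟩ := h y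
    refine ⟨v, by simpa using hv, ?_⟩
    have := (hI 1 (y - v)).mpr (by simpa using hJI hyv)
    simpa using this
  simpa using h1

theorem exists_pow_maximalIdeal_le_span (A : Type*) [CommRing A] [IsLocalRing A]
    [IsNoetherianRing A] {d : ℕ} (hd : ringKrullDim A = d) :
    ∃ x : Fin d → A, (∀ i, x i ∈ maximalIdeal A) ∧
      ∃ s, maximalIdeal A ^ s ≤ Ideal.span (Set.range x) := by
  obtain ⟨t, ht, hcard⟩ :=
    Ideal.exists_finset_card_eq_height_of_isNoetherianRing (maximalIdeal A)
  have hcard : t.card = d := by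
    have := IsLocalRing.maximalIdeal_height_eq_ringKrullDim (R := A)
    rw [hd, ← hcard] at this
    exact_mod_cast this
  let e : Fin d ≃ t := (t.equivFinOfCardEq hcard).symm
  have hrange : Set.range (fun i ↦ (e i : A)) = t := by
    rw [← Function.comp_def, e.surjective.range_comp, Subtype.range_coe]
  refine ⟨fun i ↦ e i, fun i ↦ ht.1.2 (Ideal.subset_span (e i).2), ?_⟩
  rw [hrange]
  refine Ideal.exists_pow_le_of_le_radical_of_fg ?_ (IsNoetherian.noetherian _)
  rw [Ideal.radical_eq_sInf]
  refine le_sInf fun P hP ↦ ?_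
  obtain ⟨hP, hPp⟩ := hP
  exact ht.2 ⟨hPp, hP⟩ (le_maximalIdeal hPp.ne_top)

theorem algebraMap_injective_of_ltSeries {R S : Type*} [CommRing R] [IsDomain R] [CommRing S]
    [Algebra R S] [Algebra.IsIntegral R S] {d : ℕ} (hR : ringKrullDim R ≤ d)
    (l : LTSeries (PrimeSpectrum S)) (hl : l.length = d) :
    Function.Injective (algebraMap R S) := by
  let L : LTSeries (PrimeSpectrum R) := l.map (PrimeSpectrum.comap (algebraMap R S))
    fun P Q h ↦ Ideal.IsIntegral.comap_lt_comap h
  rw [injective_iff_map_eq_zero]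
  intro r hr
  by_contra hr0
  have hbot : (⟨⊥, Ideal.isPrime_bot⟩ : PrimeSpectrum R) < L.head := by
    refine lt_of_le_of_ne bot_le fun h ↦ hr0 ?_
    have h1 : r ∈ L.head.asIdeal := by
      change algebraMap R S r ∈ l.head.asIdeal
      rw [hr]
      exact zero_mem _
    rw [← h] at h1
    exact h1
  have h2 := Order.LTSeries.length_le_krullDim (L.cons _ hbot)
  have h3 : ((L.cons _ hbot).length : WithBot ℕ∞) = (d + 1 : ℕ) := by
    rw [RelSeries.cons_length]
    exact_mod_cast congr_arg (· + 1) hl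
  rw [h3] at h2
  have h4 := h2.trans hR
  norm_cast at h4
  omega

theorem exists_ltSeries_of_flat_isLocalHom (A S : Type*) [CommRing A] [IsLocalRing A]
    [IsNoetherianRing A] [CommRing S] [IsLocalRing S] [Algebra A S] [Module.Flat A S]
    [IsLocalHom (algebraMap A S)] {d : ℕ} (hd : ringKrullDim A = d) :
    ∃ l : LTSeries (PrimeSpectrum S), l.length = d := by
  obtain ⟨l, hlast, hlen⟩ := (maximalIdeal A).exists_ltSeries_length_eq_height
  have hlen : l.length = d := by
    have := IsLocalRing.maximalIdeal_height_eq_ringKrullDim (R := A)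
    rw [hd, ← hlen] at this
    exact_mod_cast this
  have : (maximalIdeal S).LiesOver l.last.asIdeal := by
    rw [hlast]
    exact ⟨(maximalIdeal_comap (algebraMap A S)).symm⟩
  obtain ⟨L, hL, -⟩ := Ideal.exists_ltSeries_of_hasGoingDown l (maximalIdeal S)
  exact ⟨L, hL.trans hlen⟩

theorem ringKrullDim_mvPowerSeries_le (K : Type*) [Field K] (d : ℕ) :
    ringKrullDim (MvPowerSeries (Fin d) K) ≤ d := by
  refine (ringKrullDim_le_spanFinrank_maximalIdeal _).trans ?_
  rw [mvPowerSeries_maximalIdeal_eq_span_X]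
  have h := Submodule.spanFinrank_span_le_ncard_of_finite (R := MvPowerSeries (Fin d) K)
    (Set.finite_range (MvPowerSeries.X : Fin d → MvPowerSeries (Fin d) K))
  have h' : (Set.range (MvPowerSeries.X : Fin d → MvPowerSeries (Fin d) K)).ncard ≤ d := by
    simpa [Set.image_univ] using Set.ncard_image_le (Set.finite_univ)
      (f := (MvPowerSeries.X : Fin d → MvPowerSeries (Fin d) K))
  exact_mod_cast h.trans h'

/-- A Noetherian local ring of dimension `d` and residue characteristic zero maps to a domain that
is finite over a power series ring, a system of parameters being sent to the variables. -/
theorem exists_ringHom_finite_over_mvPowerSeries (A : Type) [CommRing A] [IsLocalRing A]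
    [IsNoetherianRing A] [Algebra ℚ A] {d : ℕ} (hd : ringKrullDim A = d) :
    ∃ (K : Type) (_ : Field K) (_ : CharZero K) (B : Type) (_ : CommRing B) (_ : IsDomain B)
      (_ : Algebra (MvPowerSeries (Fin d) K) B) (ψ : A →+* B) (x : Fin d → A),
      Module.Finite (MvPowerSeries (Fin d) K) B ∧
      Function.Injective (algebraMap (MvPowerSeries (Fin d) K) B) ∧
      (∀ i, ψ (x i) = algebraMap (MvPowerSeries (Fin d) K) B (MvPowerSeries.X i)) ∧
      (∀ i, x i ∈ maximalIdeal A) ∧ ∃ s, maximalIdeal A ^ s ≤ Ideal.span (Set.range x) := by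
  obtain ⟨x, hx, s, hs⟩ := exists_pow_maximalIdeal_le_span A hd
  let S := AdicCompletion (maximalIdeal A) A
  let K := ResidueField S
  have hmax : maximalIdeal S = (maximalIdeal A).map (algebraMap A S) :=
    AdicCompletion.maximalIdeal_eq_map
  let _ : Algebra ℚ S := ((algebraMap A S).comp (algebraMap ℚ A)).toAlgebra
  have : CharZero K := algebraRat.charZero _
  obtain ⟨ι, hι⟩ := exists_coefficientField S
  obtain ⟨g, hgX, hgC⟩ := exists_mvPowerSeries_ringHom (maximalIdeal S) ι
    (fun i ↦ algebraMap A S (x i)) fun i ↦ hmax ▸ Ideal.mem_map_of_mem _ (hx i)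
  let R := MvPowerSeries (Fin d) K
  have : IsDomain R := NoZeroDivisors.to_isDomain _
  let _ : Algebra R S := g.toAlgebra
  have : IsAdicComplete (maximalIdeal R) R := mvPowerSeries_isAdicComplete
  have hmap : (maximalIdeal R).map (algebraMap R S) =
      (Ideal.span (Set.range x)).map (algebraMap A S) := by
    rw [mvPowerSeries_maximalIdeal_eq_span_X, Ideal.map_span, Ideal.map_span, ← Set.range_comp,
      ← Set.range_comp]
    exact congr_arg _ (congr_arg _ (funext hgX))
  have hfin : Module.Finite R S := by
    refine finite_of_isAdicComplete (I := maximalIdeal R) (J := maximalIdeal S) (s := s) ?_ ?_ ?_ ?_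
    · rw [hmax]
      exact Ideal.FG.map (IsNoetherian.noetherian _) _
    · intro y
      refine ⟨MvPowerSeries.C (residue S y), ?_⟩
      rw [← residue_eq_zero_iff, map_sub, sub_eq_zero]
      change _ = residue S (g _)
      rw [hgC, hι]
    · rw [hmap, hmax]
      refine Ideal.map_mono (Ideal.span_le.mpr ?_)
      rintro _ ⟨i, rfl⟩
      exact hx i
    · rw [hmap, hmax, ← Ideal.map_pow]
      exact Ideal.map_mono hs
  obtain ⟨l, hl⟩ := exists_ltSeries_of_flat_isLocalHom A S hd
  have hinj : Function.Injective (algebraMap R S) :=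
    algebraMap_injective_of_ltSeries (ringKrullDim_mvPowerSeries_le K d) l hl
  obtain ⟨P, -, hP, hPR⟩ := Ideal.exists_ideal_over_prime_of_isIntegral (⊥ : Ideal R) (⊥ : Ideal S)
    (by rw [← RingHom.ker_eq_comap_bot, (RingHom.injective_iff_ker_eq_bot _).mp hinj])
  refine ⟨K, inferInstance, inferInstance, S ⧸ P, inferInstance, inferInstance, inferInstance,
    (Ideal.Quotient.mk P).comp (algebraMap A S), x, inferInstance, ?_, fun i ↦ ?_, hx, s, hs⟩
  · rw [RingHom.injective_iff_ker_eq_bot, ← hPR]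
    ext r
    rw [RingHom.mem_ker, Ideal.mem_comap]
    exact Ideal.Quotient.eq_zero_iff_mem
  · exact congr_arg (Ideal.Quotient.mk P) (hgX i).symm

end FiniteExtension

section CharPModelOfFinite

theorem exists_smul_eq_sum_smul (R B : Type*) [CommRing R] [IsDomain R] [AddCommGroup B]
    [Module R B] [Module.Finite R B] : ∃ (n : ℕ) (b : Fin n → B) (β : Fin n → B →ₗ[R] R) (c : R),
      c ≠ 0 ∧ ∀ a, c • a = ∑ i, β i a • b i := by
  obtain ⟨m, e, he⟩ := Module.Finite.exists_fin (R := R) (M := B)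
  obtain ⟨s, hs, h⟩ := exists_maximal_linearIndepOn R e
  have h' (j : Fin m) : ∃ a : R, a ≠ 0 ∧ a • e j ∈ Submodule.span R (e '' s) := by
    by_cases hj : j ∈ s
    · exact ⟨1, one_ne_zero, by
      rw [one_smul]; exact Submodule.subset_span (Set.mem_image_of_mem e hj)⟩
    · exact h j hj
  choose a ha hae using h'
  have hc (x : B) : (∏ j, a j) • x ∈ Submodule.span R (e '' s) := by
    have hx : x ∈ Submodule.span R (Set.range e) := he ▸ Submodule.mem_top
    induction hx using Submodule.span_induction with
    | mem x hx =>
      obtain ⟨j, rfl⟩ := hx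
      rw [← Finset.prod_erase_mul _ _ (Finset.mem_univ j), mul_smul]
      exact Submodule.smul_mem _ _ (hae j)
    | zero => simp
    | add x y _ _ hx hy => rw [smul_add]; exact add_mem hx hy
    | smul t x _ hx => rw [smul_comm]; exact Submodule.smul_mem _ _ hx
  have hspan : Set.range (fun i : s ↦ e i) = e '' s := by
    rw [Set.image_eq_range]
  let bas : Module.Basis s R (Submodule.span R (Set.range fun i : s ↦ e i)) := Module.Basis.span hs
  let mulc : B →ₗ[R] Submodule.span R (Set.range fun i : s ↦ e i) :=
    (LinearMap.lsmul R B (∏ j, a j)).codRestrict _ fun x ↦ by rw [hspan]; exact hc x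
  have : Fintype s := Fintype.ofFinite s
  let σ := (Fintype.equivFin s).symm
  refine ⟨Fintype.card s, fun i ↦ e (σ i), fun i ↦ (bas.coord (σ i)).comp mulc, ∏ j, a j,
    Finset.prod_ne_zero_iff.mpr fun j _ ↦ ha j, fun x ↦ ?_⟩
  have h1 := congr_arg Subtype.val (bas.sum_repr (mulc x))
  rw [Submodule.coe_sum] at h1
  rw [Equiv.sum_comp σ fun i ↦ ((bas.coord i).comp mulc) x • e i]
  refine Eq.trans h1.symm (Finset.sum_congr rfl fun i _ ↦ ?_)
  have h2 : (bas i : B) = e i := congr_arg Subtype.val (Module.Basis.span_apply hs i)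
  rw [Submodule.coe_smul, h2]
  rfl

theorem exists_baseChange_functionals {S T B : Type*} [CommRing S] [CommRing T] [Algebra S T]
    [CommRing B] [Algebra S B] {n : ℕ} (b : Fin n → B) (β : Fin n → B →ₗ[S] S) (c : S)
    (h : ∀ a, c • a = ∑ i, β i a • b i) :
    ∃ β' : Fin n → TensorProduct S T B →ₗ[T] T,
      (∀ a, algebraMap S T c • a = ∑ i, β' i a • (1 ⊗ₜ[S] b i : TensorProduct S T B)) ∧
      ∀ i, β' i 1 = algebraMap S T (β i 1) := by
  let β' (i : Fin n) : TensorProduct S T B →ₗ[T] T :=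
    (TensorProduct.AlgebraTensorModule.rid S T T).toLinearMap ∘ₗ (β i).baseChange T
  have hβ' (i t a) : β' i (t ⊗ₜ a) = β i a • t := by simp [β']
  refine ⟨β', fun a ↦ ?_, fun i ↦ ?_⟩
  · induction a using TensorProduct.induction_on with
    | zero => simp
    | add x y hx hy => simp only [smul_add, hx, hy, map_add, add_smul, Finset.sum_add_distrib]
    | tmul t a =>
      simp only [hβ']
      rw [algebraMap_smul, ← TensorProduct.tmul_smul, h, TensorProduct.tmul_sum]
      refine Finset.sum_congr rfl fun i _ ↦ ?_
      rw [TensorProduct.tmul_smul, smul_assoc, TensorProduct.smul_tmul' t, smul_eq_mul, mul_one]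
  · rw [Algebra.TensorProduct.one_def, hβ', Algebra.smul_def, mul_one]

theorem map_mem_of_mem_map {T B : Type*} [CommRing T] [CommRing B] [Algebra T B] {I : Ideal T}
    (β : B →ₗ[T] T) {a : B} (ha : a ∈ I.map (algebraMap T B)) : β a ∈ I := by
  have h : a ∈ (I • ⊤ : Submodule T B) := by rw [Ideal.smul_top_eq_map]; exact ha
  induction h using Submodule.smul_induction_on' with
  | smul t ht x _ => rw [map_smul]; exact Ideal.mul_mem_right _ _ ht
  | add x hx y hy h h' =>
    rw [Ideal.smul_top_eq_map] at hx hy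
    rw [map_add]; exact add_mem (h hx) (h' hy)

theorem almost_regular_of_functionals {T B : Type*} [CommRing T] [CommRing B] [Algebra T B]
    {n : ℕ} (b : Fin n → B) (β : Fin n → B →ₗ[T] T) (c : T) (h : ∀ a, c • a = ∑ i, β i a • b i)
    (t : T) (s : Set T) (ht : ∀ a, t * a ∈ Ideal.span s → a ∈ Ideal.span s) (a : B)
    (ha : algebraMap T B t * a ∈ Ideal.span (algebraMap T B '' s)) :
    algebraMap T B c * a ∈ Ideal.span (algebraMap T B '' s) := by
  rw [← Ideal.map_span] at ha ⊢
  rw [← Algebra.smul_def, h]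
  refine sum_mem fun i _ ↦ ?_
  rw [Algebra.smul_def]
  refine Ideal.mul_mem_right _ _ (Ideal.mem_map_of_mem _ (ht _ ?_))
  rw [← smul_eq_mul, ← map_smul, Algebra.smul_def]
  exact map_mem_of_mem_map _ ha

theorem exists_charP_model_of_finite {R B : Type} [CommRing R] [IsDomain R] [CommRing B]
    [IsDomain B] [Algebra R B] [Module.Finite R B] (hinj : Function.Injective (algebraMap R B))
    {d : ℕ} {X : Fin d → R} (hX : HasCharPModels d X) {W : Set B} (hW : W.Finite) :
    ∃ B₀ : Subring B, W ⊆ B₀ ∧ ∃ x : Fin d → B₀, (∀ i, (x i : B) = algebraMap R B (X i)) ∧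
      ∃ (p : ℕ) (_ : p.Prime) (B' : Type) (_ : CommRing B') (_ : CharP B' p) (f : B₀ →+* B')
        (y : ℕ → B') (c : B'),
        Ideal.span (Set.range fun i ↦ f (x i)) = Ideal.span (y '' Set.Iio d) ∧
        (∀ E, ∃ t, c ^ E ∉ Ideal.span (y '' Set.Iio d) ^ t) ∧
        ∀ M, ∀ j < d, ∀ a, y j ^ M * a ∈ Ideal.span ((fun i ↦ y i ^ M) '' Set.Iio j) →
          c * a ∈ Ideal.span ((fun i ↦ y i ^ M) '' Set.Iio j) := by
  obtain ⟨n, b, β, c, hc0, hc⟩ := exists_smul_eq_sum_smul R B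
  obtain ⟨m, e, he⟩ := Module.Finite.exists_fin (R := R) (M := B)
  have hκ (w : B) : ∃ κ : Fin m → R, ∑ k, κ k • e k = w :=
    (Submodule.mem_span_range_iff_exists_fun R).mp (he ▸ Submodule.mem_top)
  choose κ hκ using hκ
  obtain ⟨i₀, hi₀⟩ : ∃ i, β i 1 ≠ 0 := by
    by_contra! h
    have h1 := hc 1
    simp only [h, zero_smul, Finset.sum_const_zero] at h1
    rw [Algebra.smul_def, mul_one] at h1
    exact hc0 ((injective_iff_map_eq_zero _).mp hinj c h1)
  let V : Set B := W ∪ {1} ∪ (Set.range fun ij : Fin m × Fin m ↦ e ij.1 * e ij.2) ∪ Set.range b ∪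
    Set.range e ∪ Set.range fun i ↦ algebraMap R B (X i)
  have hV : V.Finite := by
    refine ((((hW.union ?_).union ?_).union ?_).union ?_).union ?_
    · exact Set.finite_singleton _
    all_goals exact Set.finite_range _
  obtain ⟨S, hZS, ξ, s', hξ, hs', p, hp, T, _, _, _, h, ζ, hs0, hspan, hinf, hreg⟩ :=
    hX ((⋃ k, (fun w ↦ κ w k) '' V) ∪ (Set.range fun ij : Fin n × Fin m ↦ β ij.1 (e ij.2)) ∪
      {c, β i₀ 1}) (by
        refine ((Set.finite_iUnion fun k ↦ hV.image _).union (Set.finite_range _)).union ?_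
        simp) (c * β i₀ 1) (mul_ne_zero hc0 hi₀)
  have hcS : c ∈ S := hZS (by simp)
  have hβS : β i₀ 1 ∈ S := hZS (by simp)
  let P : Submodule S B := Submodule.span S (Set.range e)
  have hVP (w) (hw : w ∈ V) : w ∈ P := by
    rw [← hκ w]
    refine sum_mem fun k _ ↦ ?_
    have hk : κ w k ∈ S := hZS (Or.inl (Or.inl (Set.mem_iUnion.mpr ⟨k, w, hw, rfl⟩)))
    exact P.smul_mem (⟨_, hk⟩ : S) (Submodule.subset_span ⟨k, rfl⟩)
  have hmul (u v : B) (hu : u ∈ P) (hv : v ∈ P) : u * v ∈ P := by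
    have h1 : u * v ∈ P * P := Submodule.mul_mem_mul hu hv
    rw [Submodule.span_mul_span] at h1
    refine Submodule.span_le.mpr ?_ h1
    rintro _ ⟨_, ⟨i, rfl⟩, _, ⟨j, rfl⟩, rfl⟩
    exact hVP _ (Or.inl (Or.inl (Or.inl (Or.inr ⟨(i, j), rfl⟩))))
  let B₀ : Subalgebra S B := P.toSubalgebra (hVP 1 (by simp [V])) hmul
  have hβP (i) (a : B) (ha : a ∈ P) : β i a ∈ S := by
    induction ha using Submodule.span_induction with
    | mem x hx =>
      obtain ⟨j, rfl⟩ := hx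
      exact hZS (Or.inl (Or.inr ⟨(i, j), rfl⟩))
    | zero => rw [map_zero]; exact S.zero_mem
    | add x y _ _ hx hy => rw [map_add]; exact S.add_mem hx hy
    | smul t x _ hx =>
      have : β i (t • x) = t * β i x := map_smul (β i) (t : R) x
      rw [this]; exact S.mul_mem t.2 hx
  let β₀ (i : Fin n) : B₀ →ₗ[S] S :=
    { toFun a := ⟨β i a, hβP i a a.2⟩
      map_add' a a' := Subtype.ext (map_add (β i) _ _)
      map_smul' t a := Subtype.ext (map_smul (β i) (t : R) (a : B)) }
  let b₀ (i : Fin n) : B₀ := ⟨b i, hVP _ (by simp [V])⟩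
  let _ : Algebra S T := h.toAlgebra
  obtain ⟨β', hβ', hβ'1⟩ := exists_baseChange_functionals (T := T) b₀ β₀ ⟨c, hcS⟩ fun a ↦ by
    refine Subtype.ext ?_
    rw [AddSubmonoidClass.coe_finsetSum]
    exact hc a
  have hc' : h ⟨c, hcS⟩ ≠ 0 ∧ h ⟨β i₀ 1, hβS⟩ ≠ 0 := by
    rw [← mul_ne_zero_iff, ← map_mul]
    convert hs0
    exact Subtype.ext hs'.symm
  have hmap : Ideal.span ((fun i ↦ algebraMap T (TensorProduct S T B₀) (ζ i)) '' Set.Iio d) =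
      (Ideal.span (ζ '' Set.Iio d)).map (algebraMap T (TensorProduct S T B₀)) := by
    rw [Ideal.map_span, ← Set.image_comp]
    rfl
  have hE (E : ℕ) : ∃ t, algebraMap T (TensorProduct S T B₀) (h ⟨c, hcS⟩) ^ E ∉
      Ideal.span ((fun i ↦ algebraMap T (TensorProduct S T B₀) (ζ i)) '' Set.Iio d) ^ t := by
    by_contra! hE
    have h1 : h ⟨c, hcS⟩ ^ E * h ⟨β i₀ 1, hβS⟩ ∈ ⨅ t : ℕ, Ideal.span (ζ '' Set.Iio d) ^ t := by
      refine Ideal.mem_iInf.mpr fun t ↦ ?_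
      have h2 := hE t
      rw [hmap, ← Ideal.map_pow, ← map_pow] at h2
      have h3 := map_mem_of_mem_map (β' i₀) h2
      rwa [Algebra.algebraMap_eq_smul_one, map_smul, hβ'1, smul_eq_mul] at h3
    rw [hinf] at h1
    exact mul_ne_zero (pow_ne_zero E hc'.1) hc'.2 h1
  have : Nontrivial (TensorProduct S T B₀) := by
    obtain ⟨t, ht⟩ := hE 0
    exact ⟨algebraMap T _ (h ⟨c, hcS⟩) ^ 0, 0, fun h0 ↦ ht (by rw [h0]; exact zero_mem _)⟩
  have hchar : CharP (TensorProduct S T B₀) p := by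
    rw [CharP.charP_iff_prime_eq_zero hp, ← map_natCast (algebraMap T (TensorProduct S T B₀)),
      CharP.cast_eq_zero, map_zero]
  refine ⟨B₀.toSubring, fun w hw ↦ hVP w (by simp [V, hw]),
    fun i ↦ ⟨algebraMap R B (X i), hVP _ (by simp [V])⟩, fun i ↦ rfl, p, hp, TensorProduct S T B₀,
    inferInstance, hchar,
    (Algebra.TensorProduct.includeRight : B₀ →ₐ[S] TensorProduct S T B₀).toRingHom,
    fun i ↦ algebraMap T _ (ζ i), algebraMap T _ (h ⟨c, hcS⟩), ?_, hE, fun M j hj a ha ↦ ?_⟩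
  · rw [hmap, ← hspan, Ideal.map_span, ← Set.range_comp]
    refine congr_arg _ (congr_arg _ (funext fun i ↦ ?_))
    have h1 : (⟨algebraMap R B (X i), hVP _ (by simp [V])⟩ : B₀) = algebraMap S B₀ (ξ i) := by
      refine Subtype.ext ?_
      exact congr_arg (algebraMap R B) (hξ i).symm
    refine Eq.trans (congr_arg _ h1) ?_
    exact (Algebra.TensorProduct.includeRight : B₀ →ₐ[S] TensorProduct S T B₀).commutes (ξ i)
  · have himg : (fun i ↦ algebraMap T (TensorProduct S T B₀) (ζ i) ^ M) '' Set.Iio j =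
        algebraMap T (TensorProduct S T B₀) '' ((fun i ↦ ζ i ^ M) '' Set.Iio j) := by
      rw [← Set.image_comp]
      simp [Function.comp_def]
    dsimp only at ha ⊢
    rw [himg] at ha ⊢
    rw [← map_pow] at ha
    exact almost_regular_of_functionals _ β' _ hβ' _ _ (hreg M j hj) a ha

end CharPModelOfFinite

section KoszulDatum

/-- The finitely many ring elements, and the polynomial identities among them, that witness the
following: matrices `φ` form a complex, `x j ^ N` acts on it null-homotopically, `z l` kills the
class of `u` in degree zero, and the map from the Koszul complex of `z` so obtained is nonzero
modulo `z` in degrees zero and one. -/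
structure KoszulDatum (B : Type*) [CommRing B] (d n N s : ℕ) (r : ℕ → ℕ) where
  φ : ∀ i, Fin (r i) → Fin (r (i + 1)) → B
  z : Fin n → B
  u : Fin (r 0) → B
  g : Fin n → Fin (r 1) → B
  χ : Fin n → Fin (r 1) → B
  ε : Fin (r 0) → B
  x : Fin d → B
  h : Fin d → ∀ i, Fin (r (i + 1)) → Fin (r i) → B
  ω : Fin n → Fin n → Fin n → B
  ω' : Fin n → Fin (r 2) → Fin n → B
  ω'' : Fin (r 1) → Fin n → B
  b : Fin n → Fin d → B
  φ_comp : ∀ i a c, ∑ k, φ i a k * φ (i + 1) k c = 0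
  φ_g : ∀ l a, ∑ k, φ 0 a k * g l k = z l * u a
  χ_g : ∀ l j, ∑ k, χ l k * g j k = (if l = j then 1 else 0) + ∑ i, z i * ω l j i
  χ_φ : ∀ l c, ∑ k, χ l k * φ 1 k c = ∑ i, z i * ω' l c i
  ε_u : ∑ k, ε k * u k = 1
  ε_φ : ∀ c, ∑ k, ε k * φ 0 k c = ∑ i, z i * ω'' c i
  homotopy : ∀ j i a c, ∑ k, φ (i + 1) a k * h j (i + 1) k c + ∑ k, h j i a k * φ i k c =
    if a = c then x j ^ N else 0
  z_pow : ∀ l, z l ^ s = ∑ i, x i * b l i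

namespace KoszulDatum

variable {B C : Type*} [CommRing B] [CommRing C] {d n N s : ℕ} {r : ℕ → ℕ}

/-- The image of a datum under a ring homomorphism. -/
def map (D : KoszulDatum B d n N s r) (f : B →+* C) : KoszulDatum C d n N s r where
  φ i a k := f (D.φ i a k)
  z l := f (D.z l)
  u a := f (D.u a)
  g l k := f (D.g l k)
  χ l k := f (D.χ l k)
  ε a := f (D.ε a)
  x j := f (D.x j)
  h j i a k := f (D.h j i a k)
  ω l j i := f (D.ω l j i)
  ω' l c i := f (D.ω' l c i)
  ω'' c i := f (D.ω'' c i)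
  b l i := f (D.b l i)
  φ_comp i a c := by simpa using congr_arg f (D.φ_comp i a c)
  φ_g l a := by simpa using congr_arg f (D.φ_g l a)
  χ_g l j := by simpa [apply_ite f] using congr_arg f (D.χ_g l j)
  χ_φ l c := by simpa using congr_arg f (D.χ_φ l c)
  ε_u := by simpa using congr_arg f D.ε_u
  ε_φ c := by simpa using congr_arg f (D.ε_φ c)
  homotopy j i a c := by simpa [apply_ite f] using congr_arg f (D.homotopy j i a c)
  z_pow l := by simpa using congr_arg f (D.z_pow l)

/-- The set of all ring elements occurring in a datum. -/
def entries (D : KoszulDatum B d n N s r) : Set B :=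
  ((((((((((((Set.range fun t : Σ i, Fin (r i) × Fin (r (i + 1)) ↦ D.φ t.1 t.2.1 t.2.2) ∪
    Set.range D.z) ∪ Set.range D.u) ∪ Set.range fun t : Fin n × Fin (r 1) ↦ D.g t.1 t.2) ∪
    Set.range fun t : Fin n × Fin (r 1) ↦ D.χ t.1 t.2) ∪ Set.range D.ε) ∪ Set.range D.x) ∪
    Set.range fun t : Fin d × Σ i, Fin (r (i + 1)) × Fin (r i) ↦ D.h t.1 t.2.1 t.2.2.1 t.2.2.2) ∪
    Set.range fun t : Fin n × Fin n × Fin n ↦ D.ω t.1 t.2.1 t.2.2) ∪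
    Set.range fun t : Fin n × Fin (r 2) × Fin n ↦ D.ω' t.1 t.2.1 t.2.2) ∪
    Set.range fun t : Fin (r 1) × Fin n ↦ D.ω'' t.1 t.2) ∪
    Set.range fun t : Fin n × Fin d ↦ D.b t.1 t.2)

theorem finite_sigma_of_eventually_zero {a b : ℕ → ℕ} (hb : ∀ i, d ≤ i → a i * b i = 0) :
    Finite (Σ i, Fin (a i) × Fin (b i)) := by
  have hlt (t : Σ i, Fin (a i) × Fin (b i)) : t.1 < d := by
    by_contra! h
    rcases Nat.mul_eq_zero.mp (hb _ h) with h | h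
    · exact (Fin.cast h t.2.1).elim0
    · exact (Fin.cast h t.2.2).elim0
  refine Finite.of_surjective
    (fun t : Σ i : Fin d, Fin (a i) × Fin (b i) ↦ (⟨t.1, t.2⟩ : Σ i, Fin (a i) × Fin (b i))) ?_
  exact fun t ↦ ⟨⟨⟨t.1, hlt t⟩, t.2⟩, rfl⟩

theorem finite_entries (D : KoszulDatum B d n N s r) (hr : ∀ i, d < i → r i = 0) :
    D.entries.Finite := by
  have : Finite (Σ i, Fin (r i) × Fin (r (i + 1))) :=
    finite_sigma_of_eventually_zero (d := d) fun i hi ↦ by rw [hr (i + 1) (by omega), mul_zero]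
  have : Finite (Σ i, Fin (r (i + 1)) × Fin (r i)) :=
    finite_sigma_of_eventually_zero (d := d) fun i hi ↦ by rw [hr (i + 1) (by omega), zero_mul]
  unfold entries
  refine (((((((((((Set.Finite.union ?_ ?_).union ?_).union ?_).union ?_).union ?_).union
    ?_).union ?_).union ?_).union ?_).union ?_).union ?_) <;> exact Set.finite_range _

/-- A datum whose elements all lie in a subring is a datum over that subring. -/
def restrict (D : KoszulDatum B d n N s r) (S : Subring B) (hS : D.entries ⊆ S) :
    KoszulDatum S d n N s r where
  φ i a k := ⟨D.φ i a k, hS (by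
    iterate 11 apply Set.mem_union_left
    exact ⟨⟨i, a, k⟩, rfl⟩)⟩
  z l := ⟨D.z l, hS (by simp [entries])⟩
  u a := ⟨D.u a, hS (by simp [entries])⟩
  g l k := ⟨D.g l k, hS (by
    iterate 8 apply Set.mem_union_left
    exact Or.inr ⟨⟨l, k⟩, rfl⟩)⟩
  χ l k := ⟨D.χ l k, hS (by
    iterate 7 apply Set.mem_union_left
    exact Or.inr ⟨⟨l, k⟩, rfl⟩)⟩
  ε a := ⟨D.ε a, hS (by simp [entries])⟩
  x j := ⟨D.x j, hS (by simp [entries])⟩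
  h j i a k := ⟨D.h j i a k, hS (by
    iterate 4 apply Set.mem_union_left
    exact Or.inr ⟨⟨j, i, a, k⟩, rfl⟩)⟩
  ω l j i := ⟨D.ω l j i, hS (by
    iterate 3 apply Set.mem_union_left
    exact Or.inr ⟨⟨l, j, i⟩, rfl⟩)⟩
  ω' l c i := ⟨D.ω' l c i, hS (by
    iterate 2 apply Set.mem_union_left
    exact Or.inr ⟨⟨l, c, i⟩, rfl⟩)⟩
  ω'' c i := ⟨D.ω'' c i, hS (by
    iterate 1 apply Set.mem_union_left
    exact Or.inr ⟨⟨c, i⟩, rfl⟩)⟩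
  b l i := ⟨D.b l i, hS (Or.inr ⟨⟨l, i⟩, rfl⟩)⟩
  φ_comp i a c := Subtype.ext (by simpa using D.φ_comp i a c)
  φ_g l a := Subtype.ext (by simpa using D.φ_g l a)
  χ_g l j := Subtype.ext (by simpa [apply_ite Subtype.val] using D.χ_g l j)
  χ_φ l c := Subtype.ext (by simpa using D.χ_φ l c)
  ε_u := Subtype.ext (by simpa using D.ε_u)
  ε_φ c := Subtype.ext (by simpa using D.ε_φ c)
  homotopy j i a c := Subtype.ext (by simpa [apply_ite Subtype.val] using D.homotopy j i a c)
  z_pow l := Subtype.ext (by simpa using D.z_pow l)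

end KoszulDatum

end KoszulDatum

section CharPBound

theorem Ideal.pow_mem_span_range_pow {B : Type*} [CommRing B] {d : ℕ} {x : Fin d → B} {y : B}
    (hy : y ∈ Ideal.span (Set.range x)) (N : ℕ) :
    y ^ (d * N + 1) ∈ Ideal.span (Set.range fun i ↦ x i ^ N) := by
  obtain ⟨a, rfl⟩ := (Submodule.mem_span_range_iff_exists_fun B).mp hy
  have h := Ideal.sum_pow_mem_span_pow Finset.univ (fun i ↦ a i • x i) N
  rw [Finset.card_univ, Fintype.card_fin] at h
  refine Ideal.span_le.mpr ?_ h
  rintro _ ⟨i, -, rfl⟩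
  beta_reduce
  rw [smul_eq_mul, mul_pow]
  exact Ideal.mul_mem_left _ _ ((pow_succ (x i) N).symm ▸
    Ideal.mul_mem_right _ _ (Ideal.subset_span ⟨i, rfl⟩))

namespace KoszulDatum

variable {B : Type*} [CommRing B] {d n N s : ℕ} {r : ℕ → ℕ}

theorem exists_homotopy_of_mem (D : KoszulDatum B d n N s r) {y : B}
    (hy : y ∈ Ideal.span (Set.range fun j ↦ D.x j ^ N)) :
    ∃ h : ∀ i, (Fin (r i) → B) →ₗ[B] (Fin (r (i + 1)) → B), ∀ i v,
      (Matrix.of (D.φ (i + 1))).mulVecLin (h (i + 1) v) +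
        h i ((Matrix.of (D.φ i)).mulVecLin v) = y • v := by
  obtain ⟨a, rfl⟩ := (Submodule.mem_span_range_iff_exists_fun B).mp hy
  refine ⟨fun i ↦ ∑ j, a j • (Matrix.of (D.h j i)).mulVecLin, fun i v ↦ ?_⟩
  have h1 (j : Fin d) : Matrix.of (D.φ (i + 1)) * Matrix.of (D.h j (i + 1)) +
      Matrix.of (D.h j i) * Matrix.of (D.φ i) = (D.x j ^ N) • 1 := by
    ext k l
    simpa [Matrix.mul_apply, Matrix.one_apply] using D.homotopy j i k l
  simp only [LinearMap.sum_apply, LinearMap.smul_apply, map_sum, map_smul, Finset.sum_smul,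
    ← Finset.sum_add_distrib, ← smul_add, Matrix.mulVecLin_apply, Matrix.mulVec_mulVec,
    ← Matrix.add_mulVec, h1, Matrix.smul_mulVec, Matrix.one_mulVec, smul_assoc]

theorem pow_mem_span_z (D : KoszulDatum B d n N s r) (hr : ∀ i, d < i → r i = 0) (hdn : d < n)
    (y : ℕ → B) (c : B) (hy : ∀ j < d, y j ∈ Ideal.span (Set.range fun j ↦ D.x j ^ N))
    (hreg : ∀ j < d, ∀ a : B, y j * a ∈ Ideal.span (y '' Set.Iio j) →
      c * a ∈ Ideal.span (y '' Set.Iio j)) :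
    c ^ (2 * d * (d + 1)) ∈ Ideal.span (Set.range D.z) := by
  have hz (a : Fin n → B) : ∑ i, D.z i * a i ∈ Ideal.span (Set.range D.z) :=
    sum_mem fun i _ ↦ Ideal.mul_mem_right _ _ (Ideal.subset_span ⟨i, rfl⟩)
  have hφ (i : ℕ) : Matrix.of (D.φ i) * Matrix.of (D.φ (i + 1)) = 0 := by
    ext k l
    simpa [Matrix.mul_apply] using D.φ_comp i k l
  have hdual {k m : ℕ} (w : Fin k → B) (F : Fin k → Fin m → B) (v : Fin m → B)
      (hF : ∀ l, ∑ k, w k * F k l ∈ Ideal.span (Set.range D.z)) :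
      w ⬝ᵥ Matrix.mulVec (Matrix.of F) v ∈ Ideal.span (Set.range D.z) := by
    rw [Matrix.dotProduct_mulVec]
    exact sum_mem fun l _ ↦ Ideal.mul_mem_right _ _ (hF l)
  refine pow_mem_span_of_almost_regular D.z hdn r (fun i ↦ (Matrix.of (D.φ i)).mulVecLin)
    (fun i v ↦ ?_) hr D.u D.g (fun l ↦ ?_) (fun l ↦ dotProductBilin B B (D.χ l)) (fun l j ↦ ?_)
    (fun l v ↦ ?_) (dotProductBilin B B D.ε) D.ε_u (fun v ↦ ?_) y c
    (fun j hj ↦ D.exists_homotopy_of_mem (hy j hj)) hreg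
  · simp [Matrix.mulVec_mulVec, hφ]
  · exact funext fun a ↦ D.φ_g l a
  · have h1 : dotProductBilin B B (D.χ l) (D.g j) = _ := D.χ_g l j
    rw [h1, add_sub_cancel_left]
    exact hz _
  · exact hdual _ _ _ fun k ↦ D.χ_φ l k ▸ hz _
  · exact hdual _ _ _ fun k ↦ D.ε_φ k ▸ hz _

theorem pow_mem_pow_of_charP (D : KoszulDatum B d n N s r) (hr : ∀ i, d < i → r i = 0)
    (hdn : d < n) {p : ℕ} (hp : p.Prime) [CharP B p] (y : ℕ → B) (c : B)
    (hspan : Ideal.span (Set.range D.x) = Ideal.span (y '' Set.Iio d))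
    (hreg : ∀ M, ∀ j < d, ∀ a, y j ^ M * a ∈ Ideal.span ((fun i ↦ y i ^ M) '' Set.Iio j) →
      c * a ∈ Ideal.span ((fun i ↦ y i ^ M) '' Set.Iio j)) (t : ℕ) :
    c ^ (2 * d * (d + 1)) ∈ Ideal.span (y '' Set.Iio d) ^ t := by
  have : Fact p.Prime := ⟨hp⟩
  let F := iterateFrobenius B p (s * t)
  have hF (a : B) : F a = a ^ p ^ (s * t) := rfl
  have h1 := (D.map F).pow_mem_span_z hr hdn (fun j ↦ y j ^ ((d * N + 1) * p ^ (s * t))) c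
    (fun j hj ↦ by
      have h2 : y j ∈ Ideal.span (Set.range D.x) := hspan ▸ Ideal.subset_span ⟨j, hj, rfl⟩
      have h3 := Ideal.mem_map_of_mem F (Ideal.pow_mem_span_range_pow h2 N)
      rw [hF, ← pow_mul, Ideal.map_span, ← Set.range_comp] at h3
      convert h3 using 4 with i
      exact (map_pow F _ _).symm) (hreg _)
  refine Ideal.span_le.mpr ?_ h1
  rintro _ ⟨l, rfl⟩
  have hle : s * t ≤ p ^ (s * t) := (Nat.lt_pow_self hp.one_lt).le
  change D.z l ^ p ^ (s * t) ∈ Ideal.span (y '' Set.Iio d) ^ t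
  refine Ideal.mem_of_dvd _ (pow_dvd_pow _ hle) ?_
  rw [pow_mul, ← hspan]
  refine Ideal.pow_mem_pow ?_ t
  rw [D.z_pow]
  exact sum_mem fun i _ ↦ Ideal.mul_mem_right _ _ (Ideal.subset_span ⟨i, rfl⟩)

/-- If a datum maps to a domain finite over `K⟦X₁, …, X_d⟧` in such a way that `x` is sent to the
variables, then it involves at most `d` elements `z`. -/
theorem le_of_finite_over_mvPowerSeries {A : Type} [CommRing A]
    {K : Type} [Field K] [CharZero K] {C : Type} [CommRing C] [IsDomain C]
    [Algebra (MvPowerSeries (Fin d) K) C] [Module.Finite (MvPowerSeries (Fin d) K) C]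
    (hinj : Function.Injective (algebraMap (MvPowerSeries (Fin d) K) C)) (ψ : A →+* C)
    (D : KoszulDatum A d n N s r) (hr : ∀ i, d < i → r i = 0)
    (hψ : ∀ i, ψ (D.x i) = algebraMap (MvPowerSeries (Fin d) K) C (MvPowerSeries.X i)) :
    n ≤ d := by
  by_contra! hdn
  have : IsDomain (MvPowerSeries (Fin d) K) := NoZeroDivisors.to_isDomain _
  obtain ⟨B₀, hB₀, x, hx, p, hp, B', _, _, f, y, c, hspan, hE, hreg⟩ :=
    exists_charP_model_of_finite hinj (hasCharPModels_mvPowerSeries K d)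
      ((D.map ψ).finite_entries hr)
  obtain ⟨t, ht⟩ := hE (2 * d * (d + 1))
  refine ht ((((D.map ψ).restrict B₀ hB₀).map f).pow_mem_pow_of_charP hr hdn hp y c ?_ hreg t)
  rw [← hspan]
  congr 2
  funext i
  refine congr_arg f (Subtype.ext ?_)
  rw [hx, ← hψ]
  rfl

end KoszulDatum

end CharPBound

section Homotopy

/-- If a power of an ideal kills the homology of a bounded complex of projective modules, then some
fixed power of each element of the ideal acts null-homotopically. -/
theorem exists_homotopy_of_annihilates_homology {A : Type*} [CommRing A] {N : ℕ → Type*}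
    [∀ i, AddCommGroup (N i)] [∀ i, Module A (N i)] [∀ i, Module.Projective A (N i)] {d : ℕ}
    (φ : ∀ i, N (i + 1) →ₗ[A] N i) (hφ : ∀ i v, φ i (φ (i + 1) v) = 0)
    (hN : ∀ i, d < i → Subsingleton (N i)) {c : A}
    (h0 : ∀ v, ∃ w, φ 0 w = c • v)
    (hc : ∀ i v, φ i v = 0 → ∃ w, φ (i + 1) w = c • v) :
    ∃ h : ∀ i, N i →ₗ[A] N (i + 1), ∀ i v,
      φ (i + 1) (h (i + 1) v) + h i (φ i v) = c ^ (d + 1) • v := by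
  have hlift {i : ℕ} (f : N i →ₗ[A] N i) (hf : ∀ v, ∃ w, φ i w = f v) :
      ∃ h : N i →ₗ[A] N (i + 1), ∀ v, φ i (h v) = f v := by
    obtain ⟨h, hh⟩ := Module.projective_lifting_property (φ i).rangeRestrict
      (f.codRestrict (LinearMap.range (φ i)) hf) (φ i).surjective_rangeRestrict
    exact ⟨h, fun v ↦ congr_arg Subtype.val (LinearMap.congr_fun hh v)⟩
  let Q (i : ℕ) := {h : N i →ₗ[A] N (i + 1) // ∀ v, φ i (h (φ i v)) = c ^ (i + 1) • φ i v}
  obtain ⟨k₀, hk₀⟩ := hlift (c • LinearMap.id) h0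
  have step (i : ℕ) (k : Q i) : ∃ k' : N (i + 1) →ₗ[A] N (i + 2),
      ∀ v, φ (i + 1) (k' v) = c • (c ^ (i + 1) • v - k.1 (φ i v)) := by
    refine hlift (c • (c ^ (i + 1) • LinearMap.id - k.1 ∘ₗ φ i)) fun v ↦ hc i _ ?_
    simp [k.2]
  choose! next hnext using step
  let seq (i : ℕ) : Q i := Nat.rec (motive := Q) ⟨k₀, fun v ↦ by simp [hk₀]⟩
    (fun i k ↦ ⟨next i k, fun v ↦ by rw [hnext, hφ, map_zero, sub_zero, smul_smul, ← pow_succ']⟩) i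
  have hseq (i : ℕ) (v : N (i + 1)) : φ (i + 1) ((seq (i + 1)).1 v) =
      c • (c ^ (i + 1) • v - (seq i).1 (φ i v)) := hnext i (seq i) v
  refine ⟨fun i ↦ c ^ (d - i) • (seq i).1, fun i v ↦ ?_⟩
  by_cases hi : d < i + 1
  · have := hN _ hi
    exact Subsingleton.elim _ _
  · obtain ⟨k, rfl⟩ := Nat.exists_eq_add_of_le (not_lt.mp hi)
    have h1 : i + 1 + k - i = k + 1 := by omega
    simp only [LinearMap.smul_apply, map_smul, hseq, h1, add_tsub_cancel_left]
    module

variable {A : Type*} [CommRing A] [IsLocalRing A]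

open IsLocalRing in
/-- Lift a linear form valued in the residue field. -/
theorem exists_lift_residueField {P : Type*} [AddCommGroup P] [Module A P] [Module.Projective A P]
    (f : P →ₗ[A] ResidueField A) : ∃ F : P →ₗ[A] A, ∀ v, residue A (F v) = f v := by
  obtain ⟨F, hF⟩ := Module.projective_lifting_property (Algebra.linearMap A (ResidueField A)) f
    residue_surjective
  exact ⟨F, fun v ↦ LinearMap.congr_fun hF v⟩

open IsLocalRing in
theorem exists_koszulDatum [IsNoetherianRing A] {d s e : ℕ} {r : ℕ → ℕ}
    (φ : ∀ i, (Fin (r (i + 1)) → A) →ₗ[A] (Fin (r i) → A))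
    (hφ : ∀ i v, φ i (φ (i + 1) v) = 0) (hr : ∀ i, d < i → r i = 0)
    (hann : ∀ i, ∀ a ∈ maximalIdeal A ^ e, ∀ v, φ i v = 0 → ∃ w, φ (i + 1) w = a • v)
    (π : (Fin (r 0) → A) →ₗ[A] ResidueField A) (hπ : Function.Surjective π)
    (hker : LinearMap.ker π = LinearMap.range (φ 0)) (x : Fin d → A)
    (hx : ∀ i, x i ∈ maximalIdeal A) (hs : maximalIdeal A ^ s ≤ Ideal.span (Set.range x)) :
    ∃ (n N : ℕ) (D : KoszulDatum A d n N s r), D.x = x ∧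
      Ideal.span (Set.range D.z) = maximalIdeal A := by
  obtain ⟨ε, hε⟩ := exists_lift_residueField π
  obtain ⟨u, hu⟩ : ∃ u, ε u = 1 := by
    obtain ⟨u, hu⟩ := hπ 1
    obtain ⟨w, hw⟩ : IsUnit (ε u) := by
      rw [← residue_ne_zero_iff_isUnit, hε, hu]
      exact one_ne_zero
    exact ⟨(w⁻¹ : Aˣ) • u, by simp [Units.smul_def, ← hw]⟩
  have hrange (v) (hv : ε v ∈ maximalIdeal A) : ∃ w, φ 0 w = v := by
    change v ∈ LinearMap.range (φ 0)
    rwa [← hker, LinearMap.mem_ker, ← hε, residue_eq_zero_iff]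
  have hεφ (v) : ε (φ 0 v) ∈ maximalIdeal A := by
    rw [← residue_eq_zero_iff, hε, ← LinearMap.mem_ker, hker]
    exact ⟨v, rfl⟩
  let bas := Module.finBasis (ResidueField A) (CotangentSpace A)
  choose z hz using fun l ↦ (maximalIdeal A).toCotangent_surjective (bas l)
  have hspan : Ideal.span (Set.range fun l ↦ (z l : A)) = maximalIdeal A := by
    have h1 := (CotangentSpace.span_image_eq_top_iff (s := Set.range z)).mp (by
      rw [← Set.range_comp, ← bas.span_eq]
      exact congr_arg _ (congr_arg _ (funext hz)))
    have h2 := congr_arg (Submodule.map (maximalIdeal A).subtype) h1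
    rwa [Submodule.map_span, ← Set.range_comp, Submodule.map_top, Submodule.range_subtype] at h2
  choose g hg using fun l ↦ hrange ((z l : A) • u) (by simp [hu])
  let θ : (Fin (r 1) → A) →ₗ[A] CotangentSpace A :=
    (maximalIdeal A).toCotangent ∘ₗ (ε ∘ₗ φ 0).codRestrict (maximalIdeal A) hεφ
  choose χ hχ using fun l ↦ exists_lift_residueField ((bas.coord l).restrictScalars A ∘ₗ θ)
  have hθ (v) : ∃ h, θ v = (maximalIdeal A).toCotangent ⟨ε (φ 0 v), h⟩ := ⟨hεφ v, rfl⟩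
  have hχg (l j) : χ l (g j) - (if l = j then 1 else 0) ∈ maximalIdeal A := by
    obtain ⟨h1, h2⟩ := hθ (g j)
    have h3 : θ (g j) = bas j := by
      rw [h2, ← hz]
      exact congr_arg _ (Subtype.ext (by simp [hg, hu]))
    rw [← residue_eq_zero_iff, map_sub, hχ]
    simp [h3, Finsupp.single_apply, apply_ite (residue A), eq_comm]
  have hχφ (l v) : χ l (φ 1 v) ∈ maximalIdeal A := by
    obtain ⟨h1, h2⟩ := hθ (φ 1 v)
    have h3 : θ (φ 1 v) = 0 := by
      rw [h2, ← map_zero (maximalIdeal A).toCotangent]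
      exact congr_arg _ (Subtype.ext (by simp [hφ]))
    rw [← residue_eq_zero_iff, hχ]
    simp [h3]
  have hmem {m : ℕ} {w : Fin m → A} {a : A} (ha : a ∈ Ideal.span (Set.range w)) :
      ∃ ω : Fin m → A, a = ∑ i, w i * ω i := by
    obtain ⟨ω, hω⟩ := (Submodule.mem_span_range_iff_exists_fun A).mp ha
    exact ⟨ω, hω.symm.trans (Finset.sum_congr rfl fun i _ ↦ mul_comm _ _)⟩
  have hsum {m : ℕ} (F : (Fin m → A) →ₗ[A] A) (v : Fin m → A) :
      ∑ k, F (Pi.single k 1) * v k = F v := by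
    conv_rhs => rw [← Finset.univ_sum_single v]
    rw [map_sum]
    refine Finset.sum_congr rfl fun k _ ↦ ?_
    rw [mul_comm, ← smul_eq_mul, ← map_smul, ← Pi.single_smul, smul_eq_mul, mul_one]
  have hsum' {m m' : ℕ} (F : (Fin m → A) →ₗ[A] (Fin m' → A)) (v : Fin m → A) (a : Fin m') :
      ∑ k, F (Pi.single k 1) a * v k = F v a := hsum (LinearMap.proj a ∘ₗ F) v
  have hN (i) (hi : d < i) : Subsingleton (Fin (r i) → A) := by
    have : IsEmpty (Fin (r i)) := by rw [hr i hi]; infer_instance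
    infer_instance
  have hhom (j : Fin d) := exists_homotopy_of_annihilates_homology (d := d) φ hφ hN
    (c := x j ^ (e + 1))
    (fun v ↦ hrange _ (by
      rw [map_smul, pow_succ]
      exact Ideal.mul_mem_right _ _ (Ideal.mul_mem_left _ _ (hx j))))
    (fun i ↦ hann i _ (Ideal.pow_le_pow_right (Nat.le_succ e) (Ideal.pow_mem_pow (hx j) _)))
  choose h hh using hhom
  choose ω hω using fun l j ↦ hmem (hspan.ge (hχg l j))
  choose ω' hω' using fun l (k : Fin (r 2)) ↦ hmem (hspan.ge (hχφ l (Pi.single k 1)))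
  choose ω'' hω'' using fun k : Fin (r 1) ↦ hmem (hspan.ge (hεφ (Pi.single k 1)))
  choose b hb using fun l ↦ hmem (hs (Ideal.pow_mem_pow (z l).2 s))
  exact ⟨_, (e + 1) * (d + 1), {
    φ i a k := φ i (Pi.single k 1) a
    z l := z l
    u := u
    g := g
    χ l k := χ l (Pi.single k 1)
    ε k := ε (Pi.single k 1)
    x := x
    h j i a k := h j i (Pi.single k 1) a
    ω := ω
    ω' := ω'
    ω'' := ω''
    b := b
    φ_comp i a c := by rw [hsum', hφ]; rfl
    φ_g l a := by rw [hsum', hg]; rfl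
    χ_g l j := by rw [hsum, ← hω]; ring
    χ_φ l c := by rw [hsum, ← hω']
    ε_u := by rw [hsum, hu]
    ε_φ c := by rw [hsum, ← hω'']
    homotopy j i a c := by
      rw [hsum', hsum', ← Pi.add_apply, hh, ← pow_mul]
      simp [Pi.single_apply]
    z_pow := hb }, rfl, hspan⟩

end Homotopy

section RegularLocal

open IsLocalRing

theorem ringKrullDim_quotient_span_of_generators {A : Type*} [CommRing A] [IsLocalRing A]
    [IsNoetherianRing A] {S T : Set A} (hS : S.Finite) {j k : ℕ} (hj : S.ncard ≤ j)
    (hST : Ideal.span S ⊔ Ideal.span T = maximalIdeal A)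
    (hdim : (j + k : ℕ) ≤ ringKrullDim A) :
    k ≤ ringKrullDim (A ⧸ Ideal.span S) ∧ ∃ _ : IsLocalRing (A ⧸ Ideal.span S),
      Ideal.span (Ideal.Quotient.mk (Ideal.span S) '' T) = maximalIdeal (A ⧸ Ideal.span S) := by
  have hle : Ideal.span S ≤ maximalIdeal A := hST ▸ le_sup_left
  have hne : Ideal.span S ≠ ⊤ := fun h ↦ (maximalIdeal.isMaximal A).ne_top (top_le_iff.mp (h ▸ hle))
  have : Nontrivial (A ⧸ Ideal.span S) := Ideal.Quotient.nontrivial_iff.mpr hne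
  have hloc : IsLocalRing (A ⧸ Ideal.span S) :=
    IsLocalRing.of_surjective' (Ideal.Quotient.mk _) Ideal.Quotient.mk_surjective
  refine ⟨?_, hloc, ?_⟩
  · have h1 := ringKrullDim_le_ringKrullDim_quotient_add_card hS.toFinset (by
      rw [IsLocalRing.ringJacobson_eq_maximalIdeal, hS.coe_toFinset]
      exact Ideal.subset_span.trans hle)
    rw [hS.coe_toFinset, ← Set.ncard_eq_toFinset_card S hS] at h1
    generalize ringKrullDim (A ⧸ Ideal.span S) = x at h1
    have h2 := hdim.trans h1
    induction x with
    | bot => simp at h2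
    | coe x =>
      induction x with
      | top => exact le_top
      | coe x =>
        norm_cast at h2 ⊢
        omega
  · have h1 : (maximalIdeal A).map (Ideal.Quotient.mk (Ideal.span S)) = _ :=
      map_maximalIdeal_of_surjective _ Ideal.Quotient.mk_surjective
    rw [← h1, ← hST, Ideal.map_sup, Ideal.map_quotient_self, bot_sup_eq, Ideal.map_span]

theorem exists_mem_maximalIdeal_notMem_minimalPrimes {A : Type*} [CommRing A] [IsLocalRing A]
    [IsNoetherianRing A] (hdim : 1 ≤ ringKrullDim A) :
    ∃ a ∈ maximalIdeal A, a ∉ maximalIdeal A ^ 2 ∧ ∀ q ∈ minimalPrimes A, a ∉ q := by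
  classical
  by_contra! h
  have hfin := minimalPrimes.finite_of_isNoetherianRing A
  have h1 := (Ideal.subset_union_prime (s := insert (maximalIdeal A ^ 2) hfin.toFinset)
    (f := id) (maximalIdeal A ^ 2) (maximalIdeal A ^ 2) (fun i hi h1 _ ↦ by
      have := (Finset.mem_insert.mp hi).resolve_left h1
      exact (hfin.mem_toFinset.mp this).1.1) (I := maximalIdeal A)).mp (fun a ha ↦ by
      by_cases h2 : a ∈ maximalIdeal A ^ 2
      · exact Set.mem_biUnion (by simp) h2
      · obtain ⟨q, hq, haq⟩ := h a ha h2
        exact Set.mem_biUnion (by simp [hq]) haq)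
  have hmin : maximalIdeal A ∈ minimalPrimes A := by
    obtain ⟨i, hi, hle⟩ := h1
    rcases Finset.mem_insert.mp hi with rfl | hi
    · have hbot : maximalIdeal A = ⊥ := Submodule.eq_bot_of_le_smul_of_le_jacobson_bot
        (maximalIdeal A) _ (IsNoetherian.noetherian _) (by simpa [pow_two] using hle)
        (maximalIdeal_le_jacobson _)
      refine ⟨⟨inferInstance, bot_le⟩, fun q hq _ ↦ ?_⟩
      rw [hbot]
      exact bot_le
    · have hi := hfin.mem_toFinset.mp hi
      have := hi.1.1
      rwa [le_antisymm hle (le_maximalIdeal this.ne_top)]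
  rw [← maximalIdeal_height_eq_ringKrullDim, Ideal.height_eq_zero_iff.mpr hmin] at hdim
  exact absurd hdim (by decide)

theorem isDomain_of_generators (k : ℕ) : ∀ {A : Type*} [CommRing A] [IsLocalRing A]
    [IsNoetherianRing A] (T : Finset A), T.card ≤ k → Ideal.span (T : Set A) = maximalIdeal A →
    k ≤ ringKrullDim A → IsDomain A := by
  classical
  induction k with
  | zero =>
    intro A _ _ _ T hT hspan _
    rw [Finset.card_eq_zero.mp (Nat.le_zero.mp hT), Finset.coe_empty, Ideal.span_empty] at hspan
    have := (isField_iff_maximalIdeal_eq.mpr hspan.symm)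
    exact this.isDomain
  | succ k ih =>
    intro A _ _ _ T hT hspan hdim
    obtain ⟨a, ham, ha2, hamin⟩ := exists_mem_maximalIdeal_notMem_minimalPrimes
      (A := A) (le_trans (by norm_cast; omega) hdim)
    obtain ⟨c, hc⟩ := Submodule.mem_span_finset'.mp (hspan ▸ ham)
    obtain ⟨t, ht⟩ : ∃ t, IsUnit (c t) := by
      by_contra! h
      refine ha2 (hc ▸ sum_mem fun t _ ↦ ?_)
      rw [pow_two]
      exact Ideal.mul_mem_mul ((mem_maximalIdeal _).mpr (h t))
        (hspan ▸ Ideal.subset_span t.2)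
    have hsup : Ideal.span {a} ⊔ Ideal.span ((T.erase t : Finset A) : Set A) = maximalIdeal A := by
      refine le_antisymm (sup_le ?_ ?_) ?_
      · rwa [Ideal.span_singleton_le_iff_mem]
      · rw [← hspan]
        exact Ideal.span_mono (by simp)
      · have hrest (v) (hv : v ∈ T) (hvt : v ≠ t) :
            v ∈ Ideal.span {a} ⊔ Ideal.span ((T.erase t : Finset A) : Set A) :=
          Ideal.mem_sup_right (Ideal.subset_span (by simp [hv, hvt]))
        rw [← hspan, Ideal.span_le]
        intro v hv
        by_cases hvt : v = t
        · subst hvt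
          refine (Ideal.unit_mul_mem_iff_mem _ ht).mp ?_
          have h1 : c t * (t : A) = a - ∑ v ∈ Finset.univ.erase t, c v • (v : A) := by
            rw [← hc, ← Finset.add_sum_erase _ _ (Finset.mem_univ t)]
            simp
          rw [h1]
          refine sub_mem (Ideal.mem_sup_left (Ideal.mem_span_singleton_self a))
            (sum_mem fun v hv ↦ Ideal.mul_mem_left _ _ (hrest v v.2 ?_))
          exact fun h ↦ Finset.ne_of_mem_erase hv (Subtype.ext h)
        · exact hrest v hv hvt
    obtain ⟨hd, _, hmax⟩ := ringKrullDim_quotient_span_of_generators (Set.finite_singleton a)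
      (Set.ncard_singleton a).le hsup (k := k) (by rwa [add_comm])
    have : IsDomain (A ⧸ Ideal.span {a}) :=
      ih ((T.erase t).image (Ideal.Quotient.mk (Ideal.span {a})))
        (Finset.card_image_le.trans (by rw [Finset.card_erase_of_mem t.2]; omega))
        (by rw [Finset.coe_image, hmax]) hd
    have hprime : (Ideal.span {a}).IsPrime := (Ideal.Quotient.isDomain_iff_prime _).mp this
    obtain ⟨q, hq, hqa⟩ := Ideal.exists_minimalPrimes_le (bot_le (a := Ideal.span {a}))
    have hqp := hq.1.1
    have hq0 : q = ⊥ := by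
      refine Submodule.eq_bot_of_le_smul_of_le_jacobson_bot (Ideal.span {a}) q
        (IsNoetherian.noetherian _) (fun b hb ↦ ?_) ?_
      · obtain ⟨v, rfl⟩ := Ideal.mem_span_singleton'.mp (hqa hb)
        rw [mul_comm]
        exact Submodule.smul_mem_smul (Ideal.mem_span_singleton_self a)
          ((hqp.mem_or_mem hb).resolve_right (hamin q hq))
      · exact ((Ideal.span_singleton_le_iff_mem _).mpr ham).trans (maximalIdeal_le_jacobson _)
    rw [hq0] at hqp
    exact IsDomain.of_bot_isPrime A

theorem ringKrullDim_le_ncard {A : Type*} [CommRing A] [IsLocalRing A] [IsNoetherianRing A]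
    {T : Set A} (hT : T.Finite) (hspan : Ideal.span T = maximalIdeal A) :
    ringKrullDim A ≤ T.ncard := by
  refine (ringKrullDim_le_spanFinrank_maximalIdeal A).trans ?_
  rw [← hspan]
  exact_mod_cast Submodule.spanFinrank_span_le_ncard_of_finite hT

theorem mem_span_of_mul_mem_span_of_regular {A : Type*} [CommRing A] [IsLocalRing A]
    [IsNoetherianRing A] {d : ℕ} (hdim : ringKrullDim A = d) (y : ℕ → A)
    (hy : Ideal.span (y '' Set.Iio d) = maximalIdeal A) {j : ℕ} (hj : j < d) {a : A}
    (ha : y j * a ∈ Ideal.span (y '' Set.Iio j)) : a ∈ Ideal.span (y '' Set.Iio j) := by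
  classical
  have hfin (i : ℕ) : (y '' Set.Iio i).Finite := (Set.finite_Iio i).image y
  have hcard (i : ℕ) : (y '' Set.Iio i).ncard ≤ i :=
    (Set.ncard_image_le (Set.finite_Iio i)).trans (by simp)
  have hsup (i : ℕ) (hi : i ≤ d) :
      Ideal.span (y '' Set.Iio i) ⊔ Ideal.span (y '' Set.Ico i d) = maximalIdeal A := by
    rw [← hy, ← Ideal.span_union, ← Set.image_union, Set.Iio_union_Ico_eq_Iio hi]
  have hcard' (i : ℕ) : (Ideal.Quotient.mk (Ideal.span (y '' Set.Iio i)) ''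
      (y '' Set.Ico i d)).ncard ≤ d - i :=
    (Set.ncard_image_le ((Set.finite_Ico i d).image y)).trans
      ((Set.ncard_image_le (Set.finite_Ico i d)).trans (by simp))
  obtain ⟨hd, _, hmax⟩ := ringKrullDim_quotient_span_of_generators (hfin j) (hcard j)
    (hsup j hj.le) (k := d - j) (by rw [hdim, Nat.add_sub_cancel' hj.le])
  have hTfin := ((Set.finite_Ico j d).image y).image
    (Ideal.Quotient.mk (Ideal.span (y '' Set.Iio j)))
  have hdom := isDomain_of_generators (d - j) hTfin.toFinset
    (by rw [← Set.ncard_eq_toFinset_card _ hTfin]; exact hcard' j)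
    (by rw [hTfin.coe_toFinset, hmax]) hd
  have hprime := (Ideal.Quotient.isDomain_iff_prime _).mp hdom
  refine (hprime.mem_or_mem ha).resolve_left fun hyj ↦ ?_
  obtain ⟨hd', _, hmax'⟩ := ringKrullDim_quotient_span_of_generators (hfin (j + 1)) (hcard (j + 1))
    (hsup (j + 1) hj) (k := d - (j + 1)) (by rw [hdim, Nat.add_sub_cancel' hj])
  have hle := ringKrullDim_le_ncard (((Set.finite_Ico (j + 1) d).image y).image
    (Ideal.Quotient.mk (Ideal.span (y '' Set.Iio (j + 1))))) hmax'
  have heq : Ideal.span (y '' Set.Iio (j + 1)) = Ideal.span (y '' Set.Iio j) := by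
    refine le_antisymm (Ideal.span_le.mpr ?_) (Ideal.span_mono (Set.image_mono ?_))
    · rintro _ ⟨i, hi, rfl⟩
      rcases Nat.lt_succ_iff_lt_or_eq.mp hi with h | rfl
      · exact Ideal.subset_span ⟨i, h, rfl⟩
      · exact hyj
    · exact Set.Iio_subset_Iio (Nat.le_succ j)
  have h1 := (hd.trans_eq (ringKrullDim_eq_of_ringEquiv (Ideal.quotEquivOfEq heq)).symm).trans
    hle
  have h2 := (Nat.cast_le (α := WithBot ℕ∞)).mp h1
  have h3 := hcard' (j + 1)
  omega

open RingTheory.Sequence in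
theorem IsLocalRing.isWeaklyRegular_append_map_pow {A : Type*} [CommRing A] [IsLocalRing A]
    [IsNoetherianRing A] (M : ℕ) (l₁ l₂ : List A) (h : IsWeaklyRegular A (l₁ ++ l₂))
    (hM : M ≠ 0) (hl : ∀ a ∈ l₁ ++ l₂, a ∈ maximalIdeal A) :
    IsWeaklyRegular A (l₁ ++ l₂.map (· ^ M)) := by
  induction l₂ generalizing l₁ with
  | nil => simpa using h
  | cons a l₂ ih =>
    have h1 : IsWeaklyRegular A ((l₁ ++ l₂) ++ [a]) :=
      isWeaklyRegular_of_perm_of_subset_maximalIdeal h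
        (by simpa using (List.perm_append_comm (l₁ := [a]) (l₂ := l₂)).append_left l₁) hl
    have h2 : IsWeaklyRegular A ((l₁ ++ l₂) ++ [a ^ M]) := by
      rw [isWeaklyRegular_append_iff, isWeaklyRegular_singleton_iff] at h1 ⊢
      exact ⟨h1.1, h1.2.pow M⟩
    have hmem : ∀ b ∈ (l₁ ++ l₂) ++ [a ^ M], b ∈ maximalIdeal A := by
      intro b hb
      simp only [List.mem_append, List.mem_singleton] at hb
      rcases hb with (hb | hb) | rfl
      · exact hl b (by simp [hb])
      · exact hl b (by simp [hb])
      · exact Ideal.pow_mem_of_mem _ (hl a (by simp)) M (Nat.pos_of_ne_zero hM)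
    have h3 : IsWeaklyRegular A ((l₁ ++ [a ^ M]) ++ l₂) :=
      isWeaklyRegular_of_perm_of_subset_maximalIdeal h2
        (by simpa using (List.perm_append_comm (l₁ := l₂) (l₂ := [a ^ M])).append_left l₁) hmem
    have h4 := ih (l₁ ++ [a ^ M]) h3 fun b hb ↦ hmem b (by
      simp only [List.mem_append, List.mem_singleton] at hb ⊢
      tauto)
    simpa using h4

theorem isWeaklyRegular_map_range_iff {A : Type*} [CommRing A] {d : ℕ} (y : ℕ → A) :
    RingTheory.Sequence.IsWeaklyRegular A ((List.range d).map y) ↔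
      ∀ j < d, ∀ a, y j * a ∈ Ideal.span (y '' Set.Iio j) → a ∈ Ideal.span (y '' Set.Iio j) := by
  rw [RingTheory.Sequence.isWeaklyRegular_iff]
  simp only [List.length_map, List.length_range, List.getElem_map, List.getElem_range,
    isSMulRegular_quotient_iff_mem_of_smul_mem, smul_eq_mul, Ideal.mul_top]
  refine forall₂_congr fun j hj ↦ ?_
  have h1 : Ideal.ofList (((List.range d).map y).take j) = Ideal.span (y '' Set.Iio j) := by
    refine congr_arg Ideal.span (Set.ext fun a ↦ ?_)
    simp [← List.map_take, List.take_range, hj.le]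
  rw [h1]

/-- In a regular local ring, positive powers of a minimal generating sequence of the maximal ideal
form a regular sequence. -/
theorem mem_span_of_pow_mul_mem_span_of_regular {A : Type*} [CommRing A] [IsLocalRing A]
    [IsNoetherianRing A] {d : ℕ} (hdim : ringKrullDim A = d) (y : ℕ → A)
    (hy : Ideal.span (y '' Set.Iio d) = maximalIdeal A) {M : ℕ} (hM : M ≠ 0) {j : ℕ} (hj : j < d)
    {a : A} (ha : y j ^ M * a ∈ Ideal.span ((fun i ↦ y i ^ M) '' Set.Iio j)) :
    a ∈ Ideal.span ((fun i ↦ y i ^ M) '' Set.Iio j) := by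
  have h1 := (isWeaklyRegular_map_range_iff (d := d) y).mpr
    fun j hj a ↦ mem_span_of_mul_mem_span_of_regular hdim y hy hj
  have h2 := IsLocalRing.isWeaklyRegular_append_map_pow M [] _ h1 hM fun b hb ↦ by
    obtain ⟨i, hi, rfl⟩ := List.mem_map.mp hb
    exact hy ▸ Ideal.subset_span ⟨i, List.mem_range.mp hi, rfl⟩
  rw [List.nil_append, List.map_map] at h2
  exact (isWeaklyRegular_map_range_iff fun i ↦ y i ^ M).mp h2 j hj a ha

end RegularLocal

section Rigidity

open IsLocalRing

theorem exists_generators_maximalIdeal_of_residueField_complex {A : Type} [CommRing A] [IsLocalRing A] [IsNoetherianRing A]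
    [Algebra ℚ A] {d : ℕ} (hdim : ringKrullDim A = d) {r : ℕ → ℕ} {e : ℕ}
    (φ : ∀ i, (Fin (r (i + 1)) → A) →ₗ[A] (Fin (r i) → A))
    (hφ : ∀ i x, φ i (φ (i + 1) x) = 0) (hr : ∀ i, d < i → r i = 0)
    (hann : ∀ i, ∀ a ∈ maximalIdeal A ^ e, ∀ v, φ i v = 0 → ∃ w, φ (i + 1) w = a • v)
    (π : (Fin (r 0) → A) →ₗ[A] ResidueField A) (hπ : Function.Surjective π)
    (hker : LinearMap.ker π = LinearMap.range (φ 0)) :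
    ∃ z : Fin d → A, Function.Injective z ∧ Ideal.span (Set.range z) = maximalIdeal A := by
  obtain ⟨K, _, _, C, _, _, _, ψ, x, hfin, hinj, hψ, hx, s, hs⟩ :=
    exists_ringHom_finite_over_mvPowerSeries A hdim
  obtain ⟨n, N, D, rfl, hz⟩ := exists_koszulDatum φ hφ hr hann π hπ hker x hx hs
  have hnd : n ≤ d := D.le_of_finite_over_mvPowerSeries hinj ψ hr hψ
  have hle := ringKrullDim_le_ncard (Set.finite_range D.z) hz
  rw [hdim] at hle
  have hle : d ≤ (Set.range D.z).ncard := by exact_mod_cast hle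
  have himg : (Set.range D.z).ncard ≤ n := by
    rw [← Set.image_univ]
    exact (Set.ncard_image_le Set.finite_univ).trans (by simp)
  obtain rfl : n = d := by omega
  refine ⟨D.z, ?_, hz⟩
  have : Set.InjOn D.z Set.univ := by
    apply Set.injOn_of_ncard_image_eq _ Set.finite_univ
    rw [Set.image_univ, Set.ncard_univ, Nat.card_eq_fintype_card, Fintype.card_fin]
    omega
  exact Set.injOn_univ.mp this

theorem exact_of_annihilates_homology_of_regular {A : Type*} [CommRing A] [IsLocalRing A]
    [IsNoetherianRing A] {d : ℕ} (hdim : ringKrullDim A = d) {r : ℕ → ℕ} {e : ℕ}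
    (φ : ∀ i, (Fin (r (i + 1)) → A) →ₗ[A] (Fin (r i) → A))
    (hφ : ∀ i x, φ i (φ (i + 1) x) = 0) (hr : ∀ i, d < i → r i = 0)
    (hann₀ : ∀ a ∈ maximalIdeal A ^ e, ∀ v, ∃ w, φ 0 w = a • v)
    (hann : ∀ i, ∀ a ∈ maximalIdeal A ^ e, ∀ v, φ i v = 0 → ∃ w, φ (i + 1) w = a • v)
    (z : Fin d → A) (hz : Ideal.span (Set.range z) = maximalIdeal A)
    (i : ℕ) (v : Fin (r (i + 1)) → A) (hv : φ i v = 0) : ∃ w, φ (i + 1) w = v := by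
  have hN : ∀ i, d < i → Subsingleton (Fin (r i) → A) := by
    intro i hi
    have : IsEmpty (Fin (r i)) := by rw [hr i hi]; infer_instance
    infer_instance
  let y : ℕ → A := fun i ↦ if h : i < d then z ⟨i, h⟩ else 0
  have hy : y '' Set.Iio d = Set.range z := by
    ext a
    constructor
    · rintro ⟨i, hi, rfl⟩
      exact ⟨⟨i, hi⟩, by simp [y, Set.mem_Iio.mp hi]⟩
    · rintro ⟨i, rfl⟩
      exact ⟨i, i.2, by simp [y]⟩
  have hyspan : Ideal.span (y '' Set.Iio d) = maximalIdeal A := by rw [hy, hz]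
  have hymem : ∀ j < d, y j ^ e ∈ maximalIdeal A ^ e := fun j hj ↦
    Ideal.pow_mem_pow (hyspan ▸ Ideal.subset_span ⟨j, hj, rfl⟩) e
  have hhom : ∀ j < d, ∃ h : ∀ i, (Fin (r i) → A) →ₗ[A] (Fin (r (i + 1)) → A),
      ∀ i x, φ (i + 1) (h (i + 1) x) + h i (φ i x) = y j ^ ((e + 1) * (d + 1)) • x := by
    intro j hj
    have hmem : y j ^ (e + 1) ∈ maximalIdeal A ^ e := by
      rw [pow_succ]
      exact Ideal.mul_mem_right _ _ (hymem j hj)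
    simp only [pow_mul]
    exact exists_homotopy_of_annihilates_homology φ hφ hN (hann₀ _ hmem)
      (fun i ↦ hann i _ hmem)
  obtain ⟨w, hw⟩ := almost_exact_of_almost_regular d φ hφ hN
    (fun j ↦ y j ^ ((e + 1) * (d + 1))) 1 hhom
    (by
      intro j hj i a ha
      rw [mem_ideal_smul_top_pi_iff] at ha ⊢
      intro k
      rw [one_smul]
      exact mem_span_of_pow_mul_mem_span_of_regular hdim y hyspan (by positivity) hj (ha k))
    d 0 rfl i (Nat.zero_le _) v (by rw [hv]; exact zero_mem _)
  refine ⟨w, ?_⟩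
  have : (Set.Iio (0 : ℕ)) = ∅ := by ext; simp
  exact (sub_eq_zero.mp (by simpa [this] using hw)).symm

theorem exists_pow_maximalIdeal_smul_eq_zero {A : Type*} [CommRing A] [IsLocalRing A]
    {M : Type*} [AddCommGroup M] [Module A M] (h : IsFiniteLength A M) :
    ∃ e : ℕ, ∀ a ∈ maximalIdeal A ^ e, ∀ v : M, a • v = 0 := by
  induction h with
  | of_subsingleton => exact ⟨0, fun _ _ _ ↦ Subsingleton.elim _ _⟩
  | @of_simple_quotient M _ _ N hsimple _ ih =>
    obtain ⟨e, he⟩ := ih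
    have hmax : Module.annihilator A (M ⧸ N) = maximalIdeal A :=
      IsLocalRing.eq_maximalIdeal (IsSimpleModule.annihilator_isMaximal (R := A) (M := M ⧸ N))
    refine ⟨e + 1, fun a ha v ↦ ?_⟩
    rw [pow_succ] at ha
    induction ha using Submodule.mul_induction_on' with
    | mem_mul_mem b hb c hc =>
      have hcv : c • v ∈ N := by
        rw [← Submodule.Quotient.mk_eq_zero, Submodule.Quotient.mk_smul]
        exact Module.mem_annihilator.mp (hmax ▸ hc) _
      rw [mul_smul]
      exact congrArg Subtype.val (he b hb ⟨c • v, hcv⟩)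
    | add x _ y _ hx hy => rw [add_smul, hx, hy, add_zero]

open CategoryTheory in
theorem CategoryTheory.ShortComplex.exists_ker_linearMap_homology {A : Type*} [CommRing A]
    (S : ShortComplex (ModuleCat A)) :
    ∃ q : LinearMap.ker S.g.hom →ₗ[A] S.homology, Function.Surjective q ∧
      ∀ v, q v = 0 ↔ ∃ w, S.f.hom w = v := by
  let E : S.homology ≃ₗ[A] (LinearMap.ker S.g.hom ⧸ LinearMap.range S.moduleCatToCycles) :=
    S.moduleCatHomologyIso.toLinearEquiv
  refine ⟨E.symm.toLinearMap ∘ₗ (LinearMap.range S.moduleCatToCycles).mkQ,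
    E.symm.surjective.comp (Submodule.mkQ_surjective _), fun v ↦ ?_⟩
  rw [LinearMap.comp_apply, LinearEquiv.coe_coe, LinearEquiv.map_eq_zero_iff]
  exact (Submodule.Quotient.mk_eq_zero _).trans (exists_congr fun w ↦ Subtype.ext_iff)

open CategoryTheory in
theorem HomologicalComplex.exists_linearMap_homology {A : Type*} [CommRing A] {ι : Type*}
    {c : ComplexShape ι} (M : HomologicalComplex (ModuleCat A) c) {i j k : ι}
    (hi : c.prev j = i) (hk : c.next j = k) :
    ∃ q : LinearMap.ker (M.d j k).hom →ₗ[A] M.homology j, Function.Surjective q ∧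
      ∀ v, q v = 0 ↔ ∃ w, (M.d i j).hom w = v := by
  obtain ⟨q, hq, hq'⟩ := ShortComplex.exists_ker_linearMap_homology (M.sc' i j k)
  let E : (M.sc' i j k).homology ≃ₗ[A] M.homology j :=
    (M.homologyIsoSc' i j k hi hk).symm.toLinearEquiv
  have hE : ∀ x, E x = 0 ↔ x = 0 := fun x ↦ E.map_eq_zero_iff
  exact ⟨E.toLinearMap ∘ₗ q, E.surjective.comp hq, fun v ↦ (hE _).trans (hq' v)⟩

open CategoryTheory in
theorem ChainComplex.exists_linearMap_of_homology_zero_iso {A : Type*} [CommRing A]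
    (M : ChainComplex (ModuleCat A) ℕ) {k : ModuleCat A} (h : M.homology 0 ≅ k) :
    ∃ π : M.X 0 →ₗ[A] k, Function.Surjective π ∧
      ∀ v, π v = 0 ↔ ∃ w, (M.d 1 0).hom w = v := by
  obtain ⟨q, hq, hq'⟩ := HomologicalComplex.exists_linearMap_homology M
    (i := 1) (j := 0) (k := 0) (by simp) (by simp)
  let E : M.homology 0 ≃ₗ[A] k := h.toLinearEquiv
  let ι : M.X 0 →ₗ[A] LinearMap.ker (M.d 0 0).hom :=
    LinearMap.codRestrict _ LinearMap.id fun v ↦ by simp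
  have hι : Function.Surjective ι := fun v ↦ ⟨v, rfl⟩
  exact ⟨E.toLinearMap ∘ₗ q ∘ₗ ι, E.surjective.comp (hq.comp hι),
    fun v ↦ (E.map_eq_zero_iff).trans (hq' (ι v))⟩

end Rigidity

open CategoryTheory CategoryTheory.Limits

/-- The intersection theorem, rigidity part: if `0 → M_d → ⋯ → M_0 → 0` is a complex of
finitely generated free modules over a Noetherian local `ℂ`-algebra `A` of Krull
dimension `d`, whose homology modules all have finite length and with
`H_0(M) ≅ A/𝔪`, then `H_i(M) = 0` for all `i ≠ 0` and `A` is regular, i.e. its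
maximal ideal is generated by `d` elements. -/
theorem intersection_theorem_rigidity
    (A : Type) [CommRing A] [IsLocalRing A] [IsNoetherianRing A] [Algebra ℂ A]
    (d : ℕ) (hdim : ringKrullDim A = d)
    (M : ChainComplex (ModuleCat A) ℕ)
    (hconc : ∀ i, d < i → IsZero (M.X i))
    (hfree : ∀ i, Module.Finite A (M.X i) ∧ Module.Free A (M.X i))
    (hfl : ∀ i, IsFiniteLength A (M.homology i))
    (hH0 : Nonempty (M.homology 0 ≅ ModuleCat.of A (IsLocalRing.ResidueField A))) :
    (∀ i, i ≠ 0 → IsZero (M.homology i)) ∧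
    (∃ t : Finset A, t.card = d ∧
      Ideal.span (t : Set A) = IsLocalRing.maximalIdeal A) := by
  classical
  let _ : Algebra ℚ A := ((algebraMap ℂ A).comp (algebraMap ℚ ℂ)).toAlgebra
  have hfin : ∀ i, Module.Finite A (M.X i) := fun i ↦ (hfree i).1
  have hfr : ∀ i, Module.Free A (M.X i) := fun i ↦ (hfree i).2
  have hsub : ∀ i, d < i → Subsingleton (M.X i) := fun i hi ↦
    ModuleCat.subsingleton_of_isZero (hconc i hi)
  have hhom : ∀ i, ∃ e : ℕ, ∀ a ∈ IsLocalRing.maximalIdeal A ^ e, ∀ v : M.X (i + 1),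
      (M.d (i + 1) i).hom v = 0 → ∃ w, (M.d (i + 1 + 1) (i + 1)).hom w = a • v := by
    intro i
    obtain ⟨q, -, hq⟩ := HomologicalComplex.exists_linearMap_homology M
      (i := i + 1 + 1) (j := i + 1) (k := i) (by simp) (by simp)
    obtain ⟨e, he⟩ := exists_pow_maximalIdeal_smul_eq_zero (hfl (i + 1))
    refine ⟨e, fun a ha v hv ↦ (hq (a • ⟨v, hv⟩)).mp ?_⟩
    rw [map_smul, he a ha]
  choose e he using hhom
  let E : ℕ := 1 + ∑ i ∈ Finset.range d, e i
  have hE : ∀ i < d, e i ≤ E := fun i hi ↦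
    (Finset.single_le_sum (f := e) (fun _ _ ↦ Nat.zero_le _)
      (Finset.mem_range.mpr hi)).trans (Nat.le_add_left _ _)
  obtain ⟨h0⟩ := hH0
  obtain ⟨π, hπ, hker⟩ := ChainComplex.exists_linearMap_of_homology_zero_iso M h0
  let r : ℕ → ℕ := fun i ↦ Module.finrank A (M.X i)
  let b : ∀ i, M.X i ≃ₗ[A] (Fin (r i) → A) := fun i ↦ (Module.finBasis A (M.X i)).equivFun
  let φ : ∀ i, (Fin (r (i + 1)) → A) →ₗ[A] (Fin (r i) → A) := fun i ↦
    (b i).toLinearMap ∘ₗ (M.d (i + 1) i).hom ∘ₗ (b (i + 1)).symm.toLinearMap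
  have hφb : ∀ i v, φ i (b (i + 1) v) = b i ((M.d (i + 1) i).hom v) := fun i v ↦ by simp [φ]
  have hdd : ∀ i v, (M.d (i + 1) i).hom ((M.d (i + 1 + 1) (i + 1)).hom v) = 0 := fun i v ↦ by
    have := M.d_comp_d (i + 1 + 1) (i + 1) i
    exact congrArg (fun f ↦ f.hom v) this
  have hφ : ∀ i x, φ i (φ (i + 1) x) = 0 := by
    intro i x
    obtain ⟨v, rfl⟩ := (b _).surjective x
    rw [hφb, hφb, hdd, map_zero]
  have hr : ∀ i, d < i → r i = 0 := fun i hi ↦ by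
    have := hsub i hi
    exact Module.finrank_zero_of_subsingleton
  have hann : ∀ i, ∀ a ∈ IsLocalRing.maximalIdeal A ^ E, ∀ v, φ i v = 0 →
      ∃ w, φ (i + 1) w = a • v := by
    intro i a ha x hx
    obtain ⟨v, rfl⟩ := (b _).surjective x
    rw [hφb, LinearEquiv.map_eq_zero_iff] at hx
    by_cases hi : i < d
    · obtain ⟨w, hw⟩ := he i a (Ideal.pow_le_pow_right (hE i hi) ha) v hx
      exact ⟨b _ w, by rw [hφb, hw, map_smul]⟩
    · have := hsub (i + 1) (by omega)
      exact ⟨0, by rw [Subsingleton.elim v 0]; simp⟩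
  have hker' : LinearMap.ker (π ∘ₗ (b 0).symm.toLinearMap) = LinearMap.range (φ 0) := by
    ext x
    obtain ⟨v, rfl⟩ := (b _).surjective x
    simp only [LinearMap.mem_ker, LinearMap.comp_apply, LinearEquiv.coe_coe,
      LinearEquiv.symm_apply_apply, LinearMap.mem_range]
    rw [hker]
    constructor
    · rintro ⟨w, hw⟩
      exact ⟨b _ w, by rw [hφb, hw]⟩
    · rintro ⟨w, hw⟩
      obtain ⟨w, rfl⟩ := (b _).surjective w
      rw [hφb] at hw
      exact ⟨w, (b 0).injective hw⟩
  have hann₀ : ∀ a ∈ IsLocalRing.maximalIdeal A ^ E, ∀ x, ∃ w, φ 0 w = a • x := by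
    intro a ha x
    have ha' : a ∈ IsLocalRing.maximalIdeal A :=
      Ideal.pow_le_self (by omega) ha
    suffices a • x ∈ LinearMap.range (φ 0) from this
    rw [← hker', LinearMap.mem_ker, map_smul, Algebra.smul_def,
      IsLocalRing.ResidueField.algebraMap_eq, (IsLocalRing.residue_eq_zero_iff a).mpr ha',
      zero_mul]
  obtain ⟨z, hinj, hz⟩ := exists_generators_maximalIdeal_of_residueField_complex hdim φ hφ hr
    hann (π ∘ₗ (b 0).symm.toLinearMap) (hπ.comp (b 0).symm.surjective) hker'
  refine ⟨fun i hi ↦ ?_, Finset.univ.image z, ?_, by simpa using hz⟩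
  · obtain ⟨i, rfl⟩ := Nat.exists_eq_succ_of_ne_zero hi
    rw [← HomologicalComplex.exactAt_iff_isZero_homology,
      M.exactAt_iff' (i + 1 + 1) (i + 1) i (by simp) (by simp),
      ShortComplex.moduleCat_exact_iff]
    intro (v : M.X (i + 1)) (hv : (M.d (i + 1) i).hom v = 0)
    obtain ⟨w, hw⟩ := exact_of_annihilates_homology_of_regular hdim φ hφ hr hann₀ hann z hz i
      (b _ v) (by rw [hφb, hv, map_zero])
    obtain ⟨w, rfl⟩ := (b _).surjective w
    rw [hφb] at hw
    exact ⟨w, (b _).injective hw⟩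
  · rw [Finset.card_image_of_injective _ hinj, Finset.card_univ, Fintype.card_fin]
end

section
/- Let (A, 𝔪) be a commutative Noetherian local ring with residue field k = A/𝔪, and let C be an arbitrary A-module. Suppose that Tor_1^A(k, C) = 0 and that there exists a nonzero finite-length A-module N with Tor_p^A(N, C) = 0 for all p > 0. Then Tor_p^A(P, C) = 0 for all p > 0 and every finite-length A-module P; in particular Tor_p^A(k, C) = 0 for all p > 0. -/
open CategoryTheory CategoryTheory.Limits

section

universe u

variable {R : Type u} [CommRing R]

open MonoidalCategory

/-- The short complex of complexes obtained by tensoring a short complex of modules with a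
complex of modules. -/
noncomputable def CategoryTheory.ShortComplex.tensorComplex (S : ShortComplex (ModuleCat.{u} R))
    (K : ChainComplex (ModuleCat.{u} R) ℕ) :
    ShortComplex (ChainComplex (ModuleCat.{u} R) ℕ) where
  X₁ := (((tensoringLeft (ModuleCat.{u} R)).obj S.X₁).mapHomologicalComplex _).obj K
  X₂ := (((tensoringLeft (ModuleCat.{u} R)).obj S.X₂).mapHomologicalComplex _).obj K
  X₃ := (((tensoringLeft (ModuleCat.{u} R)).obj S.X₃).mapHomologicalComplex _).obj K
  f := (NatTrans.mapHomologicalComplex ((tensoringLeft (ModuleCat.{u} R)).map S.f) _).app K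
  g := (NatTrans.mapHomologicalComplex ((tensoringLeft (ModuleCat.{u} R)).map S.g) _).app K
  zero := by
    ext n : 1
    exact (S.map (tensorRight (K.X n))).zero

/-- Tensoring a short exact sequence with a complex of projective modules gives a short exact
sequence of complexes. -/
lemma CategoryTheory.ShortComplex.ShortExact.tensorComplex {S : ShortComplex (ModuleCat.{u} R)}
    (hS : S.ShortExact) (K : ChainComplex (ModuleCat.{u} R) ℕ) [∀ n, Projective (K.X n)] :
    (S.tensorComplex K).ShortExact := by
  refine HomologicalComplex.shortExact_of_degreewise_shortExact _ fun n ↦ ?_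
  have : Module.Projective R (K.X n) := (IsProjective.iff_projective (K.X n)).2 inferInstance
  exact hS.map_of_exact (tensorRight (K.X n))

/-- The vanishing of `Tor` in a fixed degree is stable under extensions in the first variable. -/
lemma isZero_Tor_obj_of_shortExact {S : ShortComplex (ModuleCat.{u} R)} (hS : S.ShortExact)
    (C : ModuleCat.{u} R) (n : ℕ)
    (h₁ : IsZero (((Tor (ModuleCat.{u} R) n).obj S.X₁).obj C))
    (h₃ : IsZero (((Tor (ModuleCat.{u} R) n).obj S.X₃).obj C)) :
    IsZero (((Tor (ModuleCat.{u} R) n).obj S.X₂).obj C) := by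
  let Q := projectiveResolution C
  exact (((hS.tensorComplex Q.complex).homology_exact₂ n).isZero_X₂
    ((h₁.of_iso (Q.isoLeftDerivedObj _ n).symm).eq_zero_of_src _)
    ((h₃.of_iso (Q.isoLeftDerivedObj _ n).symm).eq_zero_of_tgt _)).of_iso
      (Q.isoLeftDerivedObj _ n)

/-- Dimension shifting for the vanishing of `Tor` along a short exact sequence in the first
variable. -/
lemma isZero_Tor_succ_obj_of_shortExact {S : ShortComplex (ModuleCat.{u} R)} (hS : S.ShortExact)
    (C : ModuleCat.{u} R) (n : ℕ)
    (h₁ : IsZero (((Tor (ModuleCat.{u} R) n).obj S.X₁).obj C))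
    (h₂ : IsZero (((Tor (ModuleCat.{u} R) (n + 1)).obj S.X₂).obj C)) :
    IsZero (((Tor (ModuleCat.{u} R) (n + 1)).obj S.X₃).obj C) := by
  let Q := projectiveResolution C
  exact (((hS.tensorComplex Q.complex).homology_exact₃ (n + 1) n rfl).isZero_X₂
    ((h₂.of_iso (Q.isoLeftDerivedObj _ (n + 1)).symm).eq_zero_of_src _)
    ((h₁.of_iso (Q.isoLeftDerivedObj _ n).symm).eq_zero_of_tgt _)).of_iso
      (Q.isoLeftDerivedObj _ (n + 1))

/-- A submodule whose quotient is simple over a local ring is the kernel of a surjection onto the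
residue field. -/
lemma exists_shortExact_residueField [IsLocalRing R] {M : Type u} [AddCommGroup M] [Module R M]
    (N : Submodule R M) [IsSimpleModule R (M ⧸ N)] :
    ∃ (f : ModuleCat.of R N ⟶ ModuleCat.of R M)
      (g : ModuleCat.of R M ⟶ ModuleCat.of R (IsLocalRing.ResidueField R)) (w : f ≫ g = 0),
      (ShortComplex.mk f g w).ShortExact := by
  obtain ⟨I, hI, ⟨e⟩⟩ := isSimpleModule_iff_quot_maximal.mp ‹IsSimpleModule R (M ⧸ N)›
  obtain rfl := IsLocalRing.eq_maximalIdeal hI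
  let e' : (M ⧸ N) ≃ₗ[R] IsLocalRing.ResidueField R := e
  have hex : Function.Exact N.subtype (e'.toLinearMap ∘ₗ N.mkQ) := by
    rw [LinearMap.exact_iff]
    simp
  refine ⟨ModuleCat.ofHom N.subtype, ModuleCat.ofHom (e'.toLinearMap ∘ₗ N.mkQ),
    ModuleCat.hom_ext hex.linearMap_comp_eq_zero, ?_⟩
  exact
    { exact := (ShortComplex.ShortExact.moduleCat_exact_iff_function_exact _).2 hex
      mono_f := (ModuleCat.mono_iff_injective _).2 N.subtype_injective
      epi_g := (ModuleCat.epi_iff_surjective _).2 (e'.surjective.comp N.mkQ_surjective) }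

/-- `Tor` of a trivial module in the first variable vanishes. -/
lemma isZero_Tor_obj_of_isZero {X : ModuleCat.{u} R} (hX : IsZero X) (C : ModuleCat.{u} R)
    (n : ℕ) : IsZero (((Tor (ModuleCat.{u} R) n).obj X).obj C) := by
  let Q := projectiveResolution C
  refine IsZero.of_iso ?_ (Q.isoLeftDerivedObj _ n)
  refine (HomologicalComplex.homologyFunctor _ _ n).map_isZero ?_
  rw [IsZero.iff_id_eq_zero]
  ext i : 1
  exact ((tensorRight (Q.complex.X i)).map_isZero hX).eq_of_src _ _

/-- If `Tor n` of the residue field vanishes, so does `Tor n` of every module of finite length. -/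
lemma isZero_Tor_obj_of_isFiniteLength [IsLocalRing R] (C : ModuleCat.{u} R) (n : ℕ)
    (h : IsZero (((Tor (ModuleCat.{u} R) n).obj
      (ModuleCat.of R (IsLocalRing.ResidueField R))).obj C))
    {P : Type u} [AddCommGroup P] [Module R P] (hP : IsFiniteLength R P) :
    IsZero (((Tor (ModuleCat.{u} R) n).obj (ModuleCat.of R P)).obj C) := by
  induction hP with
  | of_subsingleton => exact isZero_Tor_obj_of_isZero (ModuleCat.isZero_of_subsingleton _) C n
  | @of_simple_quotient M _ _ N _ _ ih =>
    obtain ⟨f, g, w, hS⟩ := exists_shortExact_residueField N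
    exact isZero_Tor_obj_of_shortExact hS C n ih h

end

/-- If `C` is a module over a Noetherian local ring `A` with `Tor_1(k, C) = 0` and there
exists a nonzero finite-length module `N` with `Tor_p(N, C) = 0` for all `p > 0`, then
`Tor_p(P, C) = 0` for all `p > 0` and every finite-length module `P`; in particular
`Tor_p(k, C) = 0` for all `p > 0`. -/
theorem tor_vanishing_finite_length
    (A : Type) [CommRing A] [IsLocalRing A] [IsNoetherianRing A]
    (C : Type) [AddCommGroup C] [Module A C]
    (N : Type) [AddCommGroup N] [Module A N]
    (hNfl : IsFiniteLength A N) (hN0 : Nontrivial N)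
    (hTor1 : IsZero (((Tor (ModuleCat A) 1).obj
      (ModuleCat.of A (IsLocalRing.ResidueField A))).obj (ModuleCat.of A C)))
    (hTorN : ∀ p, 0 < p →
      IsZero (((Tor (ModuleCat A) p).obj (ModuleCat.of A N)).obj (ModuleCat.of A C))) :
    (∀ (P : Type) [AddCommGroup P] [Module A P], IsFiniteLength A P →
      ∀ p, 0 < p →
        IsZero (((Tor (ModuleCat A) p).obj (ModuleCat.of A P)).obj (ModuleCat.of A C))) ∧
    (∀ p, 0 < p → IsZero (((Tor (ModuleCat A) p).obj
      (ModuleCat.of A (IsLocalRing.ResidueField A))).obj (ModuleCat.of A C))) := by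
  have key (p : ℕ) : IsZero (((Tor (ModuleCat A) (p + 1)).obj
      (ModuleCat.of A (IsLocalRing.ResidueField A))).obj (ModuleCat.of A C)) := by
    induction p with
    | zero => exact hTor1
    | succ p ih =>
      cases hNfl with
      | of_subsingleton => exact (not_subsingleton N ‹_›).elim
      | @of_simple_quotient _ _ _ K _ hK =>
        obtain ⟨f, g, w, hS⟩ := exists_shortExact_residueField K
        exact isZero_Tor_succ_obj_of_shortExact hS _ (p + 1)
          (isZero_Tor_obj_of_isFiniteLength _ _ ih hK) (hTorN _ (Nat.succ_pos _))
  refine ⟨fun P _ _ hP p hp ↦ ?_, fun p hp ↦ ?_⟩ <;>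
    obtain ⟨p, rfl⟩ := Nat.exists_eq_succ_of_ne_zero hp.ne'
  · exact isZero_Tor_obj_of_isFiniteLength _ _ (key p) hP
  · exact key p
end

section
/- Let A be a commutative Noetherian ring and let E be a chain complex of finitely generated projective A-modules with E_i = 0 for all i < 0 (so E has the form ⋯ → E_1 → E_0 → 0). Let s ≥ 0 be an integer and suppose that for every maximal ideal 𝔪 of A, the complex E ⊗_A A/𝔪 (obtained by applying the functor − ⊗_A A/𝔪 termwise) satisfies H_i(E ⊗_A A/𝔪) = 0 unless 0 ≤ i ≤ s. Then there exist a chain complex L of finitely generated projective A-modules with L_i = 0 unless 0 ≤ i ≤ s and a quasi-isomorphism of complexes E → L. In particular E is quasi-isomorphic to a complex of projective modules of length s. -/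
open CategoryTheory CategoryTheory.Limits CategoryTheory.MonoidalCategory

section ResidueFieldCriterion

open TensorProduct

variable {A M N P : Type*} [CommRing A] [AddCommGroup M] [Module A M]
  [AddCommGroup N] [Module A N] [AddCommGroup P] [Module A P]

/-- If `f ⊗ A/m` is injective for a maximal ideal `m`, then so is the reduction of the
localization of `f` at `m` modulo the maximal ideal of `A_m`. -/
theorem LinearMap.lTensor_residueField_baseChange_injective (m : Ideal A) [m.IsMaximal]
    (f : N →ₗ[A] P) (hf : Function.Injective (f.rTensor (A ⧸ m))) :
    Function.Injective ((f.baseChange (Localization.AtPrime m)).lTensor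
      (IsLocalRing.ResidueField (Localization.AtPrime m))) := by
  let κ := IsLocalRing.ResidueField (Localization.AtPrime m)
  have hκ : Function.Bijective (algebraMap (A ⧸ m) m.ResidueField) :=
    m.bijective_algebraMap_quotient_residueField
  let eκ : (A ⧸ m) ≃ₗ[A] κ :=
    LinearEquiv.ofBijective (IsScalarTower.toAlgHom A (A ⧸ m) m.ResidueField).toLinearMap hκ
  have hlf : Function.Injective (f.lTensor κ) := by
    have h : f.lTensor κ ∘ₗ (eκ.lTensor N ≪≫ₗ TensorProduct.comm A N κ).toLinearMap =
        (eκ.lTensor P ≪≫ₗ TensorProduct.comm A P κ).toLinearMap ∘ₗ f.rTensor (A ⧸ m) := by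
      ext; simp
    have h' : Function.Injective
        (f.lTensor κ ∘ (eκ.lTensor N ≪≫ₗ TensorProduct.comm A N κ)) := by
      have := (eκ.lTensor P ≪≫ₗ TensorProduct.comm A P κ).injective.comp hf
      convert this using 1
      exact congrArg DFunLike.coe h
    exact (Function.Injective.of_comp_iff' _
      (eκ.lTensor N ≪≫ₗ TensorProduct.comm A N κ).bijective).mp h'
  have h := AlgebraTensorModule.lTensor_comp_cancelBaseChange A (Localization.AtPrime m)
    (Localization.AtPrime m) (M := κ) f
  have h' : Function.Injective (AlgebraTensorModule.cancelBaseChange A (Localization.AtPrime m)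
      (Localization.AtPrime m) κ P ∘ ((f.baseChange (Localization.AtPrime m)).lTensor κ)) := by
    have := Function.Injective.comp hlf (AlgebraTensorModule.cancelBaseChange A
      (Localization.AtPrime m) (Localization.AtPrime m) κ N).injective
    convert this using 1
    exact (congrArg DFunLike.coe h).symm
  exact h'.of_comp

variable [Module.Finite A N] [Module.Finite A P] [Module.Projective A P]

/-- A linear map from a finite module to a finite projective module which is
injective modulo every maximal ideal is injective. -/
theorem LinearMap.injective_of_forall_rTensor_quotient_injective (f : N →ₗ[A] P)
    (hf : ∀ m : Ideal A, m.IsMaximal → Function.Injective (f.rTensor (A ⧸ m))) :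
    Function.Injective f := by
  refine injective_of_isLocalized_maximal
    (fun m _ ↦ Localization.AtPrime m ⊗[A] N)
    (fun m _ ↦ TensorProduct.mk A (Localization.AtPrime m) N 1)
    (fun m _ ↦ Localization.AtPrime m ⊗[A] P)
    (fun m _ ↦ TensorProduct.mk A (Localization.AtPrime m) P 1) f fun m hm ↦ ?_
  have := Module.free_of_flat_of_isLocalRing (R := Localization.AtPrime m)
    (P := Localization.AtPrime m ⊗[A] P)
  obtain ⟨l, hl⟩ := (IsLocalRing.split_injective_iff_lTensor_residueField_injective
    (f.baseChange (Localization.AtPrime m))).mpr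
    (f.lTensor_residueField_baseChange_injective m (hf m hm))
  have hinj : Function.Injective (f.baseChange (Localization.AtPrime m)) :=
    Function.LeftInverse.injective (g := l) (LinearMap.congr_fun hl)
  have hmap : IsLocalizedModule.map m.primeCompl
      (TensorProduct.mk A (Localization.AtPrime m) N 1)
      (TensorProduct.mk A (Localization.AtPrime m) P 1) f =
      (f.baseChange (Localization.AtPrime m)).restrictScalars A := by
    apply IsLocalizedModule.ext m.primeCompl (TensorProduct.mk A (Localization.AtPrime m) N 1)
    · exact IsLocalizedModule.map_units (TensorProduct.mk A (Localization.AtPrime m) P 1)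
    · ext x
      simp [-TensorProduct.mk_apply, IsLocalizedModule.map_apply]
      simp
  rw [hmap]
  exact hinj

/-- The cokernel of a linear map from a finite module to a finite projective module which is
injective modulo every maximal ideal is projective. -/
theorem Module.projective_quotient_range_of_forall_rTensor_quotient_injective (f : N →ₗ[A] P)
    (hf : ∀ m : Ideal A, m.IsMaximal → Function.Injective (f.rTensor (A ⧸ m))) :
    Module.Projective A (P ⧸ LinearMap.range f) := by
  have := Module.finitePresentation_of_projective A P
  have := Module.finitePresentation_of_surjective (LinearMap.range f).mkQ
    (Submodule.mkQ_surjective _) (by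
      rw [Submodule.ker_mkQ, LinearMap.range_eq_map]
      exact Module.Finite.fg_top.map f)
  refine Module.projective_of_localization_maximal'
    (fun m _ ↦ Localization.AtPrime m)
    (fun m _ ↦ Localization.AtPrime m ⊗[A] (P ⧸ LinearMap.range f))
    (fun m _ ↦ TensorProduct.mk A (Localization.AtPrime m) _ 1) fun m hm ↦ ?_
  have := Module.free_of_flat_of_isLocalRing (R := Localization.AtPrime m)
    (P := Localization.AtPrime m ⊗[A] P)
  have hfree := Module.free_of_lTensor_residueField_injective
    (f.baseChange (Localization.AtPrime m))
    ((LinearMap.range f).mkQ.baseChange (Localization.AtPrime m))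
    (LinearMap.lTensor_surjective _ (Submodule.mkQ_surjective _))
    (lTensor_exact _ f.exact_map_mkQ_range (Submodule.mkQ_surjective _))
    (f.lTensor_residueField_baseChange_injective m (hf m hm))
  infer_instance

/-- If `M → N → P` is a complex with `N` finite and `P` finite projective,
and it is exact at `N` modulo every maximal ideal, then it is exact at `N` and the cokernel of
`N → P` is projective. -/
theorem LinearMap.exact_and_projective_of_forall_rTensor_quotient_exact
    (f : M →ₗ[A] N) (g : N →ₗ[A] P) (hfg : g ∘ₗ f = 0)
    (h : ∀ m : Ideal A, m.IsMaximal →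
      Function.Exact (f.rTensor (A ⧸ m)) (g.rTensor (A ⧸ m))) :
    Function.Exact f g ∧ Module.Projective A (P ⧸ LinearMap.range g) := by
  let g' : (N ⧸ LinearMap.range f) →ₗ[A] P :=
    (LinearMap.range f).liftQ g (LinearMap.range_le_ker_iff.mpr hfg)
  have hg' : g' ∘ₗ (LinearMap.range f).mkQ = g := Submodule.liftQ_mkQ _ _ _
  have hinj (m : Ideal A) (hm : m.IsMaximal) : Function.Injective (g'.rTensor (A ⧸ m)) := by
    rw [injective_iff_map_eq_zero]
    intro x hx
    obtain ⟨y, rfl⟩ := LinearMap.rTensor_surjective (A ⧸ m)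
      (Submodule.mkQ_surjective (LinearMap.range f)) x
    rw [← LinearMap.comp_apply, ← LinearMap.rTensor_comp, hg'] at hx
    obtain ⟨z, rfl⟩ := (h m hm y).mp hx
    exact (rTensor_exact (A ⧸ m) f.exact_map_mkQ_range
      (Submodule.mkQ_surjective _)).apply_apply_eq_zero z
  refine ⟨?_, ?_⟩
  · have := g'.injective_of_forall_rTensor_quotient_injective hinj
    rw [← hg', LinearMap.exact_iff, LinearMap.ker_comp, LinearMap.ker_eq_bot.mpr this,
      Submodule.comap_bot, Submodule.ker_mkQ]
  · have hrange : LinearMap.range g' = LinearMap.range g := Submodule.range_liftQ _ _ _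
    rw [← hrange]
    exact Module.projective_quotient_range_of_forall_rTensor_quotient_injective g' hinj

end ResidueFieldCriterion

/-- The complex shape on the degrees `0, …, s` with differentials lowering the degree by one. -/
def ComplexShape.downLE (s : ℕ) : ComplexShape {i : ℕ // i ≤ s} where
  Rel i j := j.1 + 1 = i.1
  next_eq h h' := Subtype.ext (by omega)
  prev_eq h h' := Subtype.ext (by omega)

/-- The inclusion of the degrees `0, …, s` into the indices of chain complexes. -/
def ComplexShape.embeddingDownLE (s : ℕ) : (downLE s).Embedding (down ℕ) where
  f := Subtype.val
  injective_f := Subtype.val_injective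
  rel h := h

instance (s : ℕ) : (ComplexShape.embeddingDownLE s).IsTruncGE where
  rel' _ _ h := h
  mem_next {j k'} h := ⟨⟨k', by
    have h' : k' + 1 = j.1 := h
    have := j.2
    omega⟩, rfl⟩

/-- The boundary of `embeddingDownLE s` is the degree `s`. -/
theorem ComplexShape.eq_of_boundaryGE_embeddingDownLE {s : ℕ} {i : {i : ℕ // i ≤ s}}
    (hi : (embeddingDownLE s).BoundaryGE i) : i.1 = s := by
  by_contra h
  exact hi.notMem (i' := i.1 + 1) rfl ⟨i.1 + 1, by have := i.2; omega⟩ rfl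

/-- Exactness of a chain complex of modules at `i + 1`, in terms of the underlying maps. -/
theorem ChainComplex.exactAt_succ_iff_function_exact {A : Type*} [Ring A]
    (E : ChainComplex (ModuleCat A) ℕ) (i : ℕ) :
    E.ExactAt (i + 1) ↔ Function.Exact (E.d (i + 2) (i + 1)).hom (E.d (i + 1) i).hom := by
  rw [E.exactAt_iff' (i + 2) (i + 1) i (by simp) (by simp),
    ShortComplex.ShortExact.moduleCat_exact_iff_function_exact]
  rfl

/-- If `E` is a non-negatively graded complex of finitely generated projective modules
over a Noetherian ring `A` such that for every maximal ideal `𝔪` the homology of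
`E ⊗ A/𝔪` vanishes outside degrees `0,…,s`, then `E` is quasi-isomorphic to a complex
of finitely generated projective modules concentrated in degrees `0,…,s`. -/
theorem quasiIso_to_truncated_complex
    (A : Type) [CommRing A] [IsNoetherianRing A]
    (E : ChainComplex (ModuleCat A) ℕ)
    (hproj : ∀ i, Module.Finite A (E.X i) ∧ Module.Projective A (E.X i))
    (s : ℕ)
    (hvanish : ∀ (m : Ideal A), m.IsMaximal → ∀ i, s < i →
      IsZero ((((tensorRight (ModuleCat.of A (A ⧸ m))).mapHomologicalComplex
        (ComplexShape.down ℕ)).obj E).homology i)) :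
    ∃ (L : ChainComplex (ModuleCat A) ℕ) (f : E ⟶ L),
      (∀ i, Module.Finite A (L.X i) ∧ Module.Projective A (L.X i)) ∧
      (∀ i, s < i → IsZero (L.X i)) ∧
      QuasiIso f := by
  have hfin (i : ℕ) := (hproj i).1
  have hpr (i : ℕ) := (hproj i).2
  have key (i : ℕ) (hi : s ≤ i) :
      Function.Exact (E.d (i + 2) (i + 1)).hom (E.d (i + 1) i).hom ∧
        Module.Projective A (E.X i ⧸ LinearMap.range (E.d (i + 1) i).hom) := by
    refine LinearMap.exact_and_projective_of_forall_rTensor_quotient_exact _ _ ?_ fun m hm ↦ ?_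
    · rw [← ModuleCat.hom_comp, E.d_comp_d, ModuleCat.hom_zero]
    · exact (ChainComplex.exactAt_succ_iff_function_exact _ i).mp
        ((HomologicalComplex.exactAt_iff_isZero_homology _ _).mpr
          (hvanish m hm (i + 1) (by omega)))
  have hopcycles : Module.Finite A (E.opcycles s) ∧ Module.Projective A (E.opcycles s) := by
    have := (key s le_rfl).2
    have hd : LinearMap.range (E.d (s + 1) s).hom =
        LinearMap.range (E.d ((ComplexShape.down ℕ).prev s) s).hom := by
      rw [ChainComplex.prev]
    have e : (E.X s ⧸ LinearMap.range (E.d (s + 1) s).hom) ≃ₗ[A] E.opcycles s :=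
      (Submodule.quotEquivOfEq _ _ hd).trans
        (E.sc s).moduleCatOpcyclesIso.toLinearEquiv.symm
    exact ⟨Module.Finite.equiv e, Module.Projective.of_equiv e⟩
  let e := ComplexShape.embeddingDownLE s
  refine ⟨E.truncGE e, E.πTruncGE e, fun i ↦ ?_, fun i hi ↦ ?_, ?_⟩
  · by_cases his : i ≤ s
    · by_cases hb : e.BoundaryGE ⟨i, his⟩
      · obtain rfl : i = s := ComplexShape.eq_of_boundaryGE_embeddingDownLE hb
        have := hopcycles.1
        have := hopcycles.2
        have l := (E.truncGEXIsoOpcycles e (i' := i) rfl hb).toLinearEquiv.symm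
        exact ⟨Module.Finite.equiv l, Module.Projective.of_equiv l⟩
      · have l := (E.truncGEXIso e (i' := i) rfl hb).toLinearEquiv.symm
        exact ⟨Module.Finite.equiv l, Module.Projective.of_equiv l⟩
    · have := ModuleCat.subsingleton_of_isZero ((E.truncGE e).isZero_X_of_isStrictlySupported e i
        fun j hj ↦ his (hj ▸ j.2))
      exact ⟨inferInstance, inferInstance⟩
  · exact (E.truncGE e).isZero_X_of_isStrictlySupported e i
      fun j hj ↦ absurd hi (not_lt.mpr (hj ▸ j.2))
  · rw [HomologicalComplex.quasiIso_πTruncGE_iff_isSupported]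
    refine ⟨fun i hi ↦ ?_⟩
    have his : s < i := lt_of_not_ge fun h ↦ hi ⟨i, h⟩ rfl
    obtain ⟨i, rfl⟩ : ∃ j, i = j + 1 := ⟨i - 1, by omega⟩
    exact (E.exactAt_succ_iff_function_exact i).mpr (key i (by omega)).1
end
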